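/- arXiv:1902.06577 — 5 statements merged into one kernel-verified Lean document; each statement's English description precedes it below -/
import Mathlib

section
/- If k ≥ 3 and 2k ≤ n, then the ring R/I_{n,k} does not satisfy Serre's condition (S₂); more precisely, for the prime ideal P = P_F + P_{F'} with F = {1,…,k} and F' = {k+1,…,2k}, the localization (R/I_{n,k})_P has depth 1 while its Krull dimension is k − 1 ≥ 2. -/
open MvPolynomial

/-- `T : Fin n → ℕ × ℕ` is a Young tableau of shape given by the list `parts` of row
lengths: `T` is a bijection from `{0, …, n-1}` onto the set of boxes `(r, c)`
(row `r`, column `c`, both 0-indexed) of the Young diagram of `parts`. -/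
def IsTableau (parts : List ℕ) {n : ℕ} (T : Fin n → ℕ × ℕ) : Prop :=
  Function.Injective T ∧
  (∀ i : Fin n, (T i).1 < parts.length ∧ (T i).2 < parts.getD (T i).1 0) ∧
  (∀ r c : ℕ, r < parts.length → c < parts.getD r 0 → ∃ i : Fin n, T i = (r, c))

/-- The Specht polynomial `f_T` of a tableau `T`: the product over all columns `j` of
`∏_{1 ≤ s < t ≤ m} (x_{j_s} - x_{j_t})`, where `j_1, …, j_m` are the entries of column `j`
from top to bottom; equivalently, the product of `X i - X j` over all pairs of entries
`i, j` lying in the same column with `i` strictly above `j`. -/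
noncomputable def spechtPoly (K : Type*) [CommRing K] {n : ℕ} (T : Fin n → ℕ × ℕ) :
    MvPolynomial (Fin n) K :=
  ∏ p ∈ Finset.univ.filter
      (fun p : Fin n × Fin n => (T p.1).2 = (T p.2).2 ∧ (T p.1).1 < (T p.2).1),
    (X p.1 - X p.2)

/-- The Specht ideal of shape `parts`: the ideal of `K[x_1, …, x_n]` generated by all
Specht polynomials of Young tableaux of shape `parts`. -/
noncomputable def spechtIdeal (K : Type*) [CommRing K] (n : ℕ) (parts : List ℕ) :
    Ideal (MvPolynomial (Fin n) K) :=
  Ideal.span {f | ∃ T : Fin n → ℕ × ℕ, IsTableau parts T ∧ f = spechtPoly K T}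

/-- The ideal `P_F = (x_i - x_j ∣ i, j ∈ F)`. -/
noncomputable def PFIdeal (K : Type*) [CommRing K] {n : ℕ} (F : Finset (Fin n)) :
    Ideal (MvPolynomial (Fin n) K) :=
  Ideal.span {f | ∃ i ∈ F, ∃ j ∈ F, f = X i - X j}

/-- The ideal `I_{n,k} = ⋂_{F ⊆ [n], #F = k} P_F`. -/
noncomputable def InkIdeal (K : Type*) [CommRing K] (n k : ℕ) :
    Ideal (MvPolynomial (Fin n) K) :=
  ⨅ F ∈ {F : Finset (Fin n) | F.card = k}, PFIdeal K F

/-- The depth of a (local) commutative ring: the supremum of the lengths of regular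
sequences contained in the Jacobson radical (which is the maximal ideal when the ring
is local). -/
noncomputable def ringDepth (A : Type*) [CommRing A] : ℕ∞ :=
  ⨆ rs : {rs : List A // (∀ r ∈ rs, r ∈ (⊥ : Ideal A).jacobson) ∧
      RingTheory.Sequence.IsRegular A rs}, (rs.1.length : ℕ∞)

/-- A commutative ring is Cohen–Macaulay if the localization at every prime ideal has
depth equal to its Krull dimension. -/
def IsCohenMacaulayRing (A : Type*) [CommRing A] : Prop :=
  ∀ (P : Ideal A) [P.IsPrime],
    (ringDepth (Localization.AtPrime P) : WithBot ℕ∞) = ringKrullDim (Localization.AtPrime P)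

open scoped Pointwise in
/-- A local ring which is the union of two irreducible components, neither containing the other,
that meet scheme-theoretically in the closed point has depth one. -/
theorem ringDepth_eq_one_of_inf_eq_bot_of_sup_eq {A : Type*} [CommRing A] [IsLocalRing A]
    {p q : Ideal A} (hp : p.IsPrime) (hq : q.IsPrime) (hpq : ¬ p ≤ q) (hqp : ¬ q ≤ p)
    (hinf : p ⊓ q = ⊥) (hsup : p ⊔ q = IsLocalRing.maximalIdeal A) : ringDepth A = 1 := by
  have hzero {x : A} (hxp : x ∈ p) (hxq : x ∈ q) : x = 0 := by
    rw [← Ideal.mem_bot, ← hinf]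
    exact ⟨hxp, hxq⟩
  obtain ⟨u, hup, huq⟩ := SetLike.not_le_iff_exists.mp hpq
  obtain ⟨v, hvq, hvp⟩ := SetLike.not_le_iff_exists.mp hqp
  apply le_antisymm
  · refine iSup_le ?_
    rintro ⟨rs, hjac, hreg⟩
    match rs, hjac, hreg with
    | [], _, _ => simp
    | [_], _, _ => simp
    | a :: b :: t, hjac, hreg =>
      exfalso
      rw [IsLocalRing.jacobson_eq_maximalIdeal ⊥ bot_ne_top] at hjac
      rw [RingTheory.Sequence.isRegular_cons_iff, RingTheory.Sequence.isRegular_cons_iff] at hreg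
      obtain ⟨ha, hb, -⟩ := hreg
      have ham : a ∈ p ⊔ q := hsup ▸ hjac a (by simp)
      have hbm : b ∈ p ⊔ q := hsup ▸ hjac b (by simp)
      obtain ⟨y, hy, z, hz, rfl⟩ := Submodule.mem_sup.mp ham
      obtain ⟨s, hs, w, hw, rfl⟩ := Submodule.mem_sup.mp hbm
      have hyz : y * z = 0 := hzero (p.mul_mem_right _ hy) (q.mul_mem_left _ hz)
      have hsz : s * z = 0 := hzero (p.mul_mem_right _ hs) (q.mul_mem_left _ hz)
      have hwy : w * y = 0 := hzero (p.mul_mem_left _ hy) (q.mul_mem_right _ hw)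
      have hy_mem : y ∈ (y + z) • (⊤ : Submodule A A) := by
        rw [← Submodule.Quotient.mk_eq_zero]
        refine hb.right_eq_zero_of_smul ?_
        rw [← Submodule.Quotient.mk_smul, Submodule.Quotient.mk_eq_zero,
          Submodule.mem_smul_pointwise_iff_exists]
        refine ⟨s, Submodule.mem_top, ?_⟩
        simp only [smul_eq_mul]
        linear_combination hsz - hwy
      obtain ⟨c, -, hc⟩ := (Submodule.mem_smul_pointwise_iff_exists _ _ _).mp hy_mem
      rw [smul_eq_mul] at hc
      have hzc : z * c = 0 := by
        refine hzero ?_ (q.mul_mem_right _ hz)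
        have : z * c = y * (1 - c) := by linear_combination hc
        exact this ▸ p.mul_mem_right _ hy
      have hyc : y * (1 - c) = 0 := by linear_combination hzc - hc
      rcases IsLocalRing.isUnit_or_isUnit_one_sub_self c with h | h
      · have hz0 : z = 0 := h.mul_left_eq_zero.mp hzc
        have : v = 0 := ha.right_eq_zero_of_smul (by
          rw [smul_eq_mul, hz0, add_zero]
          exact hzero (p.mul_mem_right _ hy) (q.mul_mem_left _ hvq))
        exact hvp (this ▸ p.zero_mem)
      · have hy0 : y = 0 := h.mul_left_eq_zero.mp hyc
        have : u = 0 := ha.right_eq_zero_of_smul (by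
          rw [smul_eq_mul, hy0, zero_add]
          exact hzero (p.mul_mem_left _ hup) (q.mul_mem_right _ hz))
        exact huq (this ▸ q.zero_mem)
  · have hmem : u + v ∈ IsLocalRing.maximalIdeal A :=
      hsup ▸ add_mem (Ideal.mem_sup_left hup) (Ideal.mem_sup_right hvq)
    have hreg : IsSMulRegular A (u + v) := by
      rw [isSMulRegular_iff_right_eq_zero_of_smul]
      intro c hc
      rw [smul_eq_mul] at hc
      have hcp : c ∈ p := by
        refine (hp.mem_or_mem (x := u + v) (hc ▸ p.zero_mem)).resolve_left fun h ↦ hvp ?_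
        exact (p.add_mem_iff_right hup).mp h
      have hcq : c ∈ q := by
        refine (hq.mem_or_mem (x := u + v) (hc ▸ q.zero_mem)).resolve_left fun h ↦ huq ?_
        exact (q.add_mem_iff_left hvq).mp h
      exact hzero hcp hcq
    refine le_iSup_of_le ⟨[u + v], ?_, ?_⟩ (by simp)
    · simpa [IsLocalRing.jacobson_eq_maximalIdeal ⊥ bot_ne_top] using hmem
    · refine ⟨(RingTheory.Sequence.isWeaklyRegular_singleton_iff _ _).mpr hreg, ?_⟩
      rw [Ideal.ofList_singleton, smul_eq_mul, Ideal.mul_top]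
      exact fun h ↦ (IsLocalRing.mem_maximalIdeal _).mp hmem
        (Ideal.span_singleton_eq_top.mp h.symm)

/-- Localizing at the sum of two incomparable primes gives a ring of depth one whenever the
intersection of the two primes vanishes in the localization. -/
theorem ringDepth_localization_sup_eq_one {B : Type*} [CommRing B] {p q Q : Ideal B}
    [Q.IsPrime] (hp : p.IsPrime) (hq : q.IsPrime) (hpq : ¬ p ≤ q) (hqp : ¬ q ≤ p)
    (hsup : p ⊔ q = Q) {s : B} (hs : s ∉ Q) (hinf : ∀ x ∈ p, x ∈ q → s * x = 0) :
    ringDepth (Localization.AtPrime Q) = 1 := by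
  have hdisj {I : Ideal B} (hI : I ≤ Q) : Disjoint (Q.primeCompl : Set B) (I : Set B) :=
    Set.disjoint_left.mpr fun x hx hxI ↦ hx (hI hxI)
  have hdp := hdisj (hsup ▸ le_sup_left : p ≤ Q)
  have hdq := hdisj (hsup ▸ le_sup_right : q ≤ Q)
  have hle {I J : Ideal B} (hJ : J.IsPrime) (hdJ : Disjoint (Q.primeCompl : Set B) (J : Set B))
      (h : I.map (algebraMap B (Localization.AtPrime Q)) ≤
        J.map (algebraMap B (Localization.AtPrime Q))) : I ≤ J := by
    rw [Ideal.map_le_iff_le_comap] at h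
    exact h.trans_eq (IsLocalization.under_map_of_isPrime_disjoint Q.primeCompl _ hJ hdJ)
  refine ringDepth_eq_one_of_inf_eq_bot_of_sup_eq
    (IsLocalization.isPrime_of_isPrime_disjoint Q.primeCompl _ p hp hdp)
    (IsLocalization.isPrime_of_isPrime_disjoint Q.primeCompl _ q hq hdq)
    (fun h ↦ hpq (hle hq hdq h)) (fun h ↦ hqp (hle hp hdp h)) ?_ ?_
  · rw [← IsLocalization.map_inf Q.primeCompl, eq_bot_iff, Ideal.map_le_iff_le_comap]
    rintro x ⟨hxp, hxq⟩
    rw [Ideal.mem_comap, Ideal.mem_bot, IsLocalization.map_eq_zero_iff Q.primeCompl]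
    exact ⟨⟨s, hs⟩, hinf x hxp hxq⟩
  · rw [← Ideal.map_sup, hsup, Localization.AtPrime.map_eq_maximalIdeal]

/-- The kernel of a renaming of variables is generated by the differences of identified
variables. -/
theorem ker_rename_eq_span (K : Type*) [CommRing K] {σ τ : Type*} (f : σ → τ) :
    RingHom.ker (rename f : MvPolynomial σ K →ₐ[K] MvPolynomial τ K) =
      Ideal.span {g | ∃ i j, f i = f j ∧ g = X i - X j} := by
  apply le_antisymm
  · rcases isEmpty_or_nonempty σ with hσ | hσ
    · intro g hg
      rw [(RingHom.injective_iff_ker_eq_bot (rename f : MvPolynomial σ K →ₐ[K] MvPolynomial τ K)).mp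
        (rename_injective f (Function.injective_of_subsingleton f))] at hg
      rw [Ideal.mem_bot.mp hg]
      exact zero_mem _
    · intro g hg
      set J : Ideal (MvPolynomial σ K) := Ideal.span {g | ∃ i j, f i = f j ∧ g = X i - X j}
      have hcomp : (Ideal.Quotient.mkₐ K J).comp
          ((rename (Function.invFun f)).comp (rename f)) = Ideal.Quotient.mkₐ K J := by
        ext i
        simp only [AlgHom.comp_apply, rename_X, Ideal.Quotient.mkₐ_eq_mk]
        rw [Ideal.Quotient.eq]
        exact Ideal.subset_span ⟨_, _, Function.invFun_eq ⟨i, rfl⟩, rfl⟩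
      rw [← Ideal.Quotient.eq_zero_iff_mem, ← Ideal.Quotient.mkₐ_eq_mk K, ← hcomp,
        AlgHom.comp_apply, AlgHom.comp_apply, (RingHom.mem_ker).mp hg, map_zero, map_zero]
  · rw [Ideal.span_le]
    rintro _ ⟨i, j, hij, rfl⟩
    simp [RingHom.mem_ker, hij]

section PFIdeal

variable (K : Type*) [Field K] {n : ℕ} {F G H : Finset (Fin n)}

theorem X_sub_X_mem_PFIdeal {i j : Fin n} (hi : i ∈ F) (hj : j ∈ F) :
    (X i - X j : MvPolynomial (Fin n) K) ∈ PFIdeal K F :=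
  Ideal.subset_span ⟨i, hi, j, hj, rfl⟩

theorem PFIdeal_mono (h : F ⊆ G) : PFIdeal K F ≤ PFIdeal K G :=
  Ideal.span_mono fun _ ⟨i, hi, j, hj, hf⟩ ↦ ⟨i, h hi, j, h hj, hf⟩

theorem PFIdeal_empty : PFIdeal K (∅ : Finset (Fin n)) = ⊥ := by
  simp [PFIdeal]

theorem PFIdeal_sup_eq_ker_rename (h : Disjoint F G) :
    PFIdeal K F ⊔ PFIdeal K G = RingHom.ker (rename (R := K) fun i ↦
      if i ∈ F then Sum.inl true else if i ∈ G then Sum.inl false else Sum.inr i) := by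
  rw [ker_rename_eq_span]
  apply le_antisymm
  · refine sup_le (Ideal.span_mono ?_) (Ideal.span_mono ?_)
    · rintro _ ⟨i, hi, j, hj, rfl⟩
      exact ⟨i, j, by simp [hi, hj], rfl⟩
    · rintro _ ⟨i, hi, j, hj, rfl⟩
      exact ⟨i, j, by simp [hi, hj, Finset.disjoint_right.mp h], rfl⟩
  · rw [Ideal.span_le]
    rintro _ ⟨i, j, hij, rfl⟩
    by_cases hiF : i ∈ F
    · by_cases hjF : j ∈ F
      · exact Ideal.mem_sup_left (X_sub_X_mem_PFIdeal K hiF hjF)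
      · by_cases hjG : j ∈ G <;> simp [hiF, hjF, hjG] at hij
    · by_cases hjF : j ∈ F
      · by_cases hiG : i ∈ G <;> simp [hiF, hjF, hiG] at hij
      · by_cases hiG : i ∈ G <;> by_cases hjG : j ∈ G <;> simp [hiF, hjF, hiG, hjG] at hij
        · exact Ideal.mem_sup_right (X_sub_X_mem_PFIdeal K hiG hjG)
        · simp [hij]

theorem PFIdeal_sup_isPrime (h : Disjoint F G) : (PFIdeal K F ⊔ PFIdeal K G).IsPrime := by
  rw [PFIdeal_sup_eq_ker_rename K h]
  exact RingHom.ker_isPrime _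

theorem X_sub_X_mem_PFIdeal_sup_iff (h : Disjoint F G) {i j : Fin n} :
    (X i - X j : MvPolynomial (Fin n) K) ∈ PFIdeal K F ⊔ PFIdeal K G ↔
      i = j ∨ (i ∈ F ∧ j ∈ F) ∨ (i ∈ G ∧ j ∈ G) := by
  have hd (i : Fin n) (hi : i ∈ F) : i ∉ G := Finset.disjoint_left.mp h hi
  rw [PFIdeal_sup_eq_ker_rename K h, RingHom.mem_ker, map_sub, rename_X, rename_X, sub_eq_zero,
    (X_injective).eq_iff]
  grind

theorem PFIdeal_isPrime (F : Finset (Fin n)) : (PFIdeal K F).IsPrime := by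
  simpa [PFIdeal_empty] using PFIdeal_sup_isPrime K (Finset.disjoint_empty_right F)

theorem X_sub_X_mem_PFIdeal_iff {i j : Fin n} :
    (X i - X j : MvPolynomial (Fin n) K) ∈ PFIdeal K F ↔ i = j ∨ (i ∈ F ∧ j ∈ F) := by
  simpa [PFIdeal_empty] using
    X_sub_X_mem_PFIdeal_sup_iff K (Finset.disjoint_empty_right F) (i := i) (j := j)

theorem subset_or_subset_of_PFIdeal_le_sup (h : Disjoint F G) (hH : 2 ≤ H.card)
    (hle : PFIdeal K H ≤ PFIdeal K F ⊔ PFIdeal K G) : H ⊆ F ∨ H ⊆ G := by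
  have key {i j : Fin n} (hi : i ∈ H) (hj : j ∈ H) :=
    (X_sub_X_mem_PFIdeal_sup_iff K h).mp (hle (X_sub_X_mem_PFIdeal K hi hj))
  obtain ⟨a, ha, b, hb, hab⟩ := Finset.one_lt_card.mp hH
  have hd (i : Fin n) (hi : i ∈ F) : i ∉ G := Finset.disjoint_left.mp h hi
  rcases (key ha hb).resolve_left hab with ⟨haF, -⟩ | ⟨haG, -⟩
  · left
    intro c hc
    rcases key ha hc with rfl | h | h
    · exact haF
    · exact h.2
    · exact absurd h.1 (hd a haF)
  · right
    intro c hc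
    rcases key ha hc with rfl | h | h
    · exact haG
    · exact absurd haG (hd a h.1)
    · exact h.2

theorem eq_or_eq_of_PFIdeal_le_sup (h : Disjoint F G) (hH : 2 ≤ H.card)
    (hF : F.card = H.card) (hG : G.card = H.card)
    (hle : PFIdeal K H ≤ PFIdeal K F ⊔ PFIdeal K G) : H = F ∨ H = G :=
  (subset_or_subset_of_PFIdeal_le_sup K h hH hle).imp
    (fun h ↦ Finset.eq_of_subset_of_card_le h hF.le)
    (fun h ↦ Finset.eq_of_subset_of_card_le h hG.le)

theorem InkIdeal_le_PFIdeal {k : ℕ} (hF : F.card = k) : InkIdeal K n k ≤ PFIdeal K F :=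
  iInf₂_le F hF

theorem exists_PFIdeal_le_of_InkIdeal_le {k : ℕ} {P : Ideal (MvPolynomial (Fin n) K)}
    (hP : P.IsPrime) (hle : InkIdeal K n k ≤ P) :
    ∃ F : Finset (Fin n), F.card = k ∧ PFIdeal K F ≤ P := by
  have : (Finset.univ.filter fun F : Finset (Fin n) ↦ F.card = k).inf (PFIdeal K) ≤ P := by
    refine le_trans ?_ hle
    rw [InkIdeal, le_iInf₂_iff]
    exact fun F hF ↦ Finset.inf_le (by simpa using hF)
  obtain ⟨F, hF, hFP⟩ := hP.inf_le'.mp this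
  exact ⟨F, by simpa using hF, hFP⟩

theorem PFIdeal_le_of_forall_mem {J : Ideal (MvPolynomial (Fin n) K)} (a : Fin n)
    (h : ∀ i ∈ F, X a - X i ∈ J) : PFIdeal K F ≤ J := by
  refine Ideal.span_le.mpr ?_
  rintro _ ⟨i, hi, j, hj, rfl⟩
  have := J.sub_mem (h j hj) (h i hi)
  rwa [sub_sub_sub_cancel_left] at this

theorem InkIdeal_le_PFIdeal_sup {k : ℕ} (hF : F.card = k) (G : Finset (Fin n)) :
    InkIdeal K n k ≤ PFIdeal K F ⊔ PFIdeal K G :=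
  (InkIdeal_le_PFIdeal K hF).trans le_sup_left

theorem comap_map_mk_PFIdeal_sup {k : ℕ} (hF : F.card = k) (G : Finset (Fin n)) :
    ((PFIdeal K F ⊔ PFIdeal K G).map (Ideal.Quotient.mk (InkIdeal K n k))).comap
      (Ideal.Quotient.mk (InkIdeal K n k)) = PFIdeal K F ⊔ PFIdeal K G :=
  Ideal.comap_map_mk (InkIdeal_le_PFIdeal_sup K hF G)

theorem map_mk_PFIdeal_sup_isPrime {k : ℕ} (hF : F.card = k) (h : Disjoint F G) :
    ((PFIdeal K F ⊔ PFIdeal K G).map (Ideal.Quotient.mk (InkIdeal K n k))).IsPrime := by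
  have := PFIdeal_sup_isPrime K h
  refine Ideal.map_isPrime_of_surjective Ideal.Quotient.mk_surjective ?_
  rw [Ideal.mk_ker]
  exact InkIdeal_le_PFIdeal_sup K hF G

theorem card_le_height_map_mk_PFIdeal_sup_add_one {k : ℕ} (hF : F.card = k) (h : Disjoint F G)
    (hG : G.Nonempty) :
    (G.card : ℕ∞) ≤
      ((PFIdeal K F ⊔ PFIdeal K G).map (Ideal.Quotient.mk (InkIdeal K n k))).height + 1 := by
  induction hG using Finset.Nonempty.cons_induction with
  | singleton a => simp
  | cons a G ha hG ih =>
    have hFG : Disjoint F G := h.mono_right (Finset.subset_cons ha)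
    have := map_mk_PFIdeal_sup_isPrime K hF hFG
    have := map_mk_PFIdeal_sup_isPrime K hF h
    obtain ⟨b, hb⟩ := hG
    have hlt : (PFIdeal K F ⊔ PFIdeal K G).map (Ideal.Quotient.mk (InkIdeal K n k)) <
        (PFIdeal K F ⊔ PFIdeal K (Finset.cons a G ha)).map
          (Ideal.Quotient.mk (InkIdeal K n k)) := by
      refine lt_of_le_not_ge
        (Ideal.map_mono (sup_le_sup_left (PFIdeal_mono K (Finset.subset_cons ha)) _)) fun hle ↦ ?_
      have hle' := Ideal.comap_mono (f := Ideal.Quotient.mk (InkIdeal K n k)) hle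
      rw [comap_map_mk_PFIdeal_sup K hF, comap_map_mk_PFIdeal_sup K hF] at hle'
      have hab := hle' (Ideal.mem_sup_right (X_sub_X_mem_PFIdeal K (Finset.mem_cons_self a G)
        (Finset.mem_cons_of_mem hb)))
      rw [X_sub_X_mem_PFIdeal_sup_iff K hFG] at hab
      have hbF : b ∉ F := Finset.disjoint_right.mp hFG hb
      grind
    rw [Finset.card_cons, Nat.cast_add, Nat.cast_one]
    gcongr
    exact (ih hFG).trans (Ideal.height_add_one_le_of_lt_of_isPrime hlt)

theorem height_map_mk_PFIdeal_sup_le {k : ℕ} (hk : 2 ≤ k) (hF : F.card = k) (hG : G.card = k)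
    (h : Disjoint F G) :
    ((PFIdeal K F ⊔ PFIdeal K G).map (Ideal.Quotient.mk (InkIdeal K n k))).height ≤
      (k - 1 : ℕ) := by
  classical
  let e : F ≃ G := Finset.equivOfCardEq (hF.trans hG.symm)
  obtain ⟨a, ha⟩ : F.Nonempty := Finset.card_pos.mp (by omega)
  let g (i : F) : MvPolynomial (Fin n) K :=
    (X a - X (i : Fin n)) + (X (e ⟨a, ha⟩ : Fin n) - X (e i : Fin n))
  let s : Finset (MvPolynomial (Fin n) K ⧸ InkIdeal K n k) :=
    (Finset.univ.erase ⟨a, ha⟩).image fun i ↦ Ideal.Quotient.mk _ (g i)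
  have hs : s.card ≤ k - 1 := by
    refine Finset.card_image_le.trans ?_
    rw [Finset.card_erase_of_mem (Finset.mem_univ _), Finset.card_univ, Fintype.card_coe, hF]
  refine le_trans (Ideal.height_le_card_of_mem_minimalPrimes_span_finset (s := s) ?_)
    (by exact_mod_cast hs)
  refine ⟨⟨map_mk_PFIdeal_sup_isPrime K hF h, ?_⟩, ?_⟩
  · rw [Ideal.span_le]
    intro x hx
    obtain ⟨i, -, rfl⟩ := Finset.mem_image.mp (Finset.mem_coe.mp hx)
    exact Ideal.mem_map_of_mem _ (add_mem
      (Ideal.mem_sup_left (X_sub_X_mem_PFIdeal K ha i.2))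
      (Ideal.mem_sup_right (X_sub_X_mem_PFIdeal K (e _).2 (e i).2)))
  · rintro P ⟨hP, hsP⟩ hPQ
    have hle := Ideal.comap_mono (f := Ideal.Quotient.mk (InkIdeal K n k)) hPQ
    rw [comap_map_mk_PFIdeal_sup K hF] at hle
    have hg (i : F) : g i ∈ P.comap (Ideal.Quotient.mk (InkIdeal K n k)) := by
      by_cases hi : i = ⟨a, ha⟩
      · simp [g, hi]
      · exact hsP (Ideal.subset_span (Finset.mem_coe.mpr (Finset.mem_image_of_mem _
          (Finset.mem_erase.mpr ⟨hi, Finset.mem_univ _⟩))))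
    have hbot : InkIdeal K n k ≤ P.comap (Ideal.Quotient.mk (InkIdeal K n k)) := by
      conv_lhs => rw [← Ideal.mk_ker (I := InkIdeal K n k)]
      exact Ideal.comap_mono bot_le
    obtain ⟨H, hH, hHP⟩ := exists_PFIdeal_le_of_InkIdeal_le K (hP.comap _) hbot
    rw [Ideal.map_le_iff_le_comap]
    rcases eq_or_eq_of_PFIdeal_le_sup K h (hH ▸ hk) (hF.trans hH.symm) (hG.trans hH.symm)
      (hHP.trans hle) with rfl | rfl
    · refine sup_le hHP (PFIdeal_le_of_forall_mem K (e ⟨a, ha⟩) fun j hj ↦ ?_)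
      have := (Ideal.add_mem_iff_right _
        (hHP (X_sub_X_mem_PFIdeal K ha (e.symm ⟨j, hj⟩).2))).mp (hg (e.symm ⟨j, hj⟩))
      simpa only [Equiv.apply_symm_apply] using this
    · refine sup_le (PFIdeal_le_of_forall_mem K a fun j hj ↦ ?_) hHP
      exact (Ideal.add_mem_iff_left _
        (hHP (X_sub_X_mem_PFIdeal K (e ⟨a, ha⟩).2 (e ⟨j, hj⟩).2))).mp (hg ⟨j, hj⟩)

theorem height_map_mk_PFIdeal_sup {k : ℕ} (hk : 2 ≤ k) (hF : F.card = k) (hG : G.card = k)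
    (h : Disjoint F G) :
    ((PFIdeal K F ⊔ PFIdeal K G).map (Ideal.Quotient.mk (InkIdeal K n k))).height =
      (k - 1 : ℕ) := by
  refine le_antisymm (height_map_mk_PFIdeal_sup_le K hk hF hG h) ?_
  have := card_le_height_map_mk_PFIdeal_sup_add_one K hF h (Finset.card_pos.mp (by omega))
  have hk' : (k : ℕ∞) = (k - 1 : ℕ) + 1 := by exact_mod_cast (by omega : k = k - 1 + 1)
  rw [hG, hk'] at this
  exact (ENat.add_le_add_iff_right ENat.one_ne_top).mp this

theorem exists_notMem_sup_forall_mul_mem_InkIdeal {k : ℕ} (hk : 2 ≤ k) (hF : F.card = k)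
    (hG : G.card = k) (h : Disjoint F G) :
    ∃ s ∉ PFIdeal K F ⊔ PFIdeal K G,
      ∀ x ∈ PFIdeal K F, x ∈ PFIdeal K G → s * x ∈ InkIdeal K n k := by
  classical
  have hex (H : Finset (Fin n)) (hH : H.card = k ∧ H ≠ F ∧ H ≠ G) :
      ∃ s ∈ PFIdeal K H, s ∉ PFIdeal K F ⊔ PFIdeal K G := by
    refine SetLike.not_le_iff_exists.mp fun hle ↦ ?_
    obtain ⟨rfl, hHF, hHG⟩ := hH
    exact (eq_or_eq_of_PFIdeal_le_sup K h hk hF hG hle).elim hHF hHG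
  choose! s hsH hsP using hex
  refine ⟨∏ H with H.card = k ∧ H ≠ F ∧ H ≠ G, s H, ?_, fun x hxF hxG ↦ ?_⟩
  · rw [(PFIdeal_sup_isPrime K h).prod_mem_iff]
    rintro ⟨H, hH, hs⟩
    exact hsP H (by simpa using hH) hs
  · simp only [InkIdeal, Ideal.mem_iInf]
    intro H hH
    by_cases hHF : H = F
    · exact Ideal.mul_mem_left _ _ (hHF ▸ hxF)
    by_cases hHG : H = G
    · exact Ideal.mul_mem_left _ _ (hHG ▸ hxG)
    · exact Ideal.mul_mem_right _ _ (Ideal.mem_of_dvd _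
        (Finset.dvd_prod_of_mem s (by simpa using ⟨hH, hHF, hHG⟩)) (hsH H ⟨hH, hHF, hHG⟩))

theorem not_PFIdeal_le_of_disjoint (hF : 2 ≤ F.card) (h : Disjoint F G) :
    ¬ PFIdeal K F ≤ PFIdeal K G := by
  intro hle
  obtain ⟨a, ha, b, hb, hab⟩ := Finset.one_lt_card.mp hF
  have := (X_sub_X_mem_PFIdeal_iff K).mp (hle (X_sub_X_mem_PFIdeal K ha hb))
  exact Finset.disjoint_left.mp h ha (this.resolve_left hab).1

theorem ringDepth_localization_map_mk_PFIdeal_sup {k : ℕ} (hk : 2 ≤ k) (hF : F.card = k)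
    (hG : G.card = k) (h : Disjoint F G)
    [hQ : ((PFIdeal K F ⊔ PFIdeal K G).map (Ideal.Quotient.mk (InkIdeal K n k))).IsPrime] :
    ringDepth (Localization.AtPrime
      ((PFIdeal K F ⊔ PFIdeal K G).map (Ideal.Quotient.mk (InkIdeal K n k)))) = 1 := by
  have hprime {H : Finset (Fin n)} (hH : H.card = k) :
      ((PFIdeal K H).map (Ideal.Quotient.mk (InkIdeal K n k))).IsPrime := by
    simpa [PFIdeal_empty] using
      map_mk_PFIdeal_sup_isPrime K hH (Finset.disjoint_empty_right H)
  have hcomap {H : Finset (Fin n)} (hH : H.card = k) :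
      ((PFIdeal K H).map (Ideal.Quotient.mk (InkIdeal K n k))).comap
        (Ideal.Quotient.mk (InkIdeal K n k)) = PFIdeal K H :=
    Ideal.comap_map_mk (InkIdeal_le_PFIdeal K hH)
  have hnot {H H' : Finset (Fin n)} (hH : H.card = k) (hH' : H'.card = k) (hd : Disjoint H H') :
      ¬ (PFIdeal K H).map (Ideal.Quotient.mk (InkIdeal K n k)) ≤
        (PFIdeal K H').map (Ideal.Quotient.mk (InkIdeal K n k)) := by
    rw [Ideal.map_le_iff_le_comap, hcomap hH']
    exact not_PFIdeal_le_of_disjoint K (hH ▸ hk) hd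
  obtain ⟨s, hs, hsx⟩ := exists_notMem_sup_forall_mul_mem_InkIdeal K hk hF hG h
  refine ringDepth_localization_sup_eq_one (s := Ideal.Quotient.mk _ s) (hprime hF) (hprime hG)
    (hnot hF hG h) (hnot hG hF h.symm) (Ideal.map_sup _ _ _).symm ?_ ?_
  · rwa [← Ideal.mem_comap, comap_map_mk_PFIdeal_sup K hF]
  · intro x hxF hxG
    obtain ⟨x, rfl⟩ := Ideal.Quotient.mk_surjective x
    rw [← Ideal.mem_comap, hcomap hF] at hxF
    rw [← Ideal.mem_comap, hcomap hG] at hxG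
    rw [← map_mul, Ideal.Quotient.eq_zero_iff_mem]
    exact hsx x hxF hxG

end PFIdeal

/-- Proposition 2.7: if `k ≥ 3` and `2k ≤ n`, then `R/I_{n,k}` does not satisfy Serre's
condition `(S₂)`; more precisely, for the prime `P = P_F + P_{F'}` with `F = {1, …, k}`
and `F' = {k+1, …, 2k}`, the localization of `R/I_{n,k}` at (the image of) `P` has
depth `1` while its Krull dimension is `k - 1 ≥ 2`. -/
theorem Ink_not_S2 {K : Type*} [Field K] (n k : ℕ) (hk : 3 ≤ k) (hkn : 2 * k ≤ n)
    (Q : Ideal (MvPolynomial (Fin n) K ⧸ InkIdeal K n k))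
    (hQdef : Q = Ideal.map (Ideal.Quotient.mk (InkIdeal K n k))
      (PFIdeal K (Finset.univ.filter fun i : Fin n => (i : ℕ) < k) +
        PFIdeal K (Finset.univ.filter fun i : Fin n => k ≤ (i : ℕ) ∧ (i : ℕ) < 2 * k))) :
    (¬ ∀ (P : Ideal (MvPolynomial (Fin n) K ⧸ InkIdeal K n k)) [P.IsPrime],
        min 2 (ringKrullDim (Localization.AtPrime P)) ≤
          (ringDepth (Localization.AtPrime P) : WithBot ℕ∞)) ∧
      ∃ hQ : Q.IsPrime,
        ringDepth (Localization (Q.primeCompl (hp := hQ))) = 1 ∧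
        ringKrullDim (Localization (Q.primeCompl (hp := hQ))) = ((k - 1 : ℕ) : WithBot ℕ∞) ∧
        2 ≤ k - 1 := by
  set F : Finset (Fin n) := Finset.univ.filter fun i : Fin n => (i : ℕ) < k with hFdef
  set G : Finset (Fin n) :=
    Finset.univ.filter fun i : Fin n => k ≤ (i : ℕ) ∧ (i : ℕ) < 2 * k with hGdef
  have hF : F.card = k := by
    rw [hFdef, Fin.card_filter_val_lt]
    omega
  have hFG : Disjoint F G := by
    rw [Finset.disjoint_left]
    intro i hi hi'
    simp only [hFdef, hGdef, Finset.mem_filter_univ] at hi hi'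
    omega
  have hG : G.card = k := by
    have hunion : F ∪ G = Finset.univ.filter fun i : Fin n => (i : ℕ) < 2 * k := by
      ext i
      simp only [hFdef, hGdef, Finset.mem_union, Finset.mem_filter_univ]
      omega
    have hcard := congrArg Finset.card hunion
    rw [Finset.card_union_of_disjoint hFG, hF, Fin.card_filter_val_lt] at hcard
    omega
  rw [Submodule.add_eq_sup] at hQdef
  subst hQdef
  have hQ := map_mk_PFIdeal_sup_isPrime K hF hFG
  have hdepth := ringDepth_localization_map_mk_PFIdeal_sup K (by omega) hF hG hFG
  have hdim := IsLocalization.AtPrime.ringKrullDim_eq_height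
    ((PFIdeal K F ⊔ PFIdeal K G).map (Ideal.Quotient.mk (InkIdeal K n k)))
    (Localization.AtPrime
      ((PFIdeal K F ⊔ PFIdeal K G).map (Ideal.Quotient.mk (InkIdeal K n k))))
  rw [height_map_mk_PFIdeal_sup K (by omega) hF hG hFG] at hdim
  refine ⟨fun hS ↦ ?_, hQ, hdepth, hdim, by omega⟩
  have hle := hS ((PFIdeal K F ⊔ PFIdeal K G).map (Ideal.Quotient.mk (InkIdeal K n k)))
  rw [hdepth, hdim] at hle
  have hk' : (2 : WithBot ℕ∞) ≤ ((k - 1 : ℕ) : ℕ∞) := by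
    exact WithBot.coe_le_coe.mpr (Nat.cast_le.mpr (by omega : 2 ≤ k - 1))
  rw [min_eq_left hk'] at hle
  exact absurd (WithBot.coe_le_coe.mp hle) (not_le_of_gt (Nat.cast_lt.mpr one_lt_two))
end

section
/- Let A = ⊕_{i∈ℕ} Aᵢ be a Noetherian ℕ-graded commutative ring and a ∈ A a homogeneous non-zero-divisor of positive degree. If A/aA is reduced, then A is reduced. -/
/-- Lemma 3.5: let `A = ⊕_{i ∈ ℕ} A_i` be a Noetherian ℕ-graded commutative ring and
`a ∈ A` a homogeneous non-zero-divisor of positive degree.  If `A/aA` is reduced, then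
`A` is reduced. -/
theorem reduced_of_quotient_homogeneous_regular {A : Type*} [CommRing A]
    [IsNoetherianRing A] (𝒜 : ℕ → AddSubgroup A) [GradedRing 𝒜]
    (a : A) (i : ℕ) (hi : 0 < i) (hmem : a ∈ 𝒜 i)
    (hreg : a ∈ nonZeroDivisors A)
    (hred : IsReduced (A ⧸ Ideal.span {a})) :
    IsReduced A := by
  have hdiv : ∀ x : A, IsNilpotent x → ∃ y, IsNilpotent y ∧ x = a * y := by
    intro x hx
    have hx0 : Ideal.Quotient.mk (Ideal.span {a}) x = 0 := (hx.map _).eq_zero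
    rw [Ideal.Quotient.eq_zero_iff_mem, Ideal.mem_span_singleton] at hx0
    obtain ⟨y, rfl⟩ := hx0
    obtain ⟨n, hn⟩ := hx
    rw [mul_pow] at hn
    exact ⟨y, ⟨n, (mul_left_mem_nonZeroDivisors_eq_zero_iff (pow_mem hreg n)).mp hn⟩, rfl⟩
  have hcomp : ∀ n : ℕ, ∀ x : A, IsNilpotent x → (DirectSum.decompose 𝒜 x n : A) = 0 := by
    intro n
    induction n using Nat.strong_induction_on with
    | _ n ih =>
      intro x hx
      obtain ⟨y, hy, rfl⟩ := hdiv x hx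
      by_cases h : i ≤ n
      · rw [DirectSum.coe_decompose_mul_of_left_mem_of_le 𝒜 hmem h,
          ih (n - i) (by omega) y hy, mul_zero]
      · exact DirectSum.coe_decompose_mul_of_left_mem_of_not_le 𝒜 hmem h
  refine ⟨fun x hx => ?_⟩
  classical
  rw [← DirectSum.sum_support_decompose 𝒜 x]
  exact Finset.sum_eq_zero fun n _ => hcomp n x hx
end

section
/- Let λ = (n − d, d) and μ = (n − d, d − 1) for 1 ≤ d ≤ n/2, and let φ: R → S = K[x₁,…,x_{n−1}] be the K-algebra surjection sending xₙ to 0 and xᵢ to xᵢ for i < n. Then φ(I^Sp_λ) equals the ideal of S generated by all products xᵢ·f_T where T ranges over Young tableaux of shape μ (with entries in {1,…,n−1}) and xᵢ is a variable with xᵢ ∉ supp(f_T). -/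
open MvPolynomial

/-- The natural surjection `K[x_1, …, x_n] → K[x_1, …, x_{n-1}]` sending `x_n` to `0`
and `x_i` to `x_i` for `i < n`. -/
noncomputable def lowerMap (K : Type*) [CommRing K] (n : ℕ) :
    MvPolynomial (Fin n) K →ₐ[K] MvPolynomial (Fin (n - 1)) K :=
  MvPolynomial.aeval fun i : Fin n =>
    if h : (i : ℕ) < n - 1 then MvPolynomial.X ⟨(i : ℕ), h⟩ else 0

/-- The Specht polynomial of a two-row tableau, expressed through the entries `a j` and `b j` of its
columns of length two. -/
theorem spechtPoly_eq_prod_of_columns (K : Type*) [CommRing K] {N m e : ℕ}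
    {T : Fin N → ℕ × ℕ} (hT : IsTableau [m, e] T) {a b : Fin e → Fin N}
    (ha : ∀ j, T (a j) = (0, (j : ℕ))) (hb : ∀ j, T (b j) = (1, (j : ℕ))) :
    spechtPoly K T = ∏ j, (X (a j) - X (b j)) := by
  obtain ⟨hinj, hbox, -⟩ := hT
  symm
  unfold spechtPoly
  refine Finset.prod_bij (fun j _ => (a j, b j)) ?_ ?_ ?_ (fun _ _ => rfl)
  · intro j _
    simp [ha, hb]
  · intro j _ j' _ h
    have h' : T (a j) = T (a j') := congrArg T (Prod.ext_iff.1 h).1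
    rw [ha, ha] at h'
    exact Fin.ext (Prod.ext_iff.1 h').2
  · rintro ⟨p, q⟩ hpq
    simp only [Finset.mem_filter, Finset.mem_univ, true_and] at hpq
    obtain ⟨hc, hr⟩ := hpq
    obtain ⟨hq1, hq2⟩ := hbox q
    have hq : (T q).1 = 1 := by
      simp only [List.length_cons, List.length_nil] at hq1
      omega
    have hp : (T p).1 = 0 := by omega
    rw [hq] at hq2
    have hlt : (T q).2 < e := by simpa using hq2
    refine ⟨⟨(T q).2, hlt⟩, Finset.mem_univ _, Prod.ext (hinj ?_) (hinj ?_)⟩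
    · rw [ha]
      exact Prod.ext hp.symm hc.symm
    · rw [hb]
      exact Prod.ext hq.symm rfl

/-- The Specht polynomial of a two-row tableau is a product of differences of distinct variables. -/
theorem IsTableau.exists_columns (K : Type*) [CommRing K] {N m e : ℕ} (hem : e ≤ m)
    {T : Fin N → ℕ × ℕ} (hT : IsTableau [m, e] T) :
    ∃ a b : Fin e → Fin N, Function.Injective (Sum.elim a b) ∧
      spechtPoly K T = ∏ j, (X (a j) - X (b j)) := by
  have hA : ∀ j : Fin e, ∃ i, T i = (0, (j : ℕ)) := fun j =>
    hT.2.2 0 j (by simp) (by simpa using j.2.trans_le hem)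
  have hB : ∀ j : Fin e, ∃ i, T i = (1, (j : ℕ)) := fun j => hT.2.2 1 j (by simp) (by simp)
  choose a ha using hA
  choose b hb using hB
  refine ⟨a, b, ?_, spechtPoly_eq_prod_of_columns K hT ha hb⟩
  refine Function.Injective.of_comp (f := T) ?_
  rintro (i | i) (j | j) h <;> simp_all [Fin.ext_iff]

/-- Prescribed disjoint columns of length two can be completed to a two-row tableau. -/
theorem exists_isTableau_of_columns (K : Type*) [CommRing K] {N m e : ℕ} (hem : e ≤ m)
    (hN : N = m + e) {a b : Fin e → Fin N} (hab : Function.Injective (Sum.elim a b)) :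
    ∃ T : Fin N → ℕ × ℕ, IsTableau [m, e] T ∧ spechtPoly K T = ∏ j, (X (a j) - X (b j)) := by
  let label : Fin e ⊕ Fin e → ℕ × ℕ := Sum.elim (fun j => (0, (j : ℕ))) (fun j => (1, (j : ℕ)))
  have hlabel : Function.Injective label := by
    rintro (i | i) (j | j) h <;> simp_all [label, Fin.ext_iff]
  let t : Finset (ℕ × ℕ) := ({0} ×ˢ Finset.range m) ∪ ({1} ×ˢ Finset.range e)
  have hdisj : Disjoint (({0} : Finset ℕ) ×ˢ Finset.range m) ({1} ×ˢ Finset.range e) := by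
    rw [Finset.disjoint_left]
    rintro ⟨r, c⟩ h h'
    simp only [Finset.mem_product, Finset.mem_singleton] at h h'
    omega
  have hcard : Fintype.card (Fin N) = t.card := by
    rw [Finset.card_union_of_disjoint hdisj]
    simp [hN]
  let f : Fin N → ℕ × ℕ := Function.extend (Sum.elim a b) label fun _ => (0, 0)
  have hf : ∀ s, f (Sum.elim a b s) = label s := fun s => hab.extend_apply _ _ s
  obtain ⟨g, hg⟩ := Finset.exists_equiv_extend_of_card_eq hcard
    (s := Finset.univ.image (Sum.elim a b)) (f := f)
    (by
      intro x hx
      simp only [Finset.mem_image, Finset.mem_univ, true_and] at hx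
      obtain ⟨_, ⟨s, rfl⟩, rfl⟩ := hx
      rw [hf]
      rcases s with j | j
      · simpa [label, t] using j.2.trans_le hem
      · simp [label, t])
    (by
      intro x hx y hy h
      simp only [Finset.coe_image, Finset.coe_univ, Set.image_univ, Set.mem_range] at hx hy
      obtain ⟨s, rfl⟩ := hx
      obtain ⟨s', rfl⟩ := hy
      rw [hf, hf] at h
      rw [hlabel h])
  have hgf : ∀ s, (g (Sum.elim a b s) : ℕ × ℕ) = label s := fun s => by
    rw [hg _ (Finset.mem_image_of_mem _ (Finset.mem_univ s)), hf]
  have hT : IsTableau [m, e] fun i => (g i : ℕ × ℕ) := by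
    refine ⟨Subtype.val_injective.comp g.injective, fun i => ?_, fun r c hr hc => ?_⟩
    · have hi := (g i).2
      simp only [t, Finset.mem_union, Finset.mem_product, Finset.mem_singleton,
        Finset.mem_range] at hi
      rcases hi with ⟨h1, h2⟩ | ⟨h1, h2⟩ <;> simp [h1, h2]
    · have hrc : (r, c) ∈ t := by
        simp only [t, Finset.mem_union, Finset.mem_product, Finset.mem_singleton,
          Finset.mem_range]
        match r, hr, hc with
        | 0, _, hc => simpa using hc
        | 1, _, hc => simpa using hc
      exact ⟨g.symm ⟨(r, c), hrc⟩, by simp⟩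
  exact ⟨_, hT, spechtPoly_eq_prod_of_columns K hT (fun j => hgf (.inl j))
    (fun j => hgf (.inr j))⟩

/-- A variable occurs in a product of differences of distinct variables exactly when it is one of
the variables of the factors. -/
theorem forall_mem_support_prod_X_sub_X_iff {K : Type*} [Field K] {ι σ : Type*} [Fintype ι]
    {a b : ι → σ} (hab : ∀ j, a j ≠ b j) (i : σ) :
    (∀ m ∈ (∏ j, (X (a j) - X (b j)) : MvPolynomial σ K).support, m i = 0) ↔
      ∀ j, a j ≠ i ∧ b j ≠ i := by
  classical
  have hvars : (∀ m ∈ (∏ j, (X (a j) - X (b j)) : MvPolynomial σ K).support, m i = 0) ↔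
      i ∉ (∏ j, (X (a j) - X (b j)) : MvPolynomial σ K).vars := by
    simp [mem_vars_iff_mem_support]
  rw [hvars]
  constructor
  · intro hi
    have hne : (∏ j, (X (a j) - X (b j)) : MvPolynomial σ K) ≠ 0 :=
      Finset.prod_ne_zero_iff.2 fun j _ => sub_ne_zero.2 fun h => hab j (X_injective h)
    have key : ∀ y : MvPolynomial σ K,
        aeval (Function.update X i y) (∏ j, (X (a j) - X (b j)) : MvPolynomial σ K) =
          ∏ j, (X (a j) - X (b j)) := by
      intro y
      conv_rhs => rw [← aeval_X_left_apply (∏ j, (X (a j) - X (b j)) : MvPolynomial σ K)]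
      refine eval₂Hom_congr' rfl ?_ rfl
      intro k hk _
      rw [Function.update_of_ne]
      rintro rfl
      exact hi hk
    intro j
    refine ⟨fun h => hne ?_, fun h => hne ?_⟩
    · rw [← key (X (b j)), map_prod]
      refine Finset.prod_eq_zero (Finset.mem_univ j) ?_
      simp [← h, Function.update_of_ne (hab j).symm]
    · rw [← key (X (a j)), map_prod]
      refine Finset.prod_eq_zero (Finset.mem_univ j) ?_
      simp [← h, Function.update_of_ne (hab j)]
  · intro h hi
    obtain ⟨j, -, hj⟩ := Finset.mem_biUnion.1 (vars_prod _ hi)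
    have := vars_sub_subset _ hj
    simp only [vars_X, Finset.mem_union, Finset.mem_singleton] at this
    rcases this with rfl | rfl
    · exact (h j).1 rfl
    · exact (h j).2 rfl

theorem lowerMap_X_castSucc (K : Type*) [CommRing K] {N : ℕ} (i : Fin N) :
    lowerMap K (N + 1) (X i.castSucc) = X i := by
  simp [lowerMap]

theorem lowerMap_X_last (K : Type*) [CommRing K] (N : ℕ) :
    lowerMap K (N + 1) (X (Fin.last N)) = 0 := by
  simp [lowerMap]

/-- Some index can be removed so that none of the remaining values of `a` and `b` is the last
element. -/
theorem exists_forall_succAbove_ne_last {N e : ℕ} {a b : Fin (e + 1) → Fin (N + 1)}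
    (hab : Function.Injective (Sum.elim a b)) :
    ∃ c : Fin (e + 1), ∀ j, a (c.succAbove j) ≠ Fin.last N ∧ b (c.succAbove j) ≠ Fin.last N := by
  by_cases h : ∃ s, Sum.elim a b s = Fin.last N
  · obtain ⟨s, hs⟩ := h
    refine ⟨s.elim id id, fun j => ⟨fun h => ?_, fun h => ?_⟩⟩
    · have hs' := hab (a₁ := Sum.inl _) (h.trans hs.symm)
      exact Fin.succAbove_ne _ _ (congrArg (Sum.elim id id) hs')
    · have hs' := hab (a₁ := Sum.inr _) (h.trans hs.symm)
      exact Fin.succAbove_ne _ _ (congrArg (Sum.elim id id) hs')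
  · push Not at h
    exact ⟨0, fun j => ⟨h (.inl _), h (.inr _)⟩⟩


/-- Lemma 3.2: for `λ = (n-d, d)` and `μ = (n-d, d-1)`, the image of `I^Sp_λ` under the
natural surjection `φ : K[x_1, …, x_n] → K[x_1, …, x_{n-1}]` (sending `x_n` to `0`) is
the ideal generated by the products `x_i · f_T`, where `T` runs over the Young tableaux
of shape `μ` with entries in `{1, …, n-1}` and `x_i` is a variable not in `supp(f_T)`
(i.e. `x_i` divides no nonzero term of `f_T`). -/
theorem image_specht_two_rows {K : Type*} [Field K] (n d : ℕ)
    (hd : 1 ≤ d) (hdn : 2 * d ≤ n) :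
    Ideal.map (lowerMap K n) (spechtIdeal K n [n - d, d]) =
      Ideal.span {f | ∃ T : Fin (n - 1) → ℕ × ℕ, IsTableau [n - d, d - 1] T ∧
        ∃ i : Fin (n - 1), (∀ m ∈ (spechtPoly K T).support, m i = 0) ∧
          f = X i * spechtPoly K T} := by
  obtain ⟨e, rfl⟩ : ∃ e, d = e + 1 := ⟨d - 1, by omega⟩
  obtain ⟨N, rfl⟩ : ∃ N, n = N + 1 := ⟨n - 1, by omega⟩
  obtain ⟨m, hm⟩ : ∃ m, m = N + 1 - (e + 1) := ⟨_, rfl⟩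
  have hem : e + 1 ≤ m := by omega
  have hN : N = m + e := by omega
  rw [← hm]
  simp only [Nat.add_sub_cancel]
  apply le_antisymm
  · rw [spechtIdeal, Ideal.map_span, Ideal.span_le]
    rintro _ ⟨_, ⟨T, hT, rfl⟩, rfl⟩
    obtain ⟨a, b, hab, hf⟩ := hT.exists_columns K hem
    obtain ⟨c, hc⟩ := exists_forall_succAbove_ne_last hab
    choose a' ha' using fun j => Fin.exists_castSucc_eq.2 (hc j).1
    choose b' hb' using fun j => Fin.exists_castSucc_eq.2 (hc j).2
    have hab' : Function.Injective (Sum.elim a' b') := by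
      intro s s' h
      have h' : Sum.elim a b (s.map c.succAbove c.succAbove) =
          Sum.elim a b (s'.map c.succAbove c.succAbove) := by
        rcases s with j | j <;> rcases s' with k | k <;>
          simpa [← ha', ← hb'] using h
      exact Function.Injective.sumMap Fin.succAbove_right_injective
        Fin.succAbove_right_injective (hab h')
    have hlow : lowerMap K (N + 1) (spechtPoly K T) =
        (lowerMap K (N + 1) (X (a c)) - lowerMap K (N + 1) (X (b c))) *
          ∏ j, (X (a' j) - X (b' j)) := by
      rw [hf, map_prod, Fin.prod_univ_succAbove _ c, map_sub]
      congr 1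
      refine Finset.prod_congr rfl fun j _ => ?_
      rw [map_sub, ← ha', ← hb', lowerMap_X_castSucc, lowerMap_X_castSucc]
    obtain ⟨T', hT', hf'⟩ := exists_isTableau_of_columns K (by omega : e ≤ m) hN hab'
    have hmem : ∀ k : Fin (N + 1),
        (∀ j, a (c.succAbove j) ≠ k ∧ b (c.succAbove j) ≠ k) →
        lowerMap K (N + 1) (X k) * ∏ j, (X (a' j) - X (b' j)) ∈
          Ideal.span {f | ∃ T : Fin N → ℕ × ℕ, IsTableau [m, e] T ∧
            ∃ i : Fin N, (∀ m ∈ (spechtPoly K T).support, m i = 0) ∧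
              f = X i * spechtPoly K T} := by
      intro k hk
      induction k using Fin.lastCases with
      | last =>
        rw [lowerMap_X_last, zero_mul]
        exact zero_mem _
      | cast i =>
        rw [lowerMap_X_castSucc]
        refine Ideal.subset_span ⟨T', hT', i, ?_, by rw [hf']⟩
        rw [hf', forall_mem_support_prod_X_sub_X_iff
          (fun j => (Sum.elim_injective.1 hab').2.2 j j)]
        intro j
        constructor
        · rintro rfl
          exact (hk j).1 (ha' j).symm
        · rintro rfl
          exact (hk j).2 (hb' j).symm
    rw [SetLike.mem_coe, hlow, sub_mul]
    refine sub_mem (hmem _ fun j => ⟨fun h => ?_, fun h => ?_⟩)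
      (hmem _ fun j => ⟨fun h => ?_, fun h => ?_⟩)
    · exact Fin.succAbove_ne _ _ (Sum.inl_injective (hab (a₁ := .inl _) (a₂ := .inl _) h))
    · exact Sum.inr_ne_inl (hab (a₁ := .inr _) (a₂ := .inl _) h)
    · exact Sum.inl_ne_inr (hab (a₁ := .inl _) (a₂ := .inr _) h)
    · exact Fin.succAbove_ne _ _ (Sum.inr_injective (hab (a₁ := .inr _) (a₂ := .inr _) h))
  · rw [Ideal.span_le]
    rintro _ ⟨T, hT, i, hi, rfl⟩
    obtain ⟨a, b, hab, hf⟩ := hT.exists_columns K (by omega : e ≤ m)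
    rw [hf, forall_mem_support_prod_X_sub_X_iff
      (fun j => (Sum.elim_injective.1 hab).2.2 j j)] at hi
    have hcols : Function.Injective (Sum.elim
        (Fin.cons i.castSucc fun j => (a j).castSucc : Fin (e + 1) → Fin (N + 1))
        (Fin.cons (Fin.last N) fun j => (b j).castSucc : Fin (e + 1) → Fin (N + 1))) := by
      have hinj := Sum.elim_injective.1 hab
      rw [Sum.elim_injective]
      refine ⟨?_, ?_, ?_⟩
      · rw [Fin.cons_injective_iff]
        refine ⟨?_, (Fin.castSucc_injective _).comp hinj.1⟩
        rintro ⟨j, hj⟩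
        exact (hi j).1 (Fin.castSucc_injective _ hj)
      · rw [Fin.cons_injective_iff]
        refine ⟨?_, (Fin.castSucc_injective _).comp hinj.2.1⟩
        rintro ⟨j, hj⟩
        exact Fin.castSucc_ne_last _ hj
      · intro j k
        induction j using Fin.cases <;> induction k using Fin.cases
        · simp
        · simpa using ((hi _).2).symm
        · simp
        · simpa using hinj.2.2 _ _
    obtain ⟨T', hT', hf'⟩ := exists_isTableau_of_columns K hem (by omega) hcols
    have hmap : lowerMap K (N + 1) (spechtPoly K T') = X i * spechtPoly K T := by
      rw [hf', hf, map_prod, Fin.prod_univ_succ]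
      simp only [Fin.cons_zero, Fin.cons_succ, map_sub, lowerMap_X_castSucc, lowerMap_X_last,
        sub_zero]
    rw [SetLike.mem_coe, ← hmap]
    exact Ideal.mem_map_of_mem _ (Ideal.subset_span ⟨T', hT', rfl⟩)
end

section
/- For every n and every d with 1 ≤ d ≤ n/2, the Specht ideal I^Sp_{(n−d,d)} ⊆ K[x₁,…,xₙ] is a radical ideal, over any field K. -/
open MvPolynomial

section MaximalPoint

/-- `laterCount p i` is the number of indices after `i` at which `p` takes the value `p i`. -/
def laterCount {α : Type*} [DecidableEq α] {n : ℕ} (p : Fin n → α) (i : Fin n) : ℕ :=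
  (Finset.univ.filter fun j => i < j ∧ p j = p i).card

theorem laterCount_cons_succ {α : Type*} [DecidableEq α] {n : ℕ} (v : α) (p : Fin n → α)
    (i : Fin n) :
    laterCount (Fin.cons v p : Fin (n + 1) → α) i.succ = laterCount p i := by
  simp [laterCount, Fin.card_filter_univ_succ]

theorem laterCount_cons_zero {α : Type*} [DecidableEq α] {n : ℕ} (v : α) (p : Fin n → α) :
    laterCount (Fin.cons v p : Fin (n + 1) → α) 0 =
      (Finset.univ.filter fun j => p j = v).card := by
  simp [laterCount, Fin.card_filter_univ_succ, Fin.succ_pos]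

theorem laterCount_lt_of_lt {α : Type*} [DecidableEq α] {n : ℕ} {p : Fin n → α} {i j : Fin n}
    (hij : i < j) (h : p i = p j) : laterCount p j < laterCount p i := by
  apply Finset.card_lt_card
  rw [Finset.ssubset_iff_of_subset]
  · exact ⟨j, by simp [hij, h], by simp⟩
  · intro k
    simp only [Finset.mem_filter, Finset.mem_univ, true_and]
    rintro ⟨h1, h2⟩
    exact ⟨hij.trans h1, h2.trans h.symm⟩

theorem eq_of_laterCount_eq {α : Type*} [DecidableEq α] {n : ℕ} {p : Fin n → α} {i j : Fin n}
    (h : p i = p j) (hc : laterCount p i = laterCount p j) : i = j := by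
  rcases lt_trichotomy i j with hij | hij | hij
  · exact absurd hc (laterCount_lt_of_lt hij h).ne'
  · exact hij
  · exact absurd hc (laterCount_lt_of_lt hij h.symm).ne

theorem laterCount_lt_card {α : Type*} [DecidableEq α] {n : ℕ} (p : Fin n → α) (i : Fin n) :
    laterCount p i < (Finset.univ.filter fun j => p j = p i).card := by
  apply Finset.card_lt_card
  rw [Finset.ssubset_iff_of_subset]
  · exact ⟨i, by simp, by simp⟩
  · intro k
    simp +contextual

/-- A nonzero univariate polynomial does not vanish at some value `v` occurring in `p` as often
as possible; then few positions of `p` have exactly as many later repetitions as `v` has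
occurrences. -/
theorem exists_eval_ne_zero_card_laterCount_le {L : Type*} [Field L] [Infinite L] [DecidableEq L]
    {n : ℕ} (p : Fin n → L) {q : Polynomial L} (hq : q ≠ 0) :
    ∃ v, q.eval v ≠ 0 ∧
      (Finset.univ.filter fun j =>
        laterCount p j = (Finset.univ.filter fun k => p k = v).card).card ≤ q.natDegree := by
  let mult : L → ℕ := fun v => (Finset.univ.filter fun k => p k = v).card
  let S : Set ℕ := mult '' {v | q.eval v ≠ 0}
  have hne : S.Nonempty := by
    obtain ⟨v, hv⟩ := Infinite.exists_notMem_finset q.roots.toFinset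
    refine ⟨_, v, ?_, rfl⟩
    simpa [hq] using hv
  have hbdd : BddAbove S := by
    refine ⟨n, ?_⟩
    rintro _ ⟨v, -, rfl⟩
    exact (Finset.card_le_univ _).trans (by simp)
  obtain ⟨v, hv, hmax⟩ := Nat.sSup_mem hne hbdd
  refine ⟨v, hv, ?_⟩
  change (Finset.univ.filter fun j => laterCount p j = mult v).card ≤ _
  calc _ ≤ q.roots.toFinset.card := by
        refine Finset.card_le_card_of_injOn p ?_ ?_
        · intro j hj
          simp only [Finset.coe_filter, Finset.mem_univ, true_and, Set.mem_ofPred_eq] at hj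
          by_contra hroot
          have h1 : mult (p j) ∈ S := ⟨p j, by simpa [hq] using hroot, rfl⟩
          have h2 := le_csSup hbdd h1
          rw [← hmax, ← hj] at h2
          exact absurd (laterCount_lt_card p j) (not_lt.mpr h2)
        · intro i hi j hj hij
          simp only [Finset.coe_filter, Finset.mem_univ, true_and, Set.mem_ofPred_eq] at hi hj
          exact eq_of_laterCount_eq hij (hi.trans hj.symm)
    _ ≤ q.natDegree := (Multiset.toFinset_card_le _).trans (Polynomial.card_roots' q)

/-- If `a` is the lexicographically largest exponent of `f`, then `f` does not vanish at some
point `p` such that the polynomial `∏ (X i - X j)`, over pairs `i < j` having equally many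
later repetitions in `p`, has a leading exponent dividing `a`. -/
theorem exists_eval_ne_zero_of_lex_maximal {L : Type*} [Field L] [Infinite L] [DecidableEq L] :
    ∀ {n : ℕ} (f : MvPolynomial (Fin n) L) (a : Fin n →₀ ℕ), f.coeff a ≠ 0 →
      (∀ b ∈ f.support, ¬ toLex a < toLex b) →
      ∃ p : Fin n → L, eval p f ≠ 0 ∧
        ∀ i, (Finset.univ.filter fun j => i < j ∧ laterCount p j = laterCount p i).card ≤ a i
  | 0, f, a, ha, _ => by
    refine ⟨0, ?_, fun i => i.elim0⟩
    rw [eq_C_of_isEmpty f, eval_C]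
    rwa [Subsingleton.elim a 0] at ha
  | n + 1, f, a, ha, hmax => by
    set F := finSuccEquiv L n f with hF
    have hcoeff : (F.coeff (a 0)).coeff a.tail ≠ 0 := by
      rwa [hF, finSuccEquiv_coeff_coeff, Finsupp.cons_tail]
    obtain ⟨p, hp, hcount⟩ := exists_eval_ne_zero_of_lex_maximal (F.coeff (a 0)) a.tail hcoeff
      (by
        intro b hb hlt
        rw [mem_support_iff, hF, finSuccEquiv_coeff_coeff] at hb
        refine hmax _ (mem_support_iff.mpr hb) ?_
        rw [Finsupp.Lex.lt_iff] at hlt ⊢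
        obtain ⟨i, hi, hlt⟩ := hlt
        refine ⟨i.succ, ?_, ?_⟩
        · intro j hj
          induction j using Fin.cases with
          | zero => simp
          | succ j => simpa [Finsupp.tail_apply] using hi j (by simpa using hj)
        · simpa [Finsupp.tail_apply] using hlt)
    have hdeg : (F.map (eval p)).natDegree ≤ a 0 := by
      refine Polynomial.natDegree_map_le.trans ?_
      rw [Polynomial.natDegree_le_iff_coeff_eq_zero]
      intro k hk
      ext b
      rw [hF, finSuccEquiv_coeff_coeff, coeff_zero]
      by_contra hb
      refine hmax _ (mem_support_iff.mpr hb) ?_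
      rw [Finsupp.Lex.lt_iff]
      exact ⟨0, by simp, by simpa using hk⟩
    have hne : F.map (eval p) ≠ 0 := by
      intro h0
      apply hp
      have := congrArg (fun q => q.coeff (a 0)) h0
      simpa using this
    obtain ⟨v, hv, hcard⟩ := exists_eval_ne_zero_card_laterCount_le p hne
    refine ⟨Fin.cons v p, by rwa [eval_eq_eval_mv_eval'], fun i => ?_⟩
    induction i using Fin.cases with
    | zero =>
      simpa [Fin.card_filter_univ_succ, laterCount_cons_succ, laterCount_cons_zero] using
        hcard.trans hdeg
    | succ i =>
      simpa [Fin.card_filter_univ_succ, laterCount_cons_succ, Finsupp.tail_apply] using hcount i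

end MaximalPoint

section Matchings

/-- The ideal generated by the products `∏ (X a - X b)` over matchings with `d` edges on the
vertex set `S`. -/
noncomputable def matchingIdeal (K : Type*) [CommRing K] {n : ℕ} : ℕ → Finset (Fin n) →
    Ideal (MvPolynomial (Fin n) K)
  | 0, _ => ⊤
  | d + 1, S => ⨆ a ∈ S, ⨆ b ∈ S.erase a,
      Ideal.span {X a - X b} * matchingIdeal K d ((S.erase a).erase b)

theorem X_sub_X_mul_mem_matchingIdeal {K : Type*} [CommRing K] {n d : ℕ} {S : Finset (Fin n)}
    {a b : Fin n} (ha : a ∈ S) (hb : b ∈ S.erase a) {f : MvPolynomial (Fin n) K}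
    (hf : f ∈ matchingIdeal K d ((S.erase a).erase b)) :
    (X a - X b) * f ∈ matchingIdeal K (d + 1) S := by
  have h1 : Ideal.span {(X a - X b : MvPolynomial (Fin n) K)} *
      matchingIdeal K d ((S.erase a).erase b) ≤ matchingIdeal K (d + 1) S :=
    le_iSup₂_of_le a ha (le_iSup₂_of_le b hb le_rfl)
  exact h1 (Ideal.mul_mem_mul (Ideal.mem_span_singleton_self _) hf)

/-- The product of the Vandermonde polynomials of the color classes of `c` on `S`. -/
noncomputable def colorVandermonde (K : Type*) [CommRing K] {n : ℕ} (c : Fin n → ℕ)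
    (S : Finset (Fin n)) : MvPolynomial (Fin n) K :=
  ∏ p ∈ (S ×ˢ S).filter (fun p => p.1 < p.2 ∧ c p.1 = c p.2), (X p.1 - X p.2)

/-- The product of the factors of `colorVandermonde K c S` other than that of the pair `p`. -/
noncomputable def colorVandermondeErase (K : Type*) [CommRing K] {n : ℕ} (c : Fin n → ℕ)
    (S : Finset (Fin n)) (p : Fin n × Fin n) : MvPolynomial (Fin n) K :=
  ∏ q ∈ ((S ×ˢ S).filter (fun p => p.1 < p.2 ∧ c p.1 = c p.2)).erase p, (X q.1 - X q.2)

theorem colorVandermonde_eq_mul_erase {K : Type*} [CommRing K] {n : ℕ} {c : Fin n → ℕ}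
    {S : Finset (Fin n)} {a b : Fin n} (ha : a ∈ S) (hb : b ∈ S) (hab : a < b) (hc : c a = c b) :
    colorVandermonde K c S = (X a - X b) * colorVandermondeErase K c S (a, b) :=
  (Finset.mul_prod_erase _ (fun p : Fin n × Fin n => (X p.1 - X p.2 : MvPolynomial (Fin n) K))
    (a := (a, b)) (by simp [ha, hb, hab, hc])).symm

theorem colorVandermonde_dvd_erase (K : Type*) [CommRing K] {n : ℕ} (c : Fin n → ℕ)
    {S S' : Finset (Fin n)} {a b : Fin n} (hS : S' ⊆ S) (h : a ∉ S' ∨ b ∉ S') :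
    colorVandermonde K c S' ∣ colorVandermondeErase K c S (a, b) := by
  apply Finset.prod_dvd_prod_of_subset
  rintro ⟨i, j⟩
  simp only [Finset.mem_filter, Finset.mem_product, Finset.mem_erase, ne_eq, Prod.mk.injEq]
  rintro ⟨⟨hi, hj⟩, hij⟩
  refine ⟨?_, ⟨hS hi, hS hj⟩, hij⟩
  rintro ⟨rfl, rfl⟩
  tauto

theorem exists_lt_of_color_eq {n : ℕ} {c : Fin n → ℕ} {S : Finset (Fin n)}
    (h : (S.image c).card < S.card) : ∃ a ∈ S, ∃ b ∈ S, a < b ∧ c a = c b := by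
  obtain ⟨a, ha, b, hb, hab, hc⟩ := Finset.exists_ne_map_eq_of_card_lt_of_maps_to h
    (fun a ha => Finset.mem_image_of_mem c ha)
  rcases lt_or_gt_of_ne hab with h | h
  · exact ⟨a, ha, b, hb, h, hc⟩
  · exact ⟨b, hb, a, ha, h, hc.symm⟩

theorem card_image_lt_of_subset {n : ℕ} {c : Fin n → ℕ} {S S' : Finset (Fin n)} (hS : S' ⊆ S)
    {z : Fin n} (hz : z ∈ S) (h : ∀ i ∈ S', c i ≠ c z) :
    (S'.image c).card < (S.image c).card := by
  apply Finset.card_lt_card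
  rw [Finset.ssubset_iff_of_subset (Finset.image_subset_image hS)]
  exact ⟨c z, Finset.mem_image_of_mem c hz, by simpa using h⟩

/-- In a coloring of at least `2 * d > 0` points with all color classes of size at least two,
there are at least `d` more points than colors, and in the case of equality there is a color
class with exactly two elements. -/
theorem exists_pair_of_no_singleton {n d : ℕ} {c : Fin n → ℕ} {S : Finset (Fin n)}
    (hd : 0 < d) (hS : 2 * d ≤ S.card) (hcard : S.card = (S.image c).card + d)
    (hsing : ∀ z ∈ S, ∃ i ∈ S, i ≠ z ∧ c i = c z) :
    ∃ a ∈ S, ∃ b ∈ S, a < b ∧ c a = c b ∧ ∀ i ∈ (S.erase a).erase b, c i ≠ c a := by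
  by_contra! hcon
  have h3 : 3 * (S.image c).card ≤ S.card := by
    refine Finset.mul_card_image_le_card (s := S) (f := c) 3 ?_
    intro k hk
    obtain ⟨a, ha, rfl⟩ := Finset.mem_image.mp hk
    obtain ⟨b, hb, hba, hbc⟩ := hsing a ha
    obtain ⟨i, hi, hic⟩ : ∃ i ∈ (S.erase a).erase b, c i = c a := by
      rcases lt_or_gt_of_ne hba with h | h
      · obtain ⟨i, hi, hic⟩ := hcon b hb a ha h hbc
        exact ⟨i, by rwa [Finset.erase_right_comm], hic.trans hbc⟩
      · exact hcon a ha b hb h hbc.symm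
    simp only [Finset.mem_erase] at hi
    rw [Nat.succ_le_iff, Finset.two_lt_card]
    exact ⟨a, by simp [ha], b, by simp [hb, hbc], i, by simp [hi, hic], hba.symm,
      Ne.symm hi.2.1, Ne.symm hi.1⟩
  omega

theorem colorVandermonde_mem_matchingIdeal (K : Type*) [CommRing K] {n : ℕ} (c : Fin n → ℕ) :
    ∀ (d : ℕ) (S : Finset (Fin n)), 2 * d ≤ S.card → (S.image c).card + d ≤ S.card →
      colorVandermonde K c S ∈ matchingIdeal K d S
  | 0, _, _, _ => Submodule.mem_top
  | d + 1, S, hS, hcard => by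
    have hsub (a b : Fin n) : (S.erase a).erase b ⊆ S :=
      (Finset.erase_subset _ _).trans (Finset.erase_subset _ _)
    have herase {a b : Fin n} (ha : a ∈ S) (hb : b ∈ S) (hab : a ≠ b) :
        ((S.erase a).erase b).card + 2 = S.card := by
      have h1 := Finset.card_erase_add_one ha
      have h2 := Finset.card_erase_add_one (Finset.mem_erase.mpr ⟨hab.symm, hb⟩)
      omega
    have hpair {a b : Fin n} (ha : a ∈ S) (hb : b ∈ S) (hab : a < b) (hc : c a = c b)
        (hlt : (((S.erase a).erase b).image c).card + d ≤ ((S.erase a).erase b).card) :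
        colorVandermonde K c S ∈ matchingIdeal K (d + 1) S := by
      rw [colorVandermonde_eq_mul_erase ha hb hab hc]
      refine X_sub_X_mul_mem_matchingIdeal ha (Finset.mem_erase.mpr ⟨hab.ne', hb⟩) ?_
      refine Ideal.mem_of_dvd _ (colorVandermonde_dvd_erase K c (hsub a b) (by simp)) ?_
      have := herase ha hb hab.ne
      exact colorVandermonde_mem_matchingIdeal K c d _ (by omega) hlt
    obtain ⟨a, ha, b, hb, hab, hc⟩ := exists_lt_of_color_eq (c := c) (S := S) (by omega)
    by_cases hlarge : (S.image c).card + (d + 1) < S.card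
    · refine hpair ha hb hab hc ?_
      have h1 := Finset.card_le_card (Finset.image_subset_image (f := c) (hsub a b))
      have := herase ha hb hab.ne
      omega
    by_cases hsing : ∃ z ∈ S, ∀ i ∈ S, i ≠ z → c i ≠ c z
    · obtain ⟨z, hz, hsing⟩ := hsing
      have haz : a ≠ z := by
        rintro rfl
        exact hsing b hb hab.ne' hc.symm
      have hbz : b ≠ z := by
        rintro rfl
        exact hsing a ha hab.ne hc
      have key {e : Fin n} (he : e ∈ S) (hez : e ≠ z) (hab : e = a ∨ e = b) :
          (X e - X z) * colorVandermondeErase K c S (a, b) ∈ matchingIdeal K (d + 1) S := by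
        refine X_sub_X_mul_mem_matchingIdeal he (Finset.mem_erase.mpr ⟨hez.symm, hz⟩) ?_
        refine Ideal.mem_of_dvd _ (colorVandermonde_dvd_erase K c (hsub e z) ?_) ?_
        · rcases hab with rfl | rfl <;> simp
        · have h1 := herase he hz hez
          have h2 := card_image_lt_of_subset (hsub e z) hz (c := c) (fun i hi => by
            simp only [Finset.mem_erase] at hi
            exact hsing i hi.2.2 hi.1)
          exact colorVandermonde_mem_matchingIdeal K c d _ (by omega) (by omega)
      rw [colorVandermonde_eq_mul_erase ha hb hab hc,
        ← sub_sub_sub_cancel_right (X a) (X b) (X z), sub_mul]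
      exact sub_mem (key ha haz (.inl rfl)) (key hb hbz (.inr rfl))
    · push Not at hsing
      obtain ⟨a, ha, b, hb, hab, hc, hsep⟩ :=
        exists_pair_of_no_singleton d.succ_pos hS (by omega) hsing
      refine hpair ha hb hab hc ?_
      have h1 := herase ha hb hab.ne
      have h2 := card_image_lt_of_subset (hsub a b) ha hsep
      omega

theorem matchingIdeal_le (K : Type*) [CommRing K] {n : ℕ} :
    ∀ (d : ℕ) (S : Finset (Fin n)),
      matchingIdeal K d S ≤ Ideal.span {f | ∃ u : Fin d ⊕ Fin d → Fin n, Function.Injective u ∧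
        (∀ k, u k ∈ S) ∧ f = ∏ k, (X (u (.inl k)) - X (u (.inr k)))}
  | 0, S => by
    intro f _
    have h1 : (1 : MvPolynomial (Fin n) K) ∈ Ideal.span {f | ∃ u : Fin 0 ⊕ Fin 0 → Fin n,
        Function.Injective u ∧ (∀ k, u k ∈ S) ∧ f = ∏ k, (X (u (.inl k)) - X (u (.inr k)))} :=
      Ideal.subset_span ⟨isEmptyElim, Function.injective_of_subsingleton _, isEmptyElim,
        by simp⟩
    simpa using Ideal.mul_mem_left _ f h1
  | d + 1, S => by
    refine iSup₂_le fun a ha => iSup₂_le fun b hb => ?_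
    refine (Ideal.mul_mono_right (matchingIdeal_le K d _)).trans ?_
    rw [Ideal.span_mul_span', Ideal.span_le]
    rintro _ ⟨_, rfl, _, ⟨u, hu, huS, rfl⟩, rfl⟩
    apply Ideal.subset_span
    simp only [Finset.mem_erase] at huS hb
    refine ⟨Sum.elim (Fin.cons a (u ∘ .inl)) (Fin.cons b (u ∘ .inr)), ?_, ?_, ?_⟩
    · refine Function.Injective.sumElim ?_ ?_ ?_
      · rw [Fin.cons_injective_iff]
        exact ⟨by rintro ⟨k, hk⟩; exact (huS _).2.1 hk, hu.comp Sum.inl_injective⟩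
      · rw [Fin.cons_injective_iff]
        exact ⟨by rintro ⟨k, hk⟩; exact (huS _).1 hk, hu.comp Sum.inr_injective⟩
      · intro i j
        induction i using Fin.cases <;> induction j using Fin.cases
        · simpa using hb.1.symm
        · simpa using (huS _).2.1.symm
        · simpa using (huS _).1
        · simpa using hu.ne (by simp)
    · rintro (k | k) <;> induction k using Fin.cases <;> simp [ha, hb, huS]
    · simp [Fin.prod_univ_succ]

end Matchings

section Tableaux

theorem exists_sum_equiv_of_injective {α : Type*} [Finite α] {m n : ℕ} {u : α → Fin n}
    (hu : Function.Injective u) (hn : Nat.card α + m = n) :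
    ∃ e : α ⊕ Fin m ≃ Fin n, ∀ k, e (.inl k) = u k := by
  classical
  have hcard : Nat.card ((Set.range u)ᶜ : Set (Fin n)) = m := by
    have h1 := Nat.card_congr (Equiv.Set.sumCompl (Set.range u))
    rw [Nat.card_sum, Nat.card_range_of_injective hu, Nat.card_fin] at h1
    omega
  exact ⟨((Equiv.ofInjective u hu).sumCongr (Finite.equivFinOfCardEq hcard).symm).trans
    (Equiv.Set.sumCompl _), fun k => by simp⟩

theorem prod_matching_mem_spechtIdeal (K : Type*) [CommRing K] {n d : ℕ} (hdn : 2 * d ≤ n)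
    {u : Fin d ⊕ Fin d → Fin n} (hu : Function.Injective u) :
    ∏ k, (X (u (.inl k)) - X (u (.inr k))) ∈ spechtIdeal K n [n - d, d] := by
  obtain ⟨e, he⟩ := exists_sum_equiv_of_injective (m := n - 2 * d) hu (by simp; omega)
  let box : (Fin d ⊕ Fin d) ⊕ Fin (n - 2 * d) → ℕ × ℕ :=
    Sum.elim (Sum.elim (fun k => (0, k)) fun k => (1, k)) fun l => (0, d + l)
  have hbox : Function.Injective box := by
    rintro ((i | i) | i) ((j | j) | j) h <;> simp [box, Fin.ext_iff] at h ⊢ <;> omega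
  apply Ideal.subset_span
  refine ⟨box ∘ e.symm, ⟨hbox.comp e.symm.injective, ?_, ?_⟩, ?_⟩
  · intro i
    obtain ⟨k, rfl⟩ := e.surjective i
    rcases k with (k | k) | k <;> simp [box] <;> omega
  · intro r c hr hc
    suffices ∃ k, box k = (r, c) by
      obtain ⟨k, hk⟩ := this
      exact ⟨e k, by simpa using hk⟩
    have hr : r = 0 ∨ r = 1 := by
      simp at hr
      omega
    rcases hr with rfl | rfl
    · by_cases hcd : c < d
      · exact ⟨.inl (.inl ⟨c, hcd⟩), rfl⟩
      · simp only [List.getD_cons_zero] at hc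
        refine ⟨.inr ⟨c - d, by omega⟩, ?_⟩
        simp only [box, Sum.elim_inr, Prod.mk.injEq, true_and]
        omega
    · exact ⟨.inl (.inr ⟨c, by simpa using hc⟩), rfl⟩
  · refine Finset.prod_nbij (fun k => (u (.inl k), u (.inr k))) ?_ ?_ ?_ ?_
    · intro k _
      simp [← he, box]
    · intro i _ j _ h
      simpa [hu.eq_iff] using congrArg Prod.fst h
    · rintro ⟨i, j⟩ hij
      obtain ⟨i, rfl⟩ := e.surjective i
      obtain ⟨j, rfl⟩ := e.surjective j
      simp only [Finset.coe_filter, Finset.mem_univ, true_and, Function.comp_apply,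
        Equiv.symm_apply_apply, Set.mem_ofPred_eq] at hij
      rcases i with (i | i) | i <;> rcases j with (j | j) | j <;>
        simp [box, he, ← Fin.ext_iff, hu.eq_iff] at hij ⊢ <;> first | exact hij.symm | omega
    · simp

/-- A Specht polynomial of shape `(n - d, d)` vanishes at any point with more than `n - d` equal
coordinates. -/
theorem aeval_spechtPoly_eq_zero {K L : Type*} [CommRing K] [CommRing L] [Algebra K L] {n d : ℕ}
    (hdn : 2 * d ≤ n) {T : Fin n → ℕ × ℕ} (hT : IsTableau [n - d, d] T) {p : Fin n → L} {v : L}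
    {B : Finset (Fin n)} (hB : ∀ i ∈ B, p i = v) (hcard : n - d < B.card) :
    aeval p (spechtPoly K T) = 0 := by
  obtain ⟨hinj, hmem, -⟩ := hT
  have hcol (i : Fin n) : (T i).2 < n - d := by
    obtain ⟨h1, h2⟩ := hmem i
    rcases h : (T i).1 with _ | _ | r
    · simpa [h] using h2
    · simp only [h, zero_add, List.getD_cons_succ, List.getD_cons_zero] at h2
      omega
    · simp only [h, List.length_cons, List.length_nil] at h1
      omega
  obtain ⟨i, hi, j, hj, hij, hc⟩ := Finset.exists_ne_map_eq_of_card_lt_of_maps_to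
    (s := B) (t := Finset.range (n - d)) (f := fun i => (T i).2) (by simpa using hcard)
    (fun i _ => by simpa using hcol i)
  have hrow : (T i).1 ≠ (T j).1 := fun h => hij (hinj (Prod.ext h hc))
  rw [spechtPoly, map_prod]
  rcases lt_or_gt_of_ne hrow with h | h
  · exact Finset.prod_eq_zero (i := (i, j)) (by simp [hc, h]) (by simp [hB i hi, hB j hj])
  · exact Finset.prod_eq_zero (i := (j, i)) (by simp [hc, h]) (by simp [hB i hi, hB j hj])

theorem aeval_eq_zero_of_mem_spechtIdeal {K L : Type*} [CommRing K] [CommRing L] [Algebra K L]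
    {n d : ℕ} (hdn : 2 * d ≤ n) {f : MvPolynomial (Fin n) K} (hf : f ∈ spechtIdeal K n [n - d, d])
    {p : Fin n → L} {v : L} {B : Finset (Fin n)} (hB : ∀ i ∈ B, p i = v) (hcard : n - d < B.card) :
    aeval p f = 0 := by
  have hle : spechtIdeal K n [n - d, d] ≤
      RingHom.ker (aeval p : MvPolynomial (Fin n) K →ₐ[K] L) := by
    rw [spechtIdeal, Ideal.span_le]
    rintro _ ⟨T, hT, rfl⟩
    exact aeval_spechtPoly_eq_zero hdn hT hB hcard
  exact hle hf

end Tableaux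

section LeadingExponent

variable {K : Type*} [Field K] {n : ℕ}

theorem lex_degree_X_sub_X {i j : Fin n} (hij : i < j) :
    MonomialOrder.lex.degree (X i - X j : MvPolynomial (Fin n) K) = Finsupp.single i 1 := by
  rw [MonomialOrder.degree_sub_of_lt, MonomialOrder.degree_X]
  rw [MonomialOrder.degree_X, MonomialOrder.degree_X, MonomialOrder.lex_lt_iff]
  exact Finsupp.Lex.single_lt_iff.mpr hij

theorem lex_degree_colorVandermonde (c : Fin n → ℕ) (i : Fin n) :
    MonomialOrder.lex.degree (colorVandermonde K c Finset.univ) i =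
      (Finset.univ.filter fun j => i < j ∧ c j = c i).card := by
  have hne : ∀ p ∈ (Finset.univ ×ˢ Finset.univ : Finset (Fin n × Fin n)).filter
      (fun p => p.1 < p.2 ∧ c p.1 = c p.2), (X p.1 - X p.2 : MvPolynomial (Fin n) K) ≠ 0 := by
    intro p hp
    simp only [Finset.mem_filter] at hp
    exact sub_ne_zero.mpr fun h => hp.2.1.ne (X_injective h)
  rw [colorVandermonde, MonomialOrder.degree_prod hne, Finset.sum_congr rfl
    (g := fun p : Fin n × Fin n => Finsupp.single p.1 1)
    (fun p hp => lex_degree_X_sub_X (Finset.mem_filter.mp hp).2.1), Finsupp.finsetSum_apply]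
  simp only [Finsupp.single_apply, ← Finset.card_filter, Finset.filter_filter]
  refine Finset.card_nbij' Prod.snd (fun j => (i, j)) ?_ ?_ ?_ ?_
  · rintro ⟨a, b⟩ h
    simp only [Finset.coe_filter, Set.mem_ofPred_eq, Finset.mem_univ, true_and] at h ⊢
    obtain ⟨-, ⟨h1, h2⟩, rfl⟩ := h
    exact ⟨h1, h2.symm⟩
  · intro b h
    simp only [Finset.coe_filter, Set.mem_ofPred_eq, Finset.mem_univ, true_and] at h ⊢
    simp [h]
  · rintro ⟨a, b⟩ h
    simp only [Finset.coe_filter, Set.mem_ofPred_eq] at h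
    simp [h.2.2]
  · intro b _
    rfl

theorem colorVandermonde_ne_zero (c : Fin n → ℕ) (S : Finset (Fin n)) :
    colorVandermonde K c S ≠ 0 := by
  refine Finset.prod_ne_zero_iff.mpr fun p hp => ?_
  simp only [Finset.mem_filter] at hp
  exact sub_ne_zero.mpr fun h => hp.2.1.ne (X_injective h)

end LeadingExponent

/-- A polynomial vanishing at all points with more than `n - d` equal coordinates in an infinite
extension field lies in the Specht ideal of shape `(n - d, d)`. -/
theorem mem_spechtIdeal_of_aeval_eq_zero {K : Type*} [Field K] (L : Type*) [Field L] [Infinite L]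
    [Algebra K L] {n d : ℕ} (hdn : 2 * d ≤ n) {f : MvPolynomial (Fin n) K}
    (hf : ∀ (p : Fin n → L) (v : L) (B : Finset (Fin n)), (∀ i ∈ B, p i = v) → n - d < B.card →
      aeval p f = 0) :
    f ∈ spechtIdeal K n [n - d, d] := by
  classical
  set I := spechtIdeal K n [n - d, d]
  obtain ⟨q, r, hfr, -, hr⟩ := MonomialOrder.lex.div_set
    (B := {g : MvPolynomial (Fin n) K | g ∈ I ∧ g ≠ 0})
    (fun b hb => (MonomialOrder.lex.leadingCoeff_ne_zero_iff.mpr hb.2).isUnit) f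
  have hq : Finsupp.linearCombination (MvPolynomial (Fin n) K)
      (fun b : {g : MvPolynomial (Fin n) K | g ∈ I ∧ g ≠ 0} => (b : MvPolynomial (Fin n) K)) q
      ∈ I := by
    rw [Finsupp.linearCombination_apply]
    exact Submodule.sum_mem _ fun b _ => I.mul_mem_left _ b.2.1
  suffices hr0 : r = 0 by
    rwa [hfr, hr0, add_zero]
  by_contra hr0
  obtain ⟨p, hp, hle⟩ := exists_eval_ne_zero_of_lex_maximal (map (algebraMap K L) r)
    (MonomialOrder.lex.degree r)
    (by
      rw [coeff_map, map_ne_zero]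
      exact MonomialOrder.lex.coeff_degree_ne_zero_iff.mpr hr0)
    (by
      intro b hb
      exact not_lt.mpr (MonomialOrder.lex.le_degree (support_map_subset _ _ hb)))
  have hlater (i : Fin n) : laterCount p i < n - d := by
    by_contra! hi
    refine hp ?_
    have hB : ∀ j ∈ Finset.univ.filter (fun j => p j = p i), p j = p i := by simp
    have hcard := hi.trans_lt (laterCount_lt_card p i)
    rw [eval_map, ← aeval_def, ← add_sub_cancel_left _ r, ← hfr, map_sub,
      hf p _ _ hB hcard, aeval_eq_zero_of_mem_spechtIdeal hdn hq hB hcard, sub_zero]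
  have hmem : colorVandermonde K (laterCount p) Finset.univ ∈ I := by
    have h1 : (Finset.univ.image (laterCount p)).card ≤ n - d := by
      rw [← Finset.card_range (n - d)]
      exact Finset.card_le_card (Finset.image_subset_iff.mpr fun i _ => by simpa using hlater i)
    have h2 := matchingIdeal_le K d Finset.univ
      (colorVandermonde_mem_matchingIdeal K (laterCount p) d Finset.univ (by simpa) (by
        rw [Finset.card_univ, Fintype.card_fin]
        omega))
    refine Ideal.span_le.mpr ?_ h2
    rintro _ ⟨u, hu, -, rfl⟩
    exact prod_matching_mem_spechtIdeal K hdn hu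
  refine hr _ (MonomialOrder.lex.degree_mem_support hr0) _
    ⟨hmem, colorVandermonde_ne_zero _ _⟩ fun i => ?_
  rw [lex_degree_colorVandermonde]
  exact hle i

/-- Theorem 3.1: the Specht ideal `I^Sp_{(n-d, d)}` is a radical ideal, over any field. -/
theorem specht_two_rows_isRadical {K : Type*} [Field K] (n d : ℕ)
    (hd : 1 ≤ d) (hdn : 2 * d ≤ n) :
    (spechtIdeal K n [n - d, d]).IsRadical := by
  rintro f ⟨k, hk⟩
  refine mem_spechtIdeal_of_aeval_eq_zero (AlgebraicClosure K) hdn fun p v B hB hcard => ?_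
  have h := aeval_eq_zero_of_mem_spechtIdeal hdn hk hB hcard
  rw [map_pow] at h
  exact eq_zero_of_pow_eq_zero h
end

section
/- If char(K) = 0, then for every d with 1 ≤ d ≤ n/2 the ring R/I^Sp_{(n−d,d)} is Cohen–Macaulay. -/
open MvPolynomial

section Harmonic

variable {K σ : Type*} [Field K] [DecidableEq σ]

/-- Multiplication by the variable `i` on coefficient functions of squarefree polynomials. -/
def insertOp (K : Type*) [Field K] (i : σ) : (Finset σ → K) →ₗ[K] (Finset σ → K) where
  toFun v F := if i ∈ F then v (F.erase i) else 0
  map_add' v w := by ext F; by_cases h : i ∈ F <;> simp [h]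
  map_smul' c v := by ext F; by_cases h : i ∈ F <;> simp [h]

/-- The partial derivative with respect to the variable `i` on coefficient functions of
squarefree polynomials. -/
def linkOp (K : Type*) [Field K] (i : σ) : (Finset σ → K) →ₗ[K] (Finset σ → K) where
  toFun v F := if i ∈ F then 0 else v (insert i F)
  map_add' v w := by ext F; by_cases h : i ∈ F <;> simp [h]
  map_smul' c v := by ext F; by_cases h : i ∈ F <;> simp [h]

lemma insertOp_apply (i : σ) (v : Finset σ → K) (F : Finset σ) :
    insertOp K i v F = if i ∈ F then v (F.erase i) else 0 := rfl

lemma linkOp_apply (i : σ) (v : Finset σ → K) (F : Finset σ) :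
    linkOp K i v F = if i ∈ F then 0 else v (insert i F) := rfl

/-- `IsSpechtFun T d v`: `v` is the coefficient function of a product of `d` differences of
variables, with the `2 d` variables being pairwise distinct and forming the set `T`. -/
inductive IsSpechtFun (K : Type*) {σ : Type*} [Field K] [DecidableEq σ] :
    Finset σ → ℕ → (Finset σ → K) → Prop
  | one : IsSpechtFun K ∅ 0 (Pi.single ∅ 1)
  | mul {T : Finset σ} {d : ℕ} {v : Finset σ → K} {i j : σ} (hi : i ∉ T) (hj : j ∉ T)
      (hij : i ≠ j) (h : IsSpechtFun K T d v) :
      IsSpechtFun K (insert i (insert j T)) (d + 1) (insertOp K i v - insertOp K j v)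

lemma IsSpechtFun.card {T : Finset σ} {d : ℕ} {v : Finset σ → K} (h : IsSpechtFun K T d v) :
    T.card = 2 * d := by
  induction h with
  | one => simp
  | mul hi hj hij _ ih =>
    rw [Finset.card_insert_of_notMem (by simp [hi, hij]), Finset.card_insert_of_notMem hj, ih]
    ring

variable [Fintype σ]

/-- The sum of all partial derivatives on coefficient functions of squarefree polynomials. -/
def downOp (K σ : Type*) [Field K] [Fintype σ] [DecidableEq σ] :
    (Finset σ → K) →ₗ[K] (Finset σ → K) where
  toFun v G := ∑ i ∈ Gᶜ, v (insert i G)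
  map_add' v w := by ext G; simp [Finset.sum_add_distrib]
  map_smul' c v := by ext G; simp [Finset.mul_sum]

lemma downOp_apply (v : Finset σ → K) (G : Finset σ) :
    downOp K σ v G = ∑ i ∈ Gᶜ, v (insert i G) := rfl

/-- Functions on the `e`-subsets of `X` annihilated by `downOp`. -/
def harmonicFun (K : Type*) [Field K] (X : Finset σ) (e : ℕ) : Submodule K (Finset σ → K) where
  carrier := {v | (∀ F, v F ≠ 0 → F ⊆ X ∧ F.card = e) ∧ downOp K σ v = 0}
  zero_mem' := by simp
  add_mem' {v w} hv hw := by
    refine ⟨fun F hF => ?_, by simp [hv.2, hw.2]⟩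
    by_cases h : v F = 0
    · exact hw.1 F (by simpa [h] using hF)
    · exact hv.1 F h
  smul_mem' c v hv := by
    refine ⟨fun F hF => hv.1 F ?_, by simp [hv.2]⟩
    intro h
    simp [h] at hF

lemma harmonic_mono {X Y : Finset σ} (h : X ⊆ Y) (e : ℕ) : harmonicFun K X e ≤ harmonicFun K Y e :=
  fun _ hv => ⟨fun F hF => ⟨(hv.1 F hF).1.trans h, (hv.1 F hF).2⟩, hv.2⟩

lemma downOp_insertOp {i : σ} {v : Finset σ → K} (hv : ∀ F, i ∈ F → v F = 0) :
    downOp K σ (insertOp K i v) = v + insertOp K i (downOp K σ v) := by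
  ext G
  simp only [downOp_apply, insertOp_apply, Pi.add_apply]
  by_cases hG : i ∈ G
  · rw [hv G hG, if_pos hG, zero_add]
    have hc : (G.erase i)ᶜ = insert i Gᶜ := by
      ext j; by_cases h : j = i <;> simp [h]
    rw [hc, Finset.sum_insert (by simp [hG]), hv _ (Finset.mem_insert_self _ _), zero_add]
    refine Finset.sum_congr rfl fun j hj => ?_
    have hji : j ≠ i := by rintro rfl; simp [hG] at hj
    rw [if_pos (by simp [hG]), Finset.erase_insert_of_ne hji]
  · rw [if_neg hG, add_zero, Finset.sum_eq_single i]
    · simp [Finset.erase_insert hG]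
    · intro j _ hji
      simp [hG, Ne.symm hji]
    · simp [hG]

lemma downOp_linkOp (i : σ) (v : Finset σ → K) :
    downOp K σ (linkOp K i v) = linkOp K i (downOp K σ v) := by
  ext G
  simp only [downOp_apply, linkOp_apply]
  by_cases hG : i ∈ G
  · simp [hG]
  · rw [if_neg hG]
    have hc : Gᶜ = insert i (insert i G)ᶜ := by
      ext j; by_cases h : j = i <;> simp [h, hG]
    rw [hc, Finset.sum_insert (by simp)]
    simp only [Finset.mem_insert_self, if_true, zero_add]
    refine Finset.sum_congr rfl fun j hj => ?_
    simp only [Finset.mem_compl, Finset.mem_insert, not_or] at hj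
    rw [if_neg (by simp [hG, Ne.symm hj.1]), Finset.insert_comm]

lemma IsSpechtFun.mem_harmonic {T : Finset σ} {d : ℕ} {v : Finset σ → K}
    (h : IsSpechtFun K T d v) : v ∈ harmonicFun K T d := by
  induction h with
  | one =>
    refine ⟨fun F hF => ?_, ?_⟩
    · have : F = ∅ := by by_contra h; simp [h] at hF
      simp [this]
    · ext G
      simp only [downOp_apply, Pi.zero_apply]
      exact Finset.sum_eq_zero fun i _ => by simp
  | @mul T d v i j hi hj hij h ih =>
    have key : ∀ {k : σ}, k ∉ T → ∀ F, k ∈ F → v F = 0 := fun {k} hk F hF => by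
      by_contra h0
      exact hk ((ih.1 F h0).1 hF)
    have hsupp : ∀ {k : σ}, k ∉ T → ∀ F, insertOp K k v F ≠ 0 →
        F ⊆ insert k T ∧ F.card = d + 1 := fun {k} _ F hF => by
      rw [insertOp_apply] at hF
      split_ifs at hF with hkF
      · obtain ⟨h1, h2⟩ := ih.1 _ hF
        refine ⟨by rwa [Finset.subset_insert_iff], ?_⟩
        rw [← Finset.card_erase_add_one hkF, h2]
      · exact absurd rfl hF
    refine ⟨fun F hF => ?_, ?_⟩
    · by_cases h0 : insertOp K i v F = 0
      · have := hsupp hj F (by simpa [h0] using hF)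
        exact ⟨this.1.trans (Finset.subset_insert _ _), this.2⟩
      · have := hsupp hi F h0
        exact ⟨this.1.trans (Finset.insert_subset_insert _ (Finset.subset_insert _ _)), this.2⟩
    · rw [map_sub, downOp_insertOp (key hi), downOp_insertOp (key hj), ih.2]
      simp

/-- The coefficient functions of Specht polynomials supported in `X` with support satisfying `p`. -/
def spechtFunSet (K : Type*) [Field K] (X : Finset σ) (d : ℕ) (p : Finset σ → Prop) :
    Set (Finset σ → K) :=
  {v | ∃ T ⊆ X, p T ∧ IsSpechtFun K T d v}

lemma linkOp_mem_harmonic {X : Finset σ} {e : ℕ} {v : Finset σ → K}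
    (hv : v ∈ harmonicFun K X (e + 1)) (i : σ) : linkOp K i v ∈ harmonicFun K (X.erase i) e := by
  refine ⟨fun F hF => ?_, by rw [downOp_linkOp, hv.2, map_zero]⟩
  rw [linkOp_apply] at hF
  split_ifs at hF with hi
  · exact absurd rfl hF
  · obtain ⟨h1, h2⟩ := hv.1 _ hF
    rw [Finset.card_insert_of_notMem hi] at h2
    refine ⟨Finset.subset_erase.mpr ⟨(Finset.subset_insert _ _).trans h1, hi⟩, by omega⟩

lemma mem_harmonic_erase {X : Finset σ} {e : ℕ} {v : Finset σ → K} {i : σ}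
    (hv : v ∈ harmonicFun K X e) (h : linkOp K i v = 0) : v ∈ harmonicFun K (X.erase i) e := by
  refine ⟨fun F hF => ?_, hv.2⟩
  obtain ⟨h1, h2⟩ := hv.1 F hF
  refine ⟨Finset.subset_erase.mpr ⟨h1, fun hi => hF ?_⟩, h2⟩
  simpa [linkOp_apply, Finset.insert_erase hi] using congrFun h (F.erase i)

lemma linkOp_insertOp_sub {T : Finset σ} {e : ℕ} {u : Finset σ → K} {i k : σ}
    (hu : u ∈ harmonicFun K T e) (hi : i ∉ T) (hik : i ≠ k) :
    linkOp K i (insertOp K i u - insertOp K k u) = u := by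
  have h0 : ∀ F, i ∈ F → u F = 0 := fun F hF => by
    by_contra h0
    exact hi ((hu.1 F h0).1 hF)
  ext F
  simp only [linkOp_apply, Pi.sub_apply, insertOp_apply]
  by_cases hF : i ∈ F
  · simp [hF, h0 F hF]
  · have h1 : u ((insert i F).erase k) = 0 := h0 _ (by simp [hik])
    simp [hF, h1, Finset.erase_insert hF]

/-- Coefficient functions in the span of Specht functions lift along `linkOp i`. -/
lemma exists_linkOp_eq {X : Finset σ} {e : ℕ} {i : σ} {p q : Finset σ → Prop} (hiX : i ∈ X)
    (hpq : ∀ T ⊆ X.erase i, T.card = 2 * e → p T →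
      ∃ k ∈ X.erase i, k ∉ T ∧ q (insert i (insert k T)))
    {u : Finset σ → K} (hu : u ∈ Submodule.span K (spechtFunSet K (X.erase i) e p)) :
    ∃ w ∈ Submodule.span K (spechtFunSet K X (e + 1) q), linkOp K i w = u := by
  suffices h : Submodule.span K (spechtFunSet K (X.erase i) e p) ≤
      (Submodule.span K (spechtFunSet K X (e + 1) q)).map (linkOp K i) from h hu
  rw [Submodule.span_le]
  rintro v ⟨T, hT, hp, hv⟩
  obtain ⟨k, hkX, hkT, hq⟩ := hpq T hT hv.card hp
  have hiT : i ∉ T := fun h => by simpa using hT h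
  have hik : i ≠ k := fun h => by simp [h] at hkX
  refine ⟨_, Submodule.subset_span ⟨_, ?_, hq, hv.mul hiT hkT hik⟩,
    linkOp_insertOp_sub hv.mem_harmonic hiT hik⟩
  exact Finset.insert_subset hiX (Finset.insert_subset (Finset.mem_of_mem_erase hkX)
    (hT.trans (Finset.erase_subset _ _)))

lemma span_spechtFunSet_le_harmonic (X : Finset σ) (e : ℕ) (p : Finset σ → Prop) :
    Submodule.span K (spechtFunSet K X e p) ≤ harmonicFun K X e := by
  rw [Submodule.span_le]
  rintro v ⟨T, hT, _, hv⟩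
  exact harmonic_mono hT e hv.mem_harmonic

section CharZero

variable [CharZero K]

lemma harmonic_sum_superset_eq_zero {X : Finset σ} {e : ℕ} {v : Finset σ → K}
    (hv : v ∈ harmonicFun K X e) (c : ℕ) (G : Finset σ) (hG : G.card + (c + 1) = e) :
    ∑ F with G ⊆ F, v F = 0 := by
  have hstep : ∑ i ∈ Gᶜ, ∑ F with insert i G ⊆ F, v F = ((c : K) + 1) * ∑ F with G ⊆ F, v F := by
    simp only [Finset.sum_filter]
    rw [Finset.sum_comm, Finset.mul_sum]
    refine Finset.sum_congr rfl fun F _ => ?_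
    by_cases hF : v F = 0
    · simp [hF]
    have hcard := (hv.1 F hF).2
    by_cases hGF : G ⊆ F
    · rw [if_pos hGF, ← Finset.sum_filter, Finset.sum_const, nsmul_eq_mul]
      have : (Gᶜ.filter fun i => insert i G ⊆ F) = F \ G := by
        ext i; simp [Finset.insert_subset_iff, hGF, and_comm]
      rw [this, Finset.card_sdiff_of_subset hGF, hcard, show e - G.card = c + 1 by omega]
      push_cast; ring
    · rw [if_neg hGF, mul_zero]
      refine Finset.sum_eq_zero fun i _ => if_neg fun h => hGF ?_
      exact (Finset.subset_insert _ _).trans h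
  have hne : (c : K) + 1 ≠ 0 := by exact_mod_cast Nat.succ_ne_zero c
  refine (mul_eq_zero.mp (hstep.symm.trans ?_)).resolve_left hne
  cases c with
  | zero =>
    refine Eq.trans ?_ (congrFun hv.2 G)
    rw [downOp_apply]
    refine Finset.sum_congr rfl fun i hi => ?_
    rw [Finset.mem_compl] at hi
    refine Finset.sum_eq_single_of_mem _ (by simp) fun F hF hne => ?_
    by_contra h0
    refine hne (Finset.eq_of_subset_of_card_le (by simpa using hF) ?_).symm
    rw [(hv.1 F h0).2, Finset.card_insert_of_notMem hi]
    omega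
  | succ c =>
    refine Finset.sum_eq_zero fun i hi => harmonic_sum_superset_eq_zero hv c _ ?_
    rw [Finset.card_insert_of_notMem (by simpa using hi)]
    omega

lemma harmonic_sum_superset_disjoint_eq_zero {X : Finset σ} {e : ℕ} {v : Finset σ → K}
    (hv : v ∈ harmonicFun K X e) (H : Finset σ) :
    ∀ G : Finset σ, G.card + H.card < e → ∑ F with G ⊆ F ∧ Disjoint F H, v F = 0 := by
  induction H using Finset.induction_on with
  | empty =>
    intro G hG
    simpa using harmonic_sum_superset_eq_zero hv (e - G.card - 1) G (by simp at hG; omega)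
  | insert h H hh ih =>
    intro G hG
    rw [Finset.card_insert_of_notMem hh] at hG
    have h1 := ih G (by omega)
    have h2 := ih (insert h G) (by have := Finset.card_insert_le h G; omega)
    rw [← Finset.sum_filter_add_sum_filter_not _ (fun F => h ∈ F)] at h1
    simp only [Finset.filter_filter] at h1
    have h3 : (Finset.univ.filter fun F : Finset σ => (G ⊆ F ∧ Disjoint F H) ∧ h ∈ F) =
        Finset.univ.filter fun F : Finset σ => insert h G ⊆ F ∧ Disjoint F H := by
      ext F; simp only [Finset.mem_filter, Finset.mem_univ, true_and, Finset.insert_subset_iff]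
      tauto
    rw [h3, h2, zero_add] at h1
    rw [← h1]
    refine Finset.sum_congr ?_ fun _ _ => rfl
    ext F
    simp only [Finset.mem_filter, Finset.mem_univ, true_and, Finset.disjoint_insert_right]
    tauto

lemma harmonic_eq_bot {X : Finset σ} {e : ℕ} (h : X.card < 2 * e) : harmonicFun K X e = ⊥ := by
  rw [eq_bot_iff]
  intro v hv
  rw [Submodule.mem_bot]
  ext F₀
  by_contra h0
  obtain ⟨h1, h2⟩ := hv.1 F₀ h0
  refine h0 ?_
  rw [Pi.zero_apply, ← harmonic_sum_superset_disjoint_eq_zero hv (X \ F₀) ∅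
    (by rw [Finset.card_sdiff_of_subset h1]; simp; omega)]
  refine (Finset.sum_eq_single_of_mem _ (by simp [Finset.disjoint_sdiff]) fun F hF hne => ?_).symm
  by_contra h3
  obtain ⟨h4, h5⟩ := hv.1 F h3
  refine hne (Finset.eq_of_subset_of_card_le (fun i hi => ?_) (by omega))
  simp only [Finset.mem_filter, Finset.mem_univ, true_and, Finset.empty_subset] at hF
  by_contra hi'
  exact Finset.disjoint_left.mp hF hi (by simp [h4 hi, hi'])

lemma harmonic_le_span {X : Finset σ} {e : ℕ} (h : 2 * e ≤ X.card) :
    harmonicFun K X e ≤ Submodule.span K (spechtFunSet K X e fun _ => True) := by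
  induction hn : X.card generalizing X e with
  | zero =>
    obtain rfl : e = 0 := by omega
    intro v hv
    have : v = v ∅ • Pi.single ∅ 1 := by
      ext F
      by_cases hF : F = ∅
      · simp [hF]
      · by_contra h0
        refine hF (Finset.card_eq_zero.mp (hv.1 F fun h => h0 ?_).2)
        simp [h, hF]
    rw [this]
    exact Submodule.smul_mem _ _ (Submodule.subset_span ⟨∅, by simp, trivial, .one⟩)
  | succ n ih =>
    intro v hv
    obtain ⟨i, hi⟩ : X.Nonempty := Finset.card_pos.mp (by omega)
    have hc : (X.erase i).card = n := by rw [Finset.card_erase_of_mem hi]; omega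
    have hmono : ∀ d, Submodule.span K (spechtFunSet K (X.erase i) d fun _ => True) ≤
        Submodule.span K (spechtFunSet K X d fun _ => True) := fun d =>
      Submodule.span_mono fun w ⟨T, hT, hp, hw⟩ => ⟨T, hT.trans (Finset.erase_subset _ _), hp, hw⟩
    cases e with
    | zero =>
      refine hmono _ (ih (by omega) hc (mem_harmonic_erase hv ?_))
      ext F
      rw [linkOp_apply, Pi.zero_apply]
      split_ifs with hF
      · rfl
      · by_contra h0
        simpa [Finset.card_insert_of_notMem hF] using (hv.1 _ h0).2
    | succ e =>
      obtain ⟨w, hw, hwu⟩ := exists_linkOp_eq (q := fun _ => True) hi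
        (fun T hT hTc _ => by
          obtain ⟨k, hk, hkT⟩ := Finset.exists_mem_notMem_of_card_lt_card (s := T)
            (t := X.erase i) (by omega)
          exact ⟨k, hk, hkT, trivial⟩)
        (ih (by omega) hc (linkOp_mem_harmonic hv i))
      have hvw := mem_harmonic_erase (i := i)
        (sub_mem hv (span_spechtFunSet_le_harmonic _ _ _ hw)) (by rw [map_sub, hwu, sub_self])
      rw [← sub_add_cancel v w]
      refine add_mem ?_ hw
      by_cases hlt : 2 * (e + 1) ≤ n
      · exact hmono _ (ih (by omega) hc hvw)
      · rw [harmonic_eq_bot (by omega), Submodule.mem_bot] at hvw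
        rw [hvw]
        exact zero_mem _

lemma mem_span_of_forall_superset_eq_zero {A : Finset σ} :
    ∀ {X : Finset σ} {e : ℕ} {v : Finset σ → K}, A ⊆ X → 2 * e + 1 ≤ X.card →
      v ∈ harmonicFun K X e → (∀ F, A ⊆ F → v F = 0) →
      v ∈ Submodule.span K (spechtFunSet K X e fun T => ¬ A ⊆ T) := by
  induction A using Finset.induction_on with
  | empty =>
    intro X e v _ _ _ h0
    rw [show v = 0 from funext fun F => h0 F (Finset.empty_subset _)]
    exact zero_mem _
  | insert i A hiA ih =>
    intro X e v hA hX hv h0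
    rw [Finset.insert_subset_iff] at hA
    have hc : (X.erase i).card = X.card - 1 := Finset.card_erase_of_mem hA.1
    cases e with
    | zero =>
      refine Submodule.span_mono ?_ (harmonic_le_span (by omega) hv)
      rintro w ⟨T, hT, _, hw⟩
      refine ⟨T, hT, fun h => ?_, hw⟩
      rw [Finset.card_eq_zero.mp hw.card] at h
      simpa using h (Finset.mem_insert_self _ _)
    | succ e =>
      have hA' : A ⊆ X.erase i := Finset.subset_erase.mpr ⟨hA.2, hiA⟩
      obtain ⟨w, hw, hwu⟩ := exists_linkOp_eq (q := fun T => ¬ insert i A ⊆ T) hA.1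
        (fun T hT hTc hp => by
          obtain ⟨j, hjA, hjT⟩ := Finset.not_subset.mp hp
          obtain ⟨k, hk, hkT⟩ := Finset.exists_mem_notMem_of_card_lt_card (s := T)
            (t := (X.erase i).erase j)
            (by rw [Finset.card_erase_of_mem (hA' hjA)]; omega)
          refine ⟨k, Finset.mem_of_mem_erase hk, hkT, fun h => ?_⟩
          have := h (Finset.mem_insert_of_mem hjA)
          simp only [Finset.mem_insert, hjT, or_false] at this
          rcases this with rfl | rfl
          · exact hiA hjA
          · simp at hk)
        (ih hA' (by omega) (linkOp_mem_harmonic hv i) fun F hF => by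
          rw [linkOp_apply]
          split_ifs with hiF
          · rfl
          · exact h0 _ (Finset.insert_subset_insert _ hF))
      have hvw := mem_harmonic_erase (i := i)
        (sub_mem hv (span_spechtFunSet_le_harmonic _ _ _ hw)) (by rw [map_sub, hwu, sub_self])
      rw [← sub_add_cancel v w]
      refine add_mem (Submodule.span_mono ?_ (harmonic_le_span (by omega) hvw)) hw
      rintro w ⟨T, hT, _, hw⟩
      refine ⟨T, hT.trans (Finset.erase_subset _ _), fun h => ?_, hw⟩
      simpa using hT (h (Finset.mem_insert_self _ _))

lemma exists_harmonic_extension {A : Finset σ} :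
    ∀ {X : Finset σ} {e : ℕ} {u : Finset σ → K}, A ⊆ X → 2 * e ≤ X.card → A.card ≤ e →
      u ∈ harmonicFun K (X \ A) (e - A.card) →
      ∃ v ∈ harmonicFun K X e, ∀ F, Disjoint F A → v (F ∪ A) = u F := by
  induction A using Finset.induction_on with
  | empty =>
    intro X e u _ _ _ hu
    exact ⟨u, by simpa using hu, fun F _ => by simp⟩
  | insert i A hiA ih =>
    intro X e u hA hX hAe hu
    rw [Finset.card_insert_of_notMem hiA] at hAe hu
    rw [Finset.insert_subset_iff] at hA
    have hc : (X.erase i).card = X.card - 1 := Finset.card_erase_of_mem hA.1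
    obtain ⟨e, rfl⟩ : ∃ e', e = e' + 1 := ⟨e - 1, by omega⟩
    have hA' : A ⊆ X.erase i := Finset.subset_erase.mpr ⟨hA.2, hiA⟩
    obtain ⟨v₁, hv₁, hv₁u⟩ := ih (X := X.erase i) (e := e) (u := u) hA' (by omega) (by omega)
      (by
        rw [show X.erase i \ A = X \ insert i A by ext j; simp; tauto]
        simpa using hu)
    obtain ⟨w, hw, hwv⟩ := exists_linkOp_eq (p := fun _ => True) (q := fun _ => True) hA.1
        (fun T hT hTc _ => by
          obtain ⟨k, hk, hkT⟩ := Finset.exists_mem_notMem_of_card_lt_card (s := T)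
            (t := X.erase i) (by omega)
          exact ⟨k, hk, hkT, trivial⟩)
        (harmonic_le_span (by omega) hv₁)
    refine ⟨w, span_spechtFunSet_le_harmonic _ _ _ hw, fun F hF => ?_⟩
    rw [Finset.disjoint_insert_right] at hF
    rw [← hv₁u F hF.2, ← hwv, linkOp_apply, if_neg (by simp [hF.1, hiA]), Finset.union_insert]

end CharZero

end Harmonic

section
variable {K σ : Type*} [Field K] [DecidableEq σ] [Fintype σ] [CharZero K]

lemma exists_sum_superset_eq_single {X : Finset σ} {e : ℕ} (hX : 2 * e ≤ X.card + 1)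
    {H : Finset σ} (hH : H ⊆ X ∧ H.card + 1 = e) :
    ∃ v : Finset σ → K, ∀ G, G ⊆ X ∧ G.card + 1 = e →
      ∑ F ∈ X.powersetCard e with G ⊆ F, v F = if G = H then 1 else 0 := by
  let C' := {G : Finset σ // G ⊆ X ∧ G.card + 1 = e}
  let D : (Finset σ → K) →ₗ[K] (C' → K) :=
    { toFun := fun v G => ∑ F ∈ X.powersetCard e with G.1 ⊆ F, v F
      map_add' := fun v w => by ext G; simp [Finset.sum_add_distrib]
      map_smul' := fun c v => by ext G; simp [Finset.mul_sum] }
  suffices hD : LinearMap.range D = ⊤ by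
    obtain ⟨v, hv⟩ := LinearMap.range_eq_top.mp hD (Pi.single ⟨H, hH⟩ 1)
    refine ⟨v, fun G hG => (congrFun hv ⟨G, hG⟩).trans ?_⟩
    rw [Pi.single_apply]
    exact if_congr Subtype.ext_iff rfl rfl
  by_contra hne
  obtain ⟨ψ, hψ0, hψ⟩ := Submodule.exists_le_ker_of_lt_top _ (lt_top_iff_ne_top.mpr hne)
  refine hψ0 (LinearMap.pi_ext' fun G => LinearMap.ext_ring ?_)
  have hle := Finset.card_le_card hH.1
  let c : Finset σ → K := fun G => if h : G ⊆ X ∧ G.card + 1 = e then ψ (Pi.single ⟨G, h⟩ 1) else 0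
  have hψc : ∀ x : C' → K, ψ x = ∑ G, x G * c G.1 := fun x => by
    rw [LinearMap.pi_apply_eq_sum_univ ψ x]
    refine Finset.sum_congr rfl fun G _ => ?_
    have : c G.1 = ψ (Pi.single G 1) := dif_pos G.2
    rw [this, smul_eq_mul]
    congr 2
    ext G'
    simp [Pi.single_apply, eq_comm]
  have hw : (fun L => if L ⊆ X then c (X \ L) else 0) ∈ harmonicFun K X (X.card + 1 - e) := by
    refine ⟨fun L hL => ?_, ?_⟩
    · dsimp only at hL
      split_ifs at hL with h
      · refine ⟨h, ?_⟩
        have h1 : (X \ L).card + 1 = e := by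
          by_contra h2
          exact hL (dif_neg fun h3 => h2 h3.2)
        have := Finset.card_sdiff_add_card_eq_card h
        omega
      · exact absurd rfl hL
    · ext L
      rw [downOp_apply, Pi.zero_apply]
      by_cases hL : L ⊆ X ∧ L.card + e = X.card
      · have h0 : ψ (D (Pi.single (X \ L) 1)) = 0 := hψ ⟨_, rfl⟩
        have hF : (X \ L).card = e := by rw [Finset.card_sdiff_of_subset hL.1]; omega
        rw [hψc] at h0
        have hD : ∀ G : C', D (Pi.single (X \ L) 1) G = if G.1 ⊆ X \ L then 1 else 0 := fun G => by
          change ∑ F ∈ X.powersetCard e with G.1 ⊆ F, (Pi.single (X \ L) 1 : Finset σ → K) F = _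
          simp only [Pi.single_apply]
          rw [Finset.sum_ite_eq']
          simp [hF, Finset.sdiff_subset]
        simp only [hD, ite_mul, one_mul, zero_mul] at h0
        rw [← Finset.sum_filter] at h0
        refine Eq.trans ?_ h0
        rw [← Finset.sum_filter_add_sum_filter_not _ (fun i => i ∈ X),
          Finset.sum_eq_zero (s := Lᶜ.filter fun i => i ∉ X)
            (fun i hi => if_neg fun h => (Finset.mem_filter.mp hi).2
              (h (Finset.mem_insert_self _ _))), add_zero]
        refine Finset.sum_bij
          (fun i hi => (⟨X \ insert i L, Finset.sdiff_subset, ?_⟩ : C')) ?_ ?_ ?_ ?_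
        · simp only [Finset.mem_filter, Finset.mem_compl] at hi
          rw [Finset.card_sdiff_of_subset (Finset.insert_subset hi.2 hL.1),
            Finset.card_insert_of_notMem hi.1]
          omega
        · intro i hi
          simp only [Finset.mem_filter, Finset.mem_univ, true_and]
          exact Finset.sdiff_subset_sdiff le_rfl (Finset.subset_insert _ _)
        · intro i hi j hj hij
          simp only [Finset.mem_filter, Finset.mem_compl] at hi hj
          have h1 := congrArg Subtype.val hij
          dsimp only at h1
          by_contra hne
          have h2 : j ∈ X \ insert i L := by simp [hj, Ne.symm hne]
          rw [h1] at h2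
          simp at h2
        · intro G hG
          simp only [Finset.mem_filter, Finset.mem_univ, true_and] at hG
          obtain ⟨i, hi, hiG⟩ := Finset.exists_mem_notMem_of_card_lt_card (s := G.1) (t := X \ L)
            (by have := G.2.2; omega)
          refine ⟨i, by simpa [and_comm] using hi, Subtype.ext (Eq.symm ?_)⟩
          simp only [Finset.mem_sdiff] at hi
          refine Finset.eq_of_subset_of_card_le (fun k hk => ?_) ?_
          · have := hG hk
            simp only [Finset.mem_sdiff, Finset.mem_insert, not_or] at this ⊢
            exact ⟨this.1, fun h => hiG (h ▸ hk), this.2⟩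
          · rw [Finset.card_sdiff_of_subset (Finset.insert_subset hi.1 hL.1),
              Finset.card_insert_of_notMem hi.2]
            have := G.2.2
            omega
        · intro i hi
          simp only [Finset.mem_filter, Finset.mem_compl] at hi
          rw [if_pos (Finset.insert_subset hi.2 hL.1)]
      · refine Finset.sum_eq_zero fun i hi => ?_
        rw [Finset.mem_compl] at hi
        split_ifs with h
        · refine dif_neg fun h1 => hL ⟨(Finset.subset_insert _ _).trans h, ?_⟩
          have h2 := Finset.card_sdiff_add_card_eq_card h
          rw [Finset.card_insert_of_notMem hi] at h2
          omega
        · rfl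
  rw [harmonic_eq_bot (by omega), Submodule.mem_bot] at hw
  have h1 := congrFun hw (X \ G.1)
  rw [if_pos Finset.sdiff_subset, Finset.sdiff_sdiff_eq_self G.2.1] at h1
  change ψ (Pi.single G 1) = 0
  exact (dif_pos G.2).symm.trans h1
end

open IsLocalRing in
lemma exists_mem_maximalIdeal_notMem_sq_notMem_minimalPrimes {R : Type*} [CommRing R]
    [IsLocalRing R] [IsNoetherianRing R] (h : ringKrullDim R ≠ 0) :
    ∃ x ∈ maximalIdeal R, x ∉ maximalIdeal R ^ 2 ∧ ∀ p ∈ minimalPrimes R, x ∉ p := by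
  by_contra! hx
  have hfin : (insert (maximalIdeal R ^ 2) (minimalPrimes R)).Finite :=
    (minimalPrimes.finite_of_isNoetherianRing R).insert _
  have hsub : (maximalIdeal R : Set R) ⊆
      ⋃ I ∈ insert (maximalIdeal R ^ 2) (minimalPrimes R), (I : Set R) := by
    intro x hxm
    by_cases h2 : x ∈ maximalIdeal R ^ 2
    · exact Set.mem_biUnion (Set.mem_insert _ _) h2
    · obtain ⟨p, hp, hxp⟩ := hx x hxm h2
      exact Set.mem_biUnion (Set.mem_insert_of_mem _ hp) hxp
  obtain ⟨I, hI, hle⟩ := (Ideal.subset_union_prime_finite hfin (f := id) (maximalIdeal R ^ 2)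
    (maximalIdeal R ^ 2) (by
      rintro I (rfl | hI) h1 _
      · exact absurd rfl h1
      · exact hI.1.1)).mp hsub
  refine h ?_
  rw [← maximalIdeal_height_eq_ringKrullDim]
  rcases hI with rfl | hI
  · have : maximalIdeal R = ⊥ := by
      refine Submodule.eq_bot_of_le_smul_of_le_jacobson_bot (maximalIdeal R) _
        (IsNoetherian.noetherian _) ?_ (maximalIdeal_le_jacobson _)
      rw [smul_eq_mul, ← sq]
      exact hle
    have hp : (⊥ : Ideal R).IsPrime := this ▸ (maximalIdeal.isMaximal R).isPrime
    rw [this]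
    simp
  · have : I = maximalIdeal R := le_antisymm (le_maximalIdeal hI.1.1.ne_top) hle
    have h0 : (maximalIdeal R).height = 0 := by
      rw [Ideal.height_eq_zero_iff, ← this]
      exact hI
    rw [h0]; rfl

open IsLocalRing in
lemma maximalIdeal_le_span_singleton_sup {R : Type*} [CommRing R] [IsLocalRing R] [DecidableEq R]
    {S : Finset R} (hS : Ideal.span (S : Set R) = maximalIdeal R) {x : R}
    (hx : x ∈ maximalIdeal R) (hx2 : x ∉ maximalIdeal R ^ 2) :
    ∃ s ∈ S, maximalIdeal R ≤ Ideal.span {x} ⊔ Ideal.span ((S.erase s : Finset R) : Set R) := by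
  rw [← hS, Ideal.span, Submodule.mem_span_finset] at hx
  obtain ⟨f, -, hf⟩ := hx
  have hmem : ∀ s ∈ S, s ∈ maximalIdeal R := fun s hs => hS ▸ Ideal.subset_span hs
  obtain ⟨s, hs, hfs⟩ : ∃ s ∈ S, f s ∉ maximalIdeal R := by
    by_contra! h
    refine hx2 (hf ▸ Ideal.sum_mem _ fun s hs => ?_)
    rw [sq, smul_eq_mul]
    exact Ideal.mul_mem_mul (h s hs) (hmem s hs)
  refine ⟨s, hs, ?_⟩
  have hu : IsUnit (f s) := by simpa using hfs
  rw [← hS, Ideal.span_le]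
  intro t ht
  by_cases hts : t = s
  · subst hts
    rw [← Finset.add_sum_erase S _ ht] at hf
    have : f t * t ∈ Ideal.span {x} ⊔ Ideal.span ((S.erase t : Finset R) : Set R) := by
      rw [← smul_eq_mul, eq_sub_of_add_eq hf]
      refine sub_mem (Ideal.mem_sup_left (Ideal.mem_span_singleton_self x))
        (Ideal.mem_sup_right (Ideal.sum_mem _ fun s hs => ?_))
      exact Ideal.mul_mem_left _ _ (Ideal.subset_span hs)
    exact (Ideal.unit_mul_mem_iff_mem _ hu).mp this
  · exact Ideal.mem_sup_right (Ideal.subset_span (by simpa [hts] using ht))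

open IsLocalRing in
/-- A Noetherian local ring of dimension `n` whose maximal ideal has `n` generators is a domain
and its maximal ideal contains a weakly regular sequence of length `n`. -/
theorem isDomain_and_exists_isWeaklyRegular_of_span_eq_maximalIdeal (n : ℕ) :
    ∀ (R : Type*) [CommRing R] [IsLocalRing R] [IsNoetherianRing R] (S : Finset R),
      S.card ≤ n → Ideal.span (S : Set R) = maximalIdeal R → ringKrullDim R = n →
      IsDomain R ∧ ∃ rs : List R, rs.length = n ∧ (∀ r ∈ rs, r ∈ maximalIdeal R) ∧
        RingTheory.Sequence.IsWeaklyRegular R rs := by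
  classical
  induction n with
  | zero =>
    intro R _ _ _ S hS hspan _
    rw [Finset.card_eq_zero.mp (Nat.le_zero.mp hS)] at hspan
    have hF : IsField R := by
      rw [IsLocalRing.isField_iff_maximalIdeal_eq, ← hspan]; simp
    exact ⟨hF.isDomain, [], rfl, by simp, by simp⟩
  | succ n ih =>
    intro R _ _ _ S hS hspan hdim
    obtain ⟨x, hx, hx2, hxmin⟩ := exists_mem_maximalIdeal_notMem_sq_notMem_minimalPrimes (R := R)
      (by rw [hdim]; exact_mod_cast Nat.succ_ne_zero n)
    obtain ⟨s, hs, hle⟩ := maximalIdeal_le_span_singleton_sup hspan hx hx2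
    have hne : Ideal.span {x} ≠ ⊤ := fun h =>
      (maximalIdeal.isMaximal R).ne_top (top_le_iff.mp (h ▸ (Ideal.span_singleton_le_iff_mem _).mpr hx))
    have : Nontrivial (R ⧸ Ideal.span {x}) := Ideal.Quotient.nontrivial_iff.mpr hne
    have : IsLocalRing (R ⧸ Ideal.span {x}) :=
      .of_surjective' (Ideal.Quotient.mk _) Ideal.Quotient.mk_surjective
    have hmap : (maximalIdeal R).map (Ideal.Quotient.mk (Ideal.span {x})) =
        maximalIdeal (R ⧸ Ideal.span {x}) :=
      map_maximalIdeal_of_surjective _ Ideal.Quotient.mk_surjective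
    have hS' : ((S.erase s).image (Ideal.Quotient.mk (Ideal.span {x}))).card ≤ n :=
      Finset.card_image_le.trans (by rw [Finset.card_erase_of_mem hs]; omega)
    have hspan' : Ideal.span (((S.erase s).image (Ideal.Quotient.mk (Ideal.span {x})) :
        Finset (R ⧸ Ideal.span {x})) : Set (R ⧸ Ideal.span {x})) =
        maximalIdeal (R ⧸ Ideal.span {x}) := by
      rw [Finset.coe_image, ← Ideal.map_span, ← hmap]
      refine le_antisymm (Ideal.map_mono (hspan ▸ Ideal.span_mono (by simp))) ?_
      refine (Ideal.map_mono hle).trans ?_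
      rw [Ideal.map_sup, Ideal.map_quotient_self, bot_sup_eq]
    have hdim' : ringKrullDim (R ⧸ Ideal.span {x}) = n := by
      refine le_antisymm ?_ ?_
      · refine (ringKrullDim_le_spanFinrank_maximalIdeal _).trans ?_
        rw [← hspan']
        refine le_trans ?_ (Nat.cast_le.mpr hS')
        rw [← Set.ncard_coe_finset]
        exact Nat.cast_le.mpr
          (Submodule.spanFinrank_span_le_ncard_of_finite (Finset.finite_toSet _))
      · have h1 := ringKrullDim_le_ringKrullDim_quotient_add_card (R := R) {x} (by
          simpa [IsLocalRing.ringJacobson_eq_maximalIdeal] using hx)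
        rw [hdim, Finset.coe_singleton, Finset.card_singleton] at h1
        push_cast at h1
        exact ENat.WithBot.add_le_add_natCast_right_iff.mp h1
    obtain ⟨hdom, rs', hlen, hmem, hreg⟩ := ih _ _ hS' hspan' hdim'
    have hprime : (Ideal.span {x}).IsPrime := (Ideal.Quotient.isDomain_iff_prime _).mp hdom
    obtain ⟨p, hp, hpx⟩ := Ideal.exists_minimalPrimes_le (bot_le : ⊥ ≤ Ideal.span {x})
    have hxp := hxmin p hp
    have hpbot : p = ⊥ := by
      refine Submodule.eq_bot_of_le_smul_of_le_jacobson_bot (maximalIdeal R) _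
        (IsNoetherian.noetherian _) (fun y hy => ?_) (maximalIdeal_le_jacobson _)
      obtain ⟨a, rfl⟩ := Ideal.mem_span_singleton.mp (hpx hy)
      exact Ideal.mul_mem_mul hx ((hp.1.1.mem_or_mem hy).resolve_left hxp)
    have hD : IsDomain R := @IsDomain.of_bot_isPrime R _ (hpbot ▸ hp.1.1)
    refine ⟨hD, ?_⟩
    obtain ⟨rs, rfl⟩ : ∃ rs : List R, rs.map (Ideal.Quotient.mk (Ideal.span {x})) = rs' :=
      List.map_surjective_iff.mpr Ideal.Quotient.mk_surjective rs'
    refine ⟨x :: rs, by simpa using hlen, ?_, ?_⟩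
    · rintro r (_ | ⟨_, hr⟩)
      · exact hx
      · have := hmem _ (List.mem_map_of_mem hr)
        by_contra h
        rw [mem_maximalIdeal, mem_nonunits_iff, not_not] at h
        exact (mem_maximalIdeal _).mp this (h.map _)
    · rw [RingTheory.Sequence.isWeaklyRegular_cons_iff]
      refine ⟨?_, ?_⟩
      · have : x ≠ 0 := fun h => hxp (h ▸ zero_mem p)
        exact IsSMulRegular.of_ne_zero this
      · rw [← Ideal.Quotient.algebraMap_eq,
          RingTheory.Sequence.isWeaklyRegular_map_algebraMap_iff] at hreg
        refine (LinearEquiv.isWeaklyRegular_congr (Submodule.quotEquivOfEq _ _ ?_) rs).mp hreg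
        rw [← Submodule.ideal_span_singleton_smul, smul_eq_mul, Ideal.mul_top]

open IsLocalRing in
lemma ringDepth_le_ringKrullDim (A : Type*) [CommRing A] [IsLocalRing A] [IsNoetherianRing A] :
    (ringDepth A : WithBot ℕ∞) ≤ ringKrullDim A := by
  obtain ⟨n, hn⟩ := WithBot.ne_bot_iff_exists.mp (ringKrullDim_ne_bot (R := A))
  rw [← hn, WithBot.coe_le_coe]
  refine iSup_le fun ⟨rs, hmem, hreg⟩ => ?_
  have h := ringKrullDim_add_length_eq_ringKrullDim_of_isRegular rs hreg
  have : Nontrivial (A ⧸ Ideal.ofList rs) := by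
    refine Ideal.Quotient.nontrivial_iff.mpr fun h => hreg.top_ne_smul ?_
    rw [h]; simp
  rw [← WithBot.coe_le_coe, hn, ← h]
  exact le_add_of_nonneg_left ringKrullDim_nonneg_of_nontrivial

lemma Ideal.height_le_height_under {B A : Type*} [CommRing B] [CommRing A] [Algebra B A]
    [Algebra.IsIntegral B A] (P : Ideal A) [P.IsPrime] : P.height ≤ (P.under B).height := by
  have hmono : StrictMono (PrimeSpectrum.comap (algebraMap B A)) := fun I J h =>
    Ideal.IsIntegral.comap_lt_comap (R := B) h
  rw [show P = (⟨P, ‹_›⟩ : PrimeSpectrum A).asIdeal from rfl,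
    show Ideal.under B (⟨P, ‹_›⟩ : PrimeSpectrum A).asIdeal =
      (PrimeSpectrum.comap (algebraMap B A) ⟨P, ‹_›⟩).asIdeal from rfl,
    PrimeSpectrum.height_eq_orderHeight, PrimeSpectrum.height_eq_orderHeight]
  exact Order.height_le_height_apply_of_strictMono _ hmono _

open IsLocalRing in
/-- A finite flat algebra over a regular ring is Cohen–Macaulay. -/
theorem IsCohenMacaulayRing.of_finite_of_flat (B A : Type*) [CommRing B] [IsRegularRing B]
    [CommRing A] [Algebra B A] [Module.Finite B A] [Module.Flat B A] :
    IsCohenMacaulayRing A := by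
  intro P _
  have : IsNoetherianRing A := IsNoetherianRing.of_finite B A
  refine le_antisymm (ringDepth_le_ringKrullDim _) ?_
  let Q := P.under B
  let := Localization.AtPrime.algebraOfLiesOver Q P
  have : IsRegularLocalRing (Localization.AtPrime Q) :=
    IsRegularRing.isRegularLocalRing_localization Q
  set R := Localization.AtPrime Q
  set L := Localization.AtPrime P
  have hfin := (IsNoetherian.noetherian (maximalIdeal R)).finite_generators
  obtain ⟨-, rs, hlen, hmem, hreg⟩ :=
    isDomain_and_exists_isWeaklyRegular_of_span_eq_maximalIdeal (maximalIdeal R).spanFinrank R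
      hfin.toFinset (by
        rw [← Set.ncard_eq_toFinset_card _ hfin,
          Submodule.FG.generators_ncard (IsNoetherian.noetherian _)])
      (by rw [Set.Finite.coe_toFinset]; exact (maximalIdeal R).span_generators)
      (IsRegularLocalRing.spanFinrank_maximalIdeal (R := R)).symm
  have hloc : IsLocalHom (algebraMap R L) := by
    rw [RingHom.algebraMap_toAlgebra]
    exact Localization.isLocalHom_localRingHom Q P (algebraMap B A) Ideal.LiesOver.over
  have hflat : Module.Flat R L := inferInstance
  have hmem' : ∀ r ∈ rs.map (algebraMap R L), r ∈ maximalIdeal L := by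
    intro r hr
    obtain ⟨s, hs, rfl⟩ := List.mem_map.mp hr
    exact ((local_hom_TFAE (algebraMap R L)).out 0 1 rfl rfl).mp hloc ⟨s, hmem s hs, rfl⟩
  have hreg' : RingTheory.Sequence.IsRegular L (rs.map (algebraMap R L)) :=
    (isRegular_iff_isWeaklyRegular_of_subset_maximalIdeal hmem').mpr hreg.of_flat
  have hdepth : (rs.length : ℕ∞) ≤ ringDepth L := by
    have := le_iSup (fun rs : {rs : List L // (∀ r ∈ rs, r ∈ (⊥ : Ideal L).jacobson) ∧
      RingTheory.Sequence.IsRegular L rs} => (rs.1.length : ℕ∞))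
      ⟨rs.map (algebraMap R L), by rwa [jacobson_eq_maximalIdeal _ bot_ne_top], hreg'⟩
    rwa [List.length_map] at this
  calc ringKrullDim L = (P.height : WithBot ℕ∞) :=
        IsLocalization.AtPrime.ringKrullDim_eq_height P L
    _ ≤ Q.height := WithBot.coe_le_coe.mpr (Ideal.height_le_height_under P)
    _ = ringKrullDim R := (IsLocalization.AtPrime.ringKrullDim_eq_height Q R).symm
    _ = (rs.length : ℕ∞) := by
        rw [hlen, ← IsRegularLocalRing.spanFinrank_maximalIdeal (R := R)]; rfl
    _ ≤ ringDepth L := WithBot.coe_le_coe.mpr hdepth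

lemma LinearMap.finite_and_projective_of_surjective_of_ker {B M N : Type*} [CommRing B]
    [AddCommGroup M] [Module B M] [AddCommGroup N] [Module B N] (f : M →ₗ[B] N)
    (hf : Function.Surjective f) [Module.Finite B N] [Module.Projective B N]
    [Module.Finite B (LinearMap.ker f)] [Module.Projective B (LinearMap.ker f)] :
    Module.Finite B M ∧ Module.Projective B M := by
  obtain ⟨s, hs⟩ := Module.projective_lifting_property f LinearMap.id hf
  have hs' : ∀ y, f (s y) = y := fun y => LinearMap.congr_fun hs y
  let i : M →ₗ[B] LinearMap.ker f × N :=
    ((LinearMap.id - s ∘ₗ f).codRestrict (LinearMap.ker f) (by simp [hs'])).prod f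
  let p : LinearMap.ker f × N →ₗ[B] M := (LinearMap.ker f).subtype.coprod s
  have hpi : p ∘ₗ i = LinearMap.id := by ext x; simp [i, p]
  exact ⟨Module.Finite.of_surjective p fun x => ⟨i x, LinearMap.congr_fun hpi x⟩,
    Module.Projective.of_split i p hpi⟩

/-- The vectors whose image under `D` is coordinatewise divisible by `l`. -/
def dvdSubmodule {B C C' : Type*} [CommRing B] (D : (C → B) →ₗ[B] (C' → B)) (l : C' → B) :
    Submodule B (C → B) where
  carrier := {u | ∀ G, l G ∣ D u G}
  zero_mem' G := by simp
  add_mem' hu hv G := by rw [map_add]; exact dvd_add (hu G) (hv G)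
  smul_mem' b u hu G := by rw [map_smul]; exact (hu G).mul_left b

lemma dvdSubmodule_finite_and_projective {B C C' : Type*} [CommRing B] [IsDomain B] [Finite C]
    [Finite C'] (D : (C → B) →ₗ[B] (C' → B)) (s : (C' → B) →ₗ[B] (C → B))
    (hDs : ∀ c, D (s c) = c) (l : C' → B) (hl : ∀ G, l G ≠ 0) :
    Module.Finite B (dvdSubmodule D l) ∧ Module.Projective B (dvdSubmodule D l) := by
  choose q hq using fun u : dvdSubmodule D l => u.2
  let q' : dvdSubmodule D l →ₗ[B] (C' → B) :=
    { toFun := q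
      map_add' u v := by
        ext G; apply mul_left_cancel₀ (hl G)
        rw [← hq, Pi.add_apply, mul_add, ← hq, ← hq, Submodule.coe_add, map_add, Pi.add_apply]
      map_smul' b u := by
        ext G; apply mul_left_cancel₀ (hl G)
        rw [← hq, RingHom.id_apply, Pi.smul_apply, smul_eq_mul, mul_left_comm, ← hq,
          Submodule.coe_smul, map_smul, Pi.smul_apply, smul_eq_mul] }
  let m : (C' → B) →ₗ[B] (C' → B) := LinearMap.mulLeft B l
  have hmq : ∀ u : dvdSubmodule D l, m (q' u) = D u := fun u => by ext G; exact (hq u G).symm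
  let i : dvdSubmodule D l →ₗ[B] (C → B) × (C' → B) :=
    ((LinearMap.id - s ∘ₗ D) ∘ₗ (dvdSubmodule D l).subtype).prod q'
  let p : (C → B) × (C' → B) →ₗ[B] dvdSubmodule D l :=
    ((LinearMap.id - s ∘ₗ D).coprod (s ∘ₗ m)).codRestrict _ fun x G => by
      simp [hDs, m]
  have hpi : p ∘ₗ i = LinearMap.id := by
    ext1 u
    apply Subtype.ext
    change ((LinearMap.id - s ∘ₗ D).coprod (s ∘ₗ m)) (i u) = (u : C → B)
    simp [i, hDs, hmq]
  exact ⟨Module.Finite.of_surjective p fun x => ⟨i x, LinearMap.congr_fun hpi x⟩,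
    Module.Projective.of_split i p hpi⟩

section EvalFun
variable {K σ : Type*} [Field K] [DecidableEq σ] [Fintype σ]

lemma downOp_eq_sum_superset {X : Finset σ} {e : ℕ} {v : Finset σ → K}
    (hv : ∀ F, v F ≠ 0 → F ⊆ X ∧ F.card = e) {G : Finset σ} (hG : G.card + 1 = e) :
    downOp K σ v G = ∑ F ∈ X.powersetCard e with G ⊆ F, v F := by
  rw [downOp_apply, ← Finset.sum_image (s := Gᶜ) (g := fun i => insert i G) (f := v)]
  · have hsub : {F ∈ X.powersetCard e | G ⊆ F} ⊆ Gᶜ.image (fun i => insert i G) := by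
      intro F hF
      simp only [Finset.mem_filter, Finset.mem_powersetCard] at hF
      obtain ⟨⟨-, hFc⟩, hGF⟩ := hF
      obtain ⟨i, hi⟩ : ∃ i, F \ G = {i} := by
        rw [← Finset.card_eq_one, Finset.card_sdiff_of_subset hGF]; omega
      have hi' : i ∈ F \ G := hi ▸ Finset.mem_singleton_self i
      refine Finset.mem_image.mpr ⟨i, by simpa using (Finset.mem_sdiff.mp hi').2, ?_⟩
      rw [Finset.insert_eq, ← hi, Finset.sdiff_union_of_subset hGF]
    refine (Finset.sum_subset hsub fun F hF hF' => ?_).symm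
    by_contra h0
    obtain ⟨i, -, rfl⟩ := Finset.mem_image.mp hF
    exact hF' (by simpa [Finset.mem_powersetCard] using hv _ h0)
  · intro i hi j hj hij
    have hi' : i ∉ G := by simpa using hi
    have : i ∈ insert j G := by
      rw [← show insert i G = insert j G from hij]
      exact Finset.mem_insert_self i G
    exact (Finset.mem_insert.mp this).resolve_right hi'

lemma mem_harmonicFun_iff {X : Finset σ} {e : ℕ} {v : Finset σ → K} :
    v ∈ harmonicFun K X e ↔ (∀ F, v F ≠ 0 → F ⊆ X ∧ F.card = e) ∧
      ∀ G ⊆ X, G.card + 1 = e → ∑ F ∈ X.powersetCard e with G ⊆ F, v F = 0 := by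
  refine and_congr_right fun hv => ⟨fun h G _ hG => ?_, fun h => ?_⟩
  · rw [← downOp_eq_sum_superset hv hG, h]; rfl
  · ext G
    by_cases hG : G.card + 1 = e
    · rw [downOp_eq_sum_superset hv hG]
      by_cases hGX : G ⊆ X
      · exact h G hGX hG
      · refine Finset.sum_eq_zero fun F hF => ?_
        simp only [Finset.mem_filter, Finset.mem_powersetCard] at hF
        exact absurd (hF.2.trans hF.1.1) hGX
    · rw [downOp_apply]
      refine Finset.sum_eq_zero fun i hi => ?_
      by_contra h0
      have := (hv _ h0).2
      rw [Finset.card_insert_of_notMem (by simpa using hi)] at this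
      exact hG this

/-- The value at `g` of the squarefree polynomial with coefficient function `v`. -/
def evalFun {R : Type*} [CommRing R] [Algebra K R] (g : σ → R) : (Finset σ → K) →ₗ[K] R where
  toFun v := ∑ F, v F • ∏ i ∈ F, g i
  map_add' v w := by simp [add_smul, Finset.sum_add_distrib]
  map_smul' c v := by simp [Finset.smul_sum, mul_smul]

variable {R : Type*} [CommRing R] [Algebra K R]

omit [DecidableEq σ] in
lemma evalFun_apply (g : σ → R) (v : Finset σ → K) :
    evalFun g v = ∑ F, v F • ∏ i ∈ F, g i := rfl

lemma evalFun_one (g : σ → R) : evalFun g (Pi.single ∅ (1 : K)) = 1 := by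
  rw [evalFun_apply, Finset.sum_eq_single ∅]
  · simp
  · intro F _ hF; simp [hF]
  · simp

lemma evalFun_insertOp (g : σ → R) {v : Finset σ → K} {i : σ} (hv : ∀ F, i ∈ F → v F = 0) :
    evalFun g (insertOp K i v) = g i * evalFun g v := by
  rw [evalFun_apply, evalFun_apply, Finset.mul_sum]
  have h1 : ∑ F, v F • ∏ i ∈ F, g i = ∑ F with i ∉ F, v F • ∏ i ∈ F, g i := by
    refine (Finset.sum_subset (Finset.subset_univ _) fun F _ hF => ?_).symm
    rw [hv F (by simpa using hF), zero_smul]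
  rw [← Finset.sum_subset (Finset.subset_univ (Finset.univ.filter fun F => i ∈ F)),
    ← Finset.sum_subset (Finset.subset_univ (Finset.univ.filter fun F => i ∉ F))]
  · refine Finset.sum_nbij' (fun F => F.erase i) (fun F => insert i F) ?_ ?_ ?_ ?_ ?_
    · simp
    · simp
    · intro F hF; exact Finset.insert_erase (by simpa using hF)
    · intro F hF; exact Finset.erase_insert (by simpa using hF)
    · intro F hF
      have hF' : i ∈ F := by simpa using hF
      rw [insertOp_apply, if_pos hF', ← Finset.mul_prod_erase F g hF', mul_smul_comm]
  · intro F _ hF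
    rw [hv F (by simpa using hF), zero_smul, mul_zero]
  · intro F _ hF
    rw [insertOp_apply, if_neg (by simpa using hF), zero_smul]

lemma IsSpechtFun.apply_eq_zero {T : Finset σ} {d : ℕ} {v : Finset σ → K}
    (h : IsSpechtFun K T d v) {i : σ} (hi : i ∉ T) (F : Finset σ) (hF : i ∈ F) : v F = 0 := by
  by_contra h0
  exact hi ((h.mem_harmonic.1 F h0).1 hF)

lemma IsSpechtFun.evalFun_mul {T : Finset σ} {d : ℕ} {v : Finset σ → K}
    (h : IsSpechtFun K T d v) (g : σ → R) {i j : σ} (hi : i ∉ T) (hj : j ∉ T) :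
    evalFun g (insertOp K i v - insertOp K j v) = (g i - g j) * evalFun g v := by
  rw [map_sub, evalFun_insertOp g (h.apply_eq_zero hi), evalFun_insertOp g (h.apply_eq_zero hj),
    sub_mul]

lemma IsSpechtFun.evalFun_congr {T : Finset σ} {d : ℕ} {v : Finset σ → K}
    (h : IsSpechtFun K T d v) {g g' : σ → R} (hg : ∀ i ∈ T, ∀ j ∈ T, g i - g j = g' i - g' j) :
    evalFun g v = evalFun g' v := by
  induction h with
  | one => rw [evalFun_one, evalFun_one]
  | mul hi hj hij h ih =>
    rw [h.evalFun_mul g hi hj, h.evalFun_mul g' hi hj, hg _ (by simp) _ (by simp),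
      ih fun a ha b hb => hg a (by simp [ha]) b (by simp [hb])]

end EvalFun

section Ideals
variable (K : Type*) {σ : Type*} [Field K] [DecidableEq σ] [Fintype σ]

/-- The ideal generated by the products of `d` differences of variables, the `2 d` variables
being pairwise distinct elements of `E`. -/
noncomputable def spechtIdealOn (E : Finset σ) (d : ℕ) : Ideal (MvPolynomial σ K) :=
  Ideal.span {f | ∃ T ⊆ E, ∃ v, IsSpechtFun K T d v ∧ f = evalFun (X : σ → MvPolynomial σ K) v}

/-- The ideal generated by the differences of the variables in `Q`. -/
noncomputable def diagIdeal (Q : Finset σ) : Ideal (MvPolynomial σ K) :=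
  Ideal.span {f | ∃ i ∈ Q, ∃ j ∈ Q, f = X i - X j}

variable {K}

lemma IsSpechtFun.evalFun_mem {E T : Finset σ} {d : ℕ} {v : Finset σ → K}
    (h : IsSpechtFun K T d v) (hT : T ⊆ E) : evalFun X v ∈ spechtIdealOn K E d :=
  Ideal.subset_span ⟨T, hT, v, h, rfl⟩

omit [DecidableEq σ] [Fintype σ] in
lemma X_sub_X_mem_diagIdeal {Q : Finset σ} {i j : σ} (hi : i ∈ Q) (hj : j ∈ Q) :
    (X i - X j : MvPolynomial σ K) ∈ diagIdeal K Q :=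
  Ideal.subset_span ⟨i, hi, j, hj, rfl⟩

omit [DecidableEq σ] [Fintype σ] in
lemma diagIdeal_mono {Q Q' : Finset σ} (h : Q ⊆ Q') : diagIdeal K Q ≤ diagIdeal K Q' :=
  Ideal.span_mono fun _ ⟨i, hi, j, hj, hf⟩ => ⟨i, h hi, j, h hj, hf⟩

omit [Fintype σ] in
lemma X_sub_X_notMem_diagIdeal {Q : Finset σ} {i j : σ} (hi : i ∉ Q) (hj : j ∈ Q) :
    (X i - X j : MvPolynomial σ K) ∉ diagIdeal K Q := by
  intro h
  let f : MvPolynomial σ K →ₐ[K] K := aeval fun a => if a ∈ Q then (0 : K) else 1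
  have hle : diagIdeal K Q ≤ RingHom.ker f := by
    rw [diagIdeal, Ideal.span_le]
    rintro _ ⟨a, ha, b, hb, rfl⟩
    simp [f, RingHom.mem_ker, ha, hb]
  have := hle h
  simp [f, RingHom.mem_ker, hi, hj] at this

omit [Fintype σ] in
lemma diagIdeal_insert {Q : Finset σ} {i m : σ} (hm : m ∈ Q) :
    diagIdeal K (insert i Q) = diagIdeal K Q ⊔ Ideal.span {X i - X m} := by
  apply le_antisymm
  · have key : ∀ a ∈ insert i Q, (X a - X m : MvPolynomial σ K) ∈
        diagIdeal K Q ⊔ Ideal.span {X i - X m} := by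
      intro a ha
      rcases Finset.mem_insert.mp ha with rfl | ha
      · exact Ideal.mem_sup_right (Ideal.mem_span_singleton_self _)
      · exact Ideal.mem_sup_left (X_sub_X_mem_diagIdeal ha hm)
    rw [diagIdeal, Ideal.span_le]
    rintro _ ⟨a, ha, b, hb, rfl⟩
    rw [← sub_sub_sub_cancel_right (X a) (X b) (X m)]
    exact sub_mem (key a ha) (key b hb)
  · refine sup_le (diagIdeal_mono (Finset.subset_insert _ _)) ?_
    rw [Ideal.span_singleton_le_iff_mem]
    exact X_sub_X_mem_diagIdeal (by simp) (by simp [hm])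

/-- Pigeonhole: a product of differences lies in `diagIdeal K Q` if `Q` contains most of the
variables involved. -/
lemma IsSpechtFun.evalFun_mem_diagIdeal {T Q : Finset σ} {d : ℕ} {v : Finset σ → K}
    (h : IsSpechtFun K T d v) (hTQ : (T \ Q).card < d) :
    evalFun X v ∈ diagIdeal K Q := by
  induction h with
  | one => simp at hTQ
  | @mul T d v i j hi hj hij h ih =>
    rw [h.evalFun_mul _ hi hj]
    by_cases hQ : i ∈ Q ∧ j ∈ Q
    · exact Ideal.mul_mem_right _ _ (X_sub_X_mem_diagIdeal hQ.1 hQ.2)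
    · refine Ideal.mul_mem_left _ _ (ih ?_)
      have hlt : T \ Q ⊂ insert i (insert j T) \ Q := by
        rw [Finset.ssubset_iff_of_subset
          (Finset.sdiff_subset_sdiff (by intro a ha; simp [ha]) le_rfl)]
        rcases not_and_or.mp hQ with hQ | hQ
        · exact ⟨i, by simp [hQ], by simp [hi]⟩
        · exact ⟨j, by simp [hQ], by simp [hj]⟩
      have := Finset.card_lt_card hlt
      omega

lemma spechtIdealOn_le_diagIdeal {E Q : Finset σ} {d : ℕ} (h : (E \ Q).card < d) :
    spechtIdealOn K E d ≤ diagIdeal K Q := by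
  rw [spechtIdealOn, Ideal.span_le]
  rintro _ ⟨T, hT, v, hv, rfl⟩
  exact hv.evalFun_mem_diagIdeal
    ((Finset.card_le_card (Finset.sdiff_subset_sdiff hT le_rfl)).trans_lt h)

lemma spechtIdealOn_zero (E : Finset σ) : spechtIdealOn K E 0 = ⊤ := by
  rw [Ideal.eq_top_iff_one]
  convert IsSpechtFun.one.evalFun_mem (Finset.empty_subset E)
  exact (evalFun_one _).symm

/-- A product of differences is a multiple of one that avoids a given variable. -/
lemma IsSpechtFun.exists_dvd_erase {T : Finset σ} {d : ℕ} {v : Finset σ → K}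
    (h : IsSpechtFun K T (d + 1) v) (m : σ) :
    ∃ T' ⊆ T.erase m, ∃ w, IsSpechtFun K T' d w ∧
      (evalFun X w : MvPolynomial σ K) ∣ evalFun X v := by
  generalize hd : d + 1 = d' at h
  induction h generalizing d with
  | one => omega
  | @mul T e v i j hi hj hij h ih =>
    obtain rfl : d = e := by omega
    by_cases hm : m ∈ T
    · have hmi : m ≠ i := by rintro rfl; exact hi hm
      have hmj : m ≠ j := by rintro rfl; exact hj hm
      obtain ⟨d, rfl⟩ : ∃ d', d = d' + 1 := by
        refine Nat.exists_eq_succ_of_ne_zero ?_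
        rintro rfl
        have := h.card
        simp_all
      obtain ⟨T', hT', w, hw, hdvd⟩ := ih rfl
      have hi' : i ∉ T' := fun h' => hi (Finset.mem_of_mem_erase (hT' h'))
      have hj' : j ∉ T' := fun h' => hj (Finset.mem_of_mem_erase (hT' h'))
      refine ⟨_, ?_, _, hw.mul hi' hj' hij, ?_⟩
      · intro a ha
        simp only [Finset.mem_insert] at ha
        rcases ha with rfl | rfl | ha
        · simp [hmi.symm]
        · simp [hmj.symm]
        · have := hT' ha
          simp only [Finset.mem_erase] at this
          simp [this]
      · rw [hw.evalFun_mul _ hi' hj', h.evalFun_mul _ hi hj]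
        exact mul_dvd_mul_left _ hdvd
    · refine ⟨T, ?_, v, h, ?_⟩
      · intro a ha
        have : a ≠ m := by rintro rfl; exact hm ha
        simp [this, ha]
      · rw [h.evalFun_mul _ hi hj]
        exact Dvd.intro_left _ rfl

lemma spechtIdealOn_insert_le {E : Finset σ} {m : σ} {d : ℕ} :
    spechtIdealOn K (insert m E) (d + 1) ≤ spechtIdealOn K E d := by
  rw [spechtIdealOn, Ideal.span_le]
  rintro _ ⟨T, hT, v, hv, rfl⟩
  obtain ⟨T', hT', w, hw, hdvd⟩ := hv.exists_dvd_erase m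
  refine Ideal.mem_of_dvd _ hdvd (hw.evalFun_mem fun a ha => ?_)
  have h1 := Finset.mem_erase.mp (hT' ha)
  exact (Finset.mem_insert.mp (hT h1.2)).resolve_left h1.1

end Ideals

section Shift
variable (K : Type*) {σ : Type*} [Field K] [DecidableEq σ]

/-- The automorphism subtracting the variable `m` from all variables in `E`. -/
noncomputable def shiftEquiv {E : Finset σ} {m : σ} (hm : m ∉ E) :
    MvPolynomial σ K ≃ₐ[K] MvPolynomial σ K :=
  AlgEquiv.ofAlgHom (aeval fun i => if i ∈ E then X i - X m else X i)
    (aeval fun i => if i ∈ E then X i + X m else X i)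
    (by ext i : 1; by_cases hi : i ∈ E <;> simp [hi, hm])
    (by ext i : 1; by_cases hi : i ∈ E <;> simp [hi, hm])

variable {K} {E : Finset σ} {m : σ} (hm : m ∉ E)

lemma shiftEquiv_X_of_mem {i : σ} (hi : i ∈ E) :
    shiftEquiv K hm (X i) = X i - X m := by
  simp [shiftEquiv, hi]

lemma mem_diagIdeal_iff {F : Finset σ} {p : MvPolynomial σ K} :
    p ∈ diagIdeal K (insert m (E \ F)) ↔
      ∀ a : σ →₀ ℕ, a.support ∩ E ⊆ F → coeff a ((shiftEquiv K hm).symm p) = 0 := by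
  have h1 : diagIdeal K (insert m (E \ F)) =
      (Ideal.span (X '' (E \ F : Finset σ))).map (shiftEquiv K hm) := by
    rw [Ideal.map_span, diagIdeal]
    apply le_antisymm
    · have key : ∀ i ∈ insert m (E \ F), (X i - X m : MvPolynomial σ K) ∈
          Ideal.span (shiftEquiv K hm '' (X '' (E \ F : Finset σ))) := by
        intro i hi
        rcases Finset.mem_insert.mp hi with rfl | hi
        · simp
        · refine Ideal.subset_span ⟨X i, ⟨i, hi, rfl⟩, ?_⟩
          exact shiftEquiv_X_of_mem hm (Finset.mem_sdiff.mp hi).1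
      rw [Ideal.span_le]
      rintro _ ⟨i, hi, j, hj, rfl⟩
      rw [← sub_sub_sub_cancel_right (X i) (X j) (X m)]
      exact sub_mem (key i hi) (key j hj)
    · rw [Ideal.span_le]
      rintro _ ⟨_, ⟨i, hi, rfl⟩, rfl⟩
      rw [shiftEquiv_X_of_mem hm (Finset.mem_sdiff.mp hi).1]
      exact X_sub_X_mem_diagIdeal (Finset.mem_insert_of_mem hi) (Finset.mem_insert_self _ _)
  have h2 : p ∈ diagIdeal K (insert m (E \ F)) ↔
      (shiftEquiv K hm).symm p ∈ Ideal.span (X '' (E \ F : Finset σ)) := by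
    rw [h1]
    constructor
    · intro h
      have hle : ∀ I : Ideal (MvPolynomial σ K),
          I.map (shiftEquiv K hm) ≤ I.comap (shiftEquiv K hm).symm := fun I =>
        Ideal.map_le_iff_le_comap.mpr fun q hq => by
          rwa [Ideal.mem_comap, Ideal.mem_comap, AlgEquiv.symm_apply_apply]
      exact hle _ h
    · intro h
      have := Ideal.mem_map_of_mem (shiftEquiv K hm) h
      rwa [AlgEquiv.apply_symm_apply] at this
  rw [h2, mem_ideal_span_X_image]
  refine forall_congr' fun a => ?_
  rw [mem_support_iff, ← not_imp_not, not_not]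
  refine imp_congr ?_ Iff.rfl
  push Not
  constructor
  · intro h i hi
    by_contra hiF
    simp only [Finset.mem_inter, Finsupp.mem_support_iff] at hi
    exact hi.1 (h i (by simp [hi.2, hiF]))
  · intro h i hi
    by_contra h0
    simp only [Finset.coe_sdiff, Set.mem_sdiff, Finset.mem_coe] at hi
    exact hi.2 (h (by simp [h0, hi.1]))

/-- The coefficient of a polynomial at `a` in the shifted coordinates. -/
noncomputable def shiftCoeff (hm : m ∉ E) (a : σ →₀ ℕ) : MvPolynomial σ K →ₗ[K] K :=
  lcoeff K a ∘ₗ (shiftEquiv K hm).symm.toLinearMap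

lemma mem_diagIdeal_iff_shiftCoeff {F : Finset σ} {p : MvPolynomial σ K} :
    p ∈ diagIdeal K (insert m (E \ F)) ↔
      ∀ a : σ →₀ ℕ, a.support ∩ E ⊆ F → shiftCoeff hm a p = 0 :=
  mem_diagIdeal_iff hm

lemma sum_shiftEquiv_monomial {p : MvPolynomial σ K} {s : Finset (σ →₀ ℕ)}
    (hs : ((shiftEquiv K hm).symm p).support ⊆ s) :
    ∑ a ∈ s, shiftCoeff hm a p • shiftEquiv K hm (monomial a 1) = p := by
  conv_rhs => rw [← (shiftEquiv K hm).apply_symm_apply p,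
    (shiftEquiv K hm).symm p |>.as_sum, map_sum]
  rw [Finset.sum_subset hs fun a _ ha => by rw [notMem_support_iff.mp ha]; simp]
  · refine Finset.sum_congr rfl fun a _ => ?_
    rw [← map_smul, smul_monomial, smul_eq_mul, mul_one]; rfl

variable [Fintype σ]

variable (K) in
/-- Polynomial valued functions on the `e`-subsets of `E` satisfying the relations defining
`harmonicFun`. -/
noncomputable def harmonicPoly (E : Finset σ) (e : ℕ) :
    Submodule (MvPolynomial σ K) (Finset σ → MvPolynomial σ K) where
  carrier := {p | (∀ F, p F ≠ 0 → F ⊆ E ∧ F.card = e) ∧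
    ∀ G ⊆ E, G.card + 1 = e → ∑ F ∈ E.powersetCard e with G ⊆ F, p F = 0}
  zero_mem' := by simp
  add_mem' {v w} hv hw := by
    refine ⟨fun F hF => ?_, fun G hG hGe => ?_⟩
    · by_cases h : v F = 0
      · exact hw.1 F (by simpa [h] using hF)
      · exact hv.1 F h
    · simp [Finset.sum_add_distrib, hv.2 G hG hGe, hw.2 G hG hGe]
  smul_mem' c v hv := by
    refine ⟨fun F hF => hv.1 F ?_, fun G hG hGe => ?_⟩
    · intro h
      simp [h] at hF
    · simp [← Finset.mul_sum, hv.2 G hG hGe]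

lemma harmonicPoly.shiftCoeff_mem {e : ℕ} {p : Finset σ → MvPolynomial σ K}
    (hp : p ∈ harmonicPoly K E e) (a : σ →₀ ℕ) :
    (fun F => shiftCoeff hm a (p F)) ∈ harmonicFun K E e := by
  refine mem_harmonicFun_iff.mpr ⟨fun F hF => hp.1 F ?_, fun G hG hGe => ?_⟩
  · rintro h; simp [h] at hF
  · rw [← map_sum, hp.2 G hG hGe, map_zero]

lemma smul_mem_harmonicPoly {e : ℕ} {v : Finset σ → K} (hv : v ∈ harmonicFun K E e)
    (q : MvPolynomial σ K) : (fun F => v F • q) ∈ harmonicPoly K E e := by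
  rw [mem_harmonicFun_iff] at hv
  refine ⟨fun F hF => hv.1 F ?_, fun G hG hGe => ?_⟩
  · rintro h; simp [h] at hF
  · rw [← Finset.sum_smul, hv.2 G hG hGe, zero_smul]

variable (K) in
/-- The evaluation at the differences `X i - X m` of the squarefree polynomial with polynomial
coefficients. -/
noncomputable def shiftPairing (m : σ) :
    (Finset σ → MvPolynomial σ K) →ₗ[MvPolynomial σ K] MvPolynomial σ K where
  toFun p := ∑ F, p F * ∏ i ∈ F, (X i - X m)
  map_add' v w := by simp [add_mul, Finset.sum_add_distrib]
  map_smul' c v := by simp [Finset.mul_sum, mul_assoc]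

omit [DecidableEq σ] in
lemma shiftPairing_apply (m : σ) (p : Finset σ → MvPolynomial σ K) :
    shiftPairing K m p = ∑ F, p F * ∏ i ∈ F, (X i - X m) := rfl

omit [DecidableEq σ] in
lemma shiftPairing_smul (m : σ) (v : Finset σ → K) (q : MvPolynomial σ K) :
    shiftPairing K m (fun F => v F • q) = q * evalFun (fun i => X i - X m) v := by
  rw [shiftPairing_apply, evalFun_apply, Finset.mul_sum]
  exact Finset.sum_congr rfl fun F _ => by rw [smul_mul_assoc, mul_smul_comm]

lemma IsSpechtFun.evalFun_shift {T : Finset σ} {d : ℕ} {v : Finset σ → K}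
    (h : IsSpechtFun K T d v) (m : σ) :
    evalFun (fun i => (X i - X m : MvPolynomial σ K)) v = evalFun X v :=
  h.evalFun_congr fun i _ j _ => by ring

lemma exists_sum_smul (p : Finset σ → MvPolynomial σ K) :
    ∃ s : Finset (σ →₀ ℕ), p = ∑ a ∈ s,
      fun F => shiftCoeff hm a (p F) • shiftEquiv K hm (monomial a 1) := by
  refine ⟨Finset.univ.biUnion fun F => ((shiftEquiv K hm).symm (p F)).support, ?_⟩
  ext1 F
  rw [Finset.sum_apply]
  exact (sum_shiftEquiv_monomial hm
    (Finset.subset_biUnion_of_mem (fun F => ((shiftEquiv K hm).symm (p F)).support)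
      (Finset.mem_univ F))).symm

lemma shiftPairing_mem (I : Ideal (MvPolynomial σ K)) (p : Finset σ → MvPolynomial σ K)
    (h : ∀ a, shiftEquiv K hm (monomial a 1) *
      evalFun (fun i => X i - X m) (fun F => shiftCoeff hm a (p F)) ∈ I) :
    shiftPairing K m p ∈ I := by
  obtain ⟨s, hs⟩ := exists_sum_smul hm p
  rw [hs, map_sum]
  exact Ideal.sum_mem _ fun a _ => by rw [shiftPairing_smul]; exact h a

variable [CharZero K]

include hm in
lemma mem_spechtIdealOn_iff {e : ℕ} (he : 2 * e ≤ E.card) {x : MvPolynomial σ K} :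
    x ∈ spechtIdealOn K E e ↔ ∃ p ∈ harmonicPoly K E e, shiftPairing K m p = x := by
  constructor
  · intro hx
    have hle : spechtIdealOn K E e ≤ (harmonicPoly K E e).map (shiftPairing K m) := by
      rw [spechtIdealOn, Ideal.span, Submodule.span_le]
      rintro _ ⟨T, hT, v, hv, rfl⟩
      refine ⟨_, smul_mem_harmonicPoly (harmonic_mono hT e hv.mem_harmonic) 1, ?_⟩
      rw [shiftPairing_smul, one_mul, hv.evalFun_shift]
    exact hle hx
  · rintro ⟨p, hp, rfl⟩
    refine shiftPairing_mem hm _ p fun a => Ideal.mul_mem_left _ _ ?_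
    have h := harmonic_le_span he (harmonicPoly.shiftCoeff_mem hm hp a)
    refine Submodule.span_induction (p := fun v _ =>
      evalFun (fun i => (X i - X m : MvPolynomial σ K)) v ∈ spechtIdealOn K E e)
      ?_ ?_ ?_ ?_ h
    · rintro v ⟨T, hT, -, hv⟩
      rw [hv.evalFun_shift]
      exact hv.evalFun_mem hT
    · simp
    · intro v w _ _ hv hw; rw [map_add]; exact add_mem hv hw
    · intro c v _ hv; rw [map_smul]; exact Submodule.smul_of_tower_mem _ c hv

include hm in
lemma shiftPairing_mem_of_forall_mem {e : ℕ} (he : 2 * e + 1 ≤ E.card)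
    {p : Finset σ → MvPolynomial σ K} (hp : p ∈ harmonicPoly K E e)
    (h : ∀ F ⊆ E, F.card = e → p F ∈ diagIdeal K (insert m (E \ F))) :
    shiftPairing K m p ∈ spechtIdealOn K (insert m E) (e + 1) := by
  refine shiftPairing_mem hm _ p fun a => ?_
  have hv := harmonicPoly.shiftCoeff_mem hm hp a
  have hmem := mem_span_of_forall_superset_eq_zero (A := a.support ∩ E) (X := E)
    Finset.inter_subset_right he hv (by
      intro F hF
      by_contra h0
      obtain ⟨hFE, hFe⟩ := hv.1 F h0
      exact h0 ((mem_diagIdeal_iff_shiftCoeff hm).mp (h F hFE hFe) a hF))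
  refine Submodule.span_induction (p := fun v _ => shiftEquiv K hm (monomial a 1) *
    evalFun (fun i => (X i - X m : MvPolynomial σ K)) v ∈ spechtIdealOn K (insert m E) (e + 1))
    ?_ ?_ ?_ ?_ hmem
  · rintro v ⟨T, hT, hAT, hv⟩
    obtain ⟨i, hi, hiT⟩ := Finset.not_subset.mp hAT
    rw [Finset.mem_inter, Finsupp.mem_support_iff] at hi
    have hmT : m ∉ T := fun h => hm (hT h)
    have him : i ≠ m := by rintro rfl; exact hm hi.2
    have hdvd : (X i - X m : MvPolynomial σ K) ∣ shiftEquiv K hm (monomial a 1) := by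
      rw [← shiftEquiv_X_of_mem hm hi.2]
      exact map_dvd _ ((X_dvd_monomial).mpr (Or.inr hi.1))
    have h1 := (hv.mul hiT hmT him).evalFun_mem (E := insert m E) (by
      intro b hb
      simp only [Finset.mem_insert] at hb ⊢
      rcases hb with rfl | rfl | hb
      · exact Or.inr hi.2
      · exact Or.inl rfl
      · exact Or.inr (hT hb))
    rw [hv.evalFun_mul _ hiT hmT] at h1
    rw [hv.evalFun_shift]
    exact Ideal.mem_of_dvd _ (mul_dvd_mul_right hdvd _) h1
  · simp
  · intro v w _ _ hv hw; rw [map_add, mul_add]; exact add_mem hv hw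
  · intro c v _ hv
    rw [map_smul, mul_smul_comm]
    exact Submodule.smul_of_tower_mem _ c hv

end Shift

section Lift
variable {K σ : Type*} [Field K] [DecidableEq σ] [Fintype σ] [CharZero K]

lemma exists_harmonic_eq_of_superset {A E : Finset σ} {e : ℕ} (hA : A ⊆ E)
    (he : 2 * e ≤ E.card) (c : Finset σ → K) (hc : ∀ G ⊆ E, G.card + 1 = e → A ⊆ G →
      ∑ F ∈ E.powersetCard e with G ⊆ F, c F = 0) :
    ∃ v ∈ harmonicFun K E e, ∀ F ⊆ E, F.card = e → A ⊆ F → v F = c F := by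
  by_cases hAe : A.card ≤ e
  · let u : Finset σ → K := fun F => if F ⊆ E \ A ∧ F.card = e - A.card then c (F ∪ A) else 0
    have hu : u ∈ harmonicFun K (E \ A) (e - A.card) := by
      refine mem_harmonicFun_iff.mpr ⟨fun F hF => ?_, fun G hG hGe => ?_⟩
      · by_contra h; exact hF (if_neg h)
      · have hGA : Disjoint G A := Finset.disjoint_of_subset_left hG Finset.sdiff_disjoint
        rw [← hc (G ∪ A) (Finset.union_subset (hG.trans Finset.sdiff_subset) hA)
          (by rw [Finset.card_union_of_disjoint hGA]; omega) Finset.subset_union_right]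
        refine Finset.sum_nbij' (fun F => F ∪ A) (fun F => F \ A) ?_ ?_ ?_ ?_ ?_
        · intro F hF
          simp only [Finset.mem_filter, Finset.mem_powersetCard] at hF ⊢
          have hd : Disjoint F A := Finset.disjoint_of_subset_left hF.1.1 Finset.sdiff_disjoint
          exact ⟨⟨Finset.union_subset (hF.1.1.trans Finset.sdiff_subset) hA,
            by rw [Finset.card_union_of_disjoint hd]; omega⟩,
            Finset.union_subset_union_left hF.2⟩
        · intro F hF
          simp only [Finset.mem_filter, Finset.mem_powersetCard] at hF ⊢
          have hAF : A ⊆ F := Finset.subset_union_right.trans hF.2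
          refine ⟨⟨Finset.sdiff_subset_sdiff hF.1.1 le_rfl, ?_⟩, ?_⟩
          · rw [Finset.card_sdiff_of_subset hAF, hF.1.2]
          · exact Finset.subset_sdiff.mpr ⟨Finset.subset_union_left.trans hF.2, hGA⟩
        · intro F hF
          simp only [Finset.mem_filter, Finset.mem_powersetCard] at hF
          exact Finset.union_sdiff_cancel_right
            (Finset.disjoint_of_subset_left hF.1.1 Finset.sdiff_disjoint)
        · intro F hF
          simp only [Finset.mem_filter, Finset.mem_powersetCard] at hF
          exact Finset.sdiff_union_of_subset (Finset.subset_union_right.trans hF.2)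
        · intro F hF
          simp only [Finset.mem_filter, Finset.mem_powersetCard] at hF
          exact if_pos hF.1
    obtain ⟨v, hv, hvu⟩ := exists_harmonic_extension hA he hAe hu
    refine ⟨v, hv, fun F hF hFe hAF => ?_⟩
    have h := hvu (F \ A) Finset.sdiff_disjoint
    rw [Finset.sdiff_union_of_subset hAF] at h
    rw [h]
    simp only [u]
    rw [if_pos ⟨Finset.sdiff_subset_sdiff hF le_rfl, by
      rw [Finset.card_sdiff_of_subset hAF, hFe]⟩, Finset.sdiff_union_of_subset hAF]
  · exact ⟨0, zero_mem _, fun F _ hFe hAF => absurd (hFe ▸ Finset.card_le_card hAF) hAe⟩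

variable {E : Finset σ} {m : σ} (hm : m ∉ E)

include hm in
lemma exists_harmonicPoly_sub_mem {e : ℕ} (he : 2 * e ≤ E.card)
    (c : Finset σ → MvPolynomial σ K) (hc : ∀ G ⊆ E, G.card + 1 = e →
      ∑ F ∈ E.powersetCard e with G ⊆ F, c F ∈ diagIdeal K (insert m (E \ G))) :
    ∃ p ∈ harmonicPoly K E e, ∀ F ⊆ E, F.card = e →
      p F - c F ∈ diagIdeal K (insert m (E \ F)) := by
  choose v hv hvc using fun a : σ →₀ ℕ => exists_harmonic_eq_of_superset
    (A := a.support ∩ E) Finset.inter_subset_right he (fun F => shiftCoeff hm a (c F)) (by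
      intro G hG hGe hAG
      rw [← map_sum]
      exact (mem_diagIdeal_iff_shiftCoeff hm).mp (hc G hG hGe) a hAG)
  obtain ⟨s, hs⟩ := exists_sum_smul hm c
  refine ⟨∑ a ∈ s, fun F => v a F • shiftEquiv K hm (monomial a 1),
    sum_mem fun a _ => smul_mem_harmonicPoly (hv a) _, fun F hF hFe => ?_⟩
  rw [hs, Finset.sum_apply, Finset.sum_apply, ← Finset.sum_sub_distrib]
  refine sum_mem fun a _ => ?_
  rw [← sub_smul, mem_diagIdeal_iff hm]
  intro b hb
  rw [map_smul, AlgEquiv.symm_apply_apply, coeff_smul, coeff_monomial]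
  split_ifs with hab
  · subst hab
    rw [hvc a F hF hFe hb, sub_self, zero_smul]
  · simp

omit [CharZero K] in
include hm in
lemma mem_diagIdeal_of_shiftPairing_mem {e : ℕ} {p : Finset σ → MvPolynomial σ K}
    (hp : ∀ F, p F ≠ 0 → F ⊆ E ∧ F.card = e)
    (h : shiftPairing K m p ∈ spechtIdealOn K (insert m E) (e + 1)) {F : Finset σ}
    (hF : F ⊆ E) (hFe : F.card = e) [hprime : (diagIdeal K (insert m (E \ F))).IsPrime] :
    p F ∈ diagIdeal K (insert m (E \ F)) := by
  have hmF : m ∉ F := fun h' => hm (hF h')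
  have h1 : insert m E \ insert m (E \ F) = F := by
    ext i
    by_cases him : i = m
    · subst him; simp [hmF]
    · have : i ∈ F → i ∈ E := fun h => hF h
      simp [him]; tauto
  have h2 := spechtIdealOn_le_diagIdeal (K := K) (Q := insert m (E \ F)) (by
    rw [h1, hFe]; exact Nat.lt_succ_self e) h
  have h3 : p F * ∏ i ∈ F, (X i - X m) ∈ diagIdeal K (insert m (E \ F)) := by
    rw [shiftPairing_apply, ← Finset.add_sum_erase _ _ (Finset.mem_univ F)] at h2
    refine (Submodule.add_mem_iff_left _ (sum_mem fun F' hF' => ?_)).mp h2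
    by_cases h0 : p F' = 0
    · rw [h0, zero_mul]; exact zero_mem _
    obtain ⟨hF'E, hF'e⟩ := hp F' h0
    obtain ⟨i, hi, hiF⟩ : ∃ i ∈ F', i ∉ F := by
      by_contra! hsub
      exact (Finset.mem_erase.mp hF').1 (Finset.eq_of_subset_of_card_le hsub (by omega))
    refine Ideal.mul_mem_left _ _ (Ideal.mem_of_dvd _ (Finset.dvd_prod_of_mem _ hi) ?_)
    exact X_sub_X_mem_diagIdeal (by simp [hF'E hi, hiF]) (by simp)
  refine (hprime.mem_or_mem h3).resolve_right fun h4 => ?_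
  obtain ⟨i, hi, h5⟩ := (Ideal.IsPrime.prod_mem_iff).mp h4
  refine X_sub_X_notMem_diagIdeal ?_ (Finset.mem_insert_self m _) h5
  have : i ≠ m := by rintro rfl; exact hmF hi
  simp [hi, this]

end Lift

lemma LinearMap.exists_equiv_range_of_ker_eq {B M N P : Type*} [CommRing B] [AddCommGroup M]
    [Module B M] [AddCommGroup N] [Module B N] [AddCommGroup P] [Module B P] (g : M →ₗ[B] N)
    (h : M →ₗ[B] P) (hgh : LinearMap.ker g = LinearMap.ker h) :
    Nonempty (LinearMap.range g ≃ₗ[B] LinearMap.range h) :=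
  ⟨g.quotKerEquivRange.symm ≪≫ₗ Submodule.quotEquivOfEq _ _ hgh ≪≫ₗ h.quotKerEquivRange⟩

lemma sum_subtype_superset_eq {σ R : Type*} [DecidableEq σ] [Fintype σ] [AddCommMonoid R]
    (E : Finset σ) (e : ℕ) (b : Finset σ → R) (G : Finset σ) :
    ∑ F : {F : Finset σ // F ⊆ E ∧ F.card = e} with G ⊆ F.1, b F.1 =
      ∑ F ∈ E.powersetCard e with G ⊆ F, b F := by
  refine Finset.sum_bij (fun F _ => F.1) ?_ ?_ ?_ ?_
  · intro F hF
    simpa [Finset.mem_powersetCard, F.2.1, F.2.2] using hF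
  · intro F _ F' _ h; exact Subtype.ext h
  · intro F hF
    simp only [Finset.mem_filter, Finset.mem_powersetCard] at hF
    exact ⟨⟨F, hF.1⟩, by simpa using hF.2, rfl⟩
  · intro F _; rfl

section Step
variable {K σ B : Type*} [Field K] [DecidableEq σ] [CommRing B]
  [Algebra B (MvPolynomial σ K)]

lemma exists_mem_diagIdeal_insert_iff_dvd {Q : Finset σ} {j m : σ} (hm : m ∈ Q) (hj : j ∉ Q)
    (hQ : Function.Bijective (algebraMap B (MvPolynomial σ K ⧸ diagIdeal K Q))) :
    ∃ l : B, l ≠ 0 ∧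
      ∀ b, algebraMap B (MvPolynomial σ K) b ∈ diagIdeal K (insert j Q) ↔ l ∣ b := by
  obtain ⟨l, hl⟩ := hQ.2 (Ideal.Quotient.mk _ (X j - X m))
  refine ⟨l, ?_, fun b => ?_⟩
  · rintro rfl
    rw [map_zero, eq_comm, Ideal.Quotient.eq_zero_iff_mem] at hl
    exact X_sub_X_notMem_diagIdeal hj hm hl
  · rw [diagIdeal_insert hm]
    constructor
    · intro h
      obtain ⟨y, hy, z, hz, hyz⟩ := Submodule.mem_sup.mp h
      obtain ⟨c, rfl⟩ := Ideal.mem_span_singleton.mp hz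
      obtain ⟨c', hc'⟩ := hQ.2 (Ideal.Quotient.mk _ c)
      refine ⟨c', hQ.1 ?_⟩
      rw [map_mul, hl, hc', ← map_mul, IsScalarTower.algebraMap_apply B (MvPolynomial σ K),
        Ideal.Quotient.algebraMap_eq, ← hyz, map_add, Ideal.Quotient.eq_zero_iff_mem.mpr hy,
        zero_add]
    · rintro ⟨c, rfl⟩
      have h1 : algebraMap B (MvPolynomial σ K) l - (X j - X m) ∈ diagIdeal K Q := by
        rw [← Ideal.Quotient.eq, ← hl]; rfl
      rw [map_mul, ← sub_add_cancel (algebraMap B (MvPolynomial σ K) l) (X j - X m)]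
      exact Ideal.mul_mem_right _ _ (add_mem (Ideal.mem_sup_left h1)
        (Ideal.mem_sup_right (Ideal.mem_span_singleton_self _)))

omit [DecidableEq σ] in
lemma diagIdeal_isPrime [IsDomain B] {Q : Finset σ}
    (hQ : Function.Bijective (algebraMap B (MvPolynomial σ K ⧸ diagIdeal K Q))) :
    (diagIdeal K Q).IsPrime := by
  rw [← Ideal.Quotient.isDomain_iff_prime]
  exact (RingEquiv.ofBijective _ hQ).symm.toMulEquiv.isDomain B

variable [Fintype σ] [CharZero K] [Algebra K B] [IsDomain B]

lemma spechtIdealOn_insert_finite_and_projective {E : Finset σ} {m : σ} (hm : m ∉ E) {e k : ℕ}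
    (hk : E.card + 1 = e + k) (he : 2 * e + 1 ≤ E.card)
    (hB : ∀ Q : Finset σ, Q.card = k →
      Function.Bijective (algebraMap B (MvPolynomial σ K ⧸ diagIdeal K Q)))
    [Module.Finite B (MvPolynomial σ K ⧸ spechtIdealOn K E e)]
    [Module.Projective B (MvPolynomial σ K ⧸ spechtIdealOn K E e)] :
    Module.Finite B (MvPolynomial σ K ⧸ spechtIdealOn K (insert m E) (e + 1)) ∧
      Module.Projective B (MvPolynomial σ K ⧸ spechtIdealOn K (insert m E) (e + 1)) := by
  have hE : 2 * e ≤ E.card := by omega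
  let C := {F : Finset σ // F ⊆ E ∧ F.card = e}
  let C' := {G : Finset σ // G ⊆ E ∧ G.card + 1 = e}
  have hcard : ∀ G ⊆ E, (insert m (E \ G)).card = E.card - G.card + 1 := fun G hG => by
    rw [Finset.card_insert_of_notMem (by simp [hm]), Finset.card_sdiff_of_subset hG]
  have hF : ∀ F : C, Function.Bijective
      (algebraMap B (MvPolynomial σ K ⧸ diagIdeal K (insert m (E \ F.1)))) := fun F =>
    hB _ (by rw [hcard _ F.2.1, F.2.2]; omega)
  have hprime : ∀ F : C, (diagIdeal K (insert m (E \ F.1))).IsPrime := fun F =>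
    diagIdeal_isPrime (hF F)
  have hmono : ∀ {G F : Finset σ}, G ⊆ F →
      diagIdeal K (insert m (E \ F)) ≤ diagIdeal K (insert m (E \ G)) := fun h =>
    diagIdeal_mono (Finset.insert_subset_insert _ (Finset.sdiff_subset_sdiff le_rfl h))
  have hG : ∀ G : C', ∃ l : B, l ≠ 0 ∧ ∀ b,
      algebraMap B (MvPolynomial σ K) b ∈ diagIdeal K (insert m (E \ G.1)) ↔ l ∣ b := by
    rintro ⟨G, hGE, hGe⟩
    obtain ⟨j, hj⟩ : (E \ G).Nonempty := by
      rw [← Finset.card_pos, Finset.card_sdiff_of_subset hGE]; omega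
    rw [Finset.mem_sdiff] at hj
    have hjm : j ≠ m := by rintro rfl; exact hm hj.1
    have h1 : insert m (E \ G) = insert j (insert m (E \ insert j G)) := by
      ext i
      by_cases hij : i = j
      · subst hij; simp [hj]
      · simp [hij]
    rw [h1]
    exact exists_mem_diagIdeal_insert_iff_dvd (Finset.mem_insert_self _ _) (by simp [hjm])
      (hF ⟨insert j G, Finset.insert_subset hj.1 hGE,
        by rw [Finset.card_insert_of_notMem hj.2, hGe]⟩)
  choose l hl0 hl using hG
  let D : (C → B) →ₗ[B] (C' → B) := LinearMap.pi fun G =>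
    ∑ F : C with G.1 ⊆ F.1, LinearMap.proj F
  have hD : ∀ b G, D b G = ∑ F : C with G.1 ⊆ F.1, b F := fun b G => by simp [D]
  choose v hv using fun H : C' => exists_sum_superset_eq_single (K := K) (X := E) (e := e)
    (by omega) (H := H.1) H.2
  let s : (C' → B) →ₗ[B] (C → B) := LinearMap.pi fun F =>
    ∑ H : C', algebraMap K B (v H F.1) • LinearMap.proj H
  have hDs : ∀ c, D (s c) = c := by
    intro c
    ext G
    rw [hD]
    simp only [s, LinearMap.pi_apply, LinearMap.sum_apply, LinearMap.smul_apply,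
      LinearMap.proj_apply, smul_eq_mul]
    rw [Finset.sum_comm]
    simp only [← Finset.sum_mul, ← map_sum]
    rw [Finset.sum_eq_single G]
    · rw [sum_subtype_superset_eq E e (v G), hv G G.1 G.2, if_pos rfl, map_one, one_mul]
    · intro H _ hH
      rw [sum_subtype_superset_eq E e (v H), hv H G.1 G.2,
        if_neg (fun h => hH (Subtype.ext h.symm)), map_zero, zero_mul]
    · simp
  obtain ⟨hUf, hUp⟩ := dvdSubmodule_finite_and_projective D s hDs l hl0
  set I := spechtIdealOn K (insert m E) (e + 1)
  set J := spechtIdealOn K E e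
  have hIJ : I ≤ J := spechtIdealOn_insert_le
  let M := (harmonicPoly K E e).restrictScalars B
  let g : M →ₗ[B] MvPolynomial σ K ⧸ I := (Ideal.Quotient.mkₐ B I).toLinearMap ∘ₗ
    (shiftPairing K m).restrictScalars B ∘ₗ M.subtype
  have hg : ∀ p, g p = Ideal.Quotient.mk I (shiftPairing K m p.1) := fun p => rfl
  let eF : ∀ F : C, B ≃ₗ[B] MvPolynomial σ K ⧸ diagIdeal K (insert m (E \ F.1)) := fun F =>
    LinearEquiv.ofBijective (Algebra.linearMap B _) (hF F)
  have heF : ∀ F b, eF F b = Ideal.Quotient.mk _ (algebraMap B (MvPolynomial σ K) b) :=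
    fun F b => rfl
  let h : M →ₗ[B] (C → B) := LinearMap.pi fun F => (eF F).symm.toLinearMap ∘ₗ
    (Ideal.Quotient.mkₐ B _).toLinearMap ∘ₗ LinearMap.proj F.1 ∘ₗ M.subtype
  have hh : ∀ (p : M) (F : C), h p F = (eF F).symm (Ideal.Quotient.mk _ (p.1 F.1)) :=
    fun p F => rfl
  have hmem : ∀ (p : M) (F : C), algebraMap B (MvPolynomial σ K) (h p F) - p.1 F.1 ∈
      diagIdeal K (insert m (E \ F.1)) := fun p F => by
    rw [← Ideal.Quotient.eq, ← heF, hh, LinearEquiv.apply_symm_apply]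
  have hker : LinearMap.ker g = LinearMap.ker h := by
    ext p
    rw [LinearMap.mem_ker, LinearMap.mem_ker, hg, Ideal.Quotient.eq_zero_iff_mem]
    have h0 : h p = 0 ↔ ∀ F : C, p.1 F.1 ∈ diagIdeal K (insert m (E \ F.1)) := by
      rw [funext_iff]
      refine forall_congr' fun F => ?_
      rw [hh, Pi.zero_apply, LinearEquiv.map_eq_zero_iff, Ideal.Quotient.eq_zero_iff_mem]
    rw [h0]
    constructor
    · intro hp F
      have := hprime F
      exact mem_diagIdeal_of_shiftPairing_mem hm p.2.1 hp F.2.1 F.2.2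
    · intro hp
      exact shiftPairing_mem_of_forall_mem hm he p.2 fun F hF hFe => hp ⟨F, hF, hFe⟩
  have hrange : LinearMap.range h = dvdSubmodule D l := by
    ext b
    constructor
    · rintro ⟨p, rfl⟩ G
      rw [← hl, hD, map_sum]
      have h1 : ∑ F : C with G.1 ⊆ F.1, p.1 F.1 = 0 := by
        rw [sum_subtype_superset_eq E e p.1]; exact p.2.2 G.1 G.2.1 G.2.2
      rw [← sub_zero (∑ F : C with G.1 ⊆ F.1, _), ← h1, ← Finset.sum_sub_distrib]
      exact sum_mem fun F hF => hmono (by simpa using hF) (hmem p F)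
    · intro hb
      let c : Finset σ → MvPolynomial σ K := fun F =>
        if hF : F ⊆ E ∧ F.card = e then algebraMap B _ (b ⟨F, hF⟩) else 0
      have hc : ∀ F : C, c F.1 = algebraMap B _ (b F) := fun F => dif_pos F.2
      obtain ⟨p, hp, hpc⟩ := exists_harmonicPoly_sub_mem hm hE c (by
        intro G hG hGe
        have := (hl ⟨G, hG, hGe⟩ _).mpr (hb ⟨G, hG, hGe⟩)
        rw [hD, map_sum] at this
        rw [← sum_subtype_superset_eq]
        simpa only [hc] using this)
      refine ⟨⟨p, hp⟩, ?_⟩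
      ext F
      rw [hh, LinearEquiv.symm_apply_eq, heF, Ideal.Quotient.eq, ← hc]
      exact hpc F.1 F.2.1 F.2.2
  let f : (MvPolynomial σ K ⧸ I) →ₗ[B] MvPolynomial σ K ⧸ J :=
    (Ideal.Quotient.factorₐ B hIJ).toLinearMap
  have hf : ∀ x, f (Ideal.Quotient.mk I x) = Ideal.Quotient.mk J x := fun x => rfl
  have hkerf : LinearMap.ker f = LinearMap.range g := by
    ext y
    obtain ⟨x, rfl⟩ := Ideal.Quotient.mk_surjective y
    rw [LinearMap.mem_ker, hf, Ideal.Quotient.eq_zero_iff_mem]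
    constructor
    · intro hx
      obtain ⟨p, hp, rfl⟩ := (mem_spechtIdealOn_iff hm hE).mp hx
      exact ⟨⟨p, hp⟩, rfl⟩
    · rintro ⟨p, hp⟩
      rw [hg, Ideal.Quotient.eq] at hp
      have h1 := (mem_spechtIdealOn_iff hm hE).mpr ⟨p.1, p.2, rfl⟩
      have h2 := sub_mem h1 (hIJ hp)
      rwa [sub_sub_cancel] at h2
  obtain ⟨eq1⟩ := LinearMap.exists_equiv_range_of_ker_eq g h hker
  let eq2 : LinearMap.ker f ≃ₗ[B] dvdSubmodule D l :=
    LinearEquiv.ofEq _ _ hkerf ≪≫ₗ eq1 ≪≫ₗ LinearEquiv.ofEq _ _ hrange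
  have : Module.Finite B (LinearMap.ker f) := Module.Finite.equiv eq2.symm
  have : Module.Projective B (LinearMap.ker f) := Module.Projective.of_equiv eq2.symm
  refine LinearMap.finite_and_projective_of_surjective_of_ker f fun y => ?_
  obtain ⟨x, rfl⟩ := Ideal.Quotient.mk_surjective y
  exact ⟨Ideal.Quotient.mk I x, hf x⟩

theorem spechtIdealOn_finite_and_projective {k : ℕ}
    (hB : ∀ Q : Finset σ, Q.card = k →
      Function.Bijective (algebraMap B (MvPolynomial σ K ⧸ diagIdeal K Q))) (d : ℕ) :
    ∀ E : Finset σ, 2 * d ≤ E.card → E.card + 1 = d + k →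
      Module.Finite B (MvPolynomial σ K ⧸ spechtIdealOn K E d) ∧
        Module.Projective B (MvPolynomial σ K ⧸ spechtIdealOn K E d) := by
  induction d with
  | zero =>
    intro E _ _
    have : Subsingleton (MvPolynomial σ K ⧸ spechtIdealOn K E 0) :=
      Ideal.Quotient.subsingleton_iff.mpr (spechtIdealOn_zero E)
    exact ⟨inferInstance, inferInstance⟩
  | succ e ih =>
    intro E hE hk
    obtain ⟨m, hm⟩ : E.Nonempty := Finset.card_pos.mp (by omega)
    have hc := Finset.card_erase_add_one hm
    obtain ⟨h1, h2⟩ := ih (E.erase m) (by omega) (by omega)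
    have := spechtIdealOn_insert_finite_and_projective (E := E.erase m) (m := m) (by simp)
      (e := e) (k := k) (by omega) (by omega) hB
    rwa [Finset.insert_erase hm] at this

end Step

lemma IsNoetherianRing.injective_of_surjective_ringHom {B : Type*} [CommRing B]
    [IsNoetherianRing B] (f : B →+* B) (hf : Function.Surjective f) : Function.Injective f := by
  have hmono : Monotone fun n : ℕ => RingHom.ker (f ^ n) := by
    refine monotone_nat_of_le_succ fun n x hx => ?_
    rw [RingHom.mem_ker] at hx ⊢
    rw [pow_succ', RingHom.mul_def, RingHom.comp_apply, hx, map_zero]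
  obtain ⟨n, hn⟩ := monotone_stabilizes_iff_noetherian.mpr ‹IsNoetherianRing B› ⟨_, hmono⟩
  have hker : RingHom.ker (f ^ n) = RingHom.ker (f ^ (n + 1)) := hn (n + 1) n.le_succ
  have hsurj : Function.Surjective (f ^ n) := by
    rw [RingHom.coe_pow]; exact hf.iterate n
  refine (injective_iff_map_eq_zero f).mpr fun x hx => ?_
  obtain ⟨y, rfl⟩ := hsurj x
  rw [← RingHom.mem_ker, hker, RingHom.mem_ker, pow_succ', RingHom.mul_def, RingHom.comp_apply, hx]

lemma Submodule.exists_forall_sup_span_range_eq_top {K V ι : Type*} [Field K] [Infinite K]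
    [AddCommGroup V] [Module K V] [FiniteDimensional K V] [Finite ι] (r : ℕ) :
    ∀ W : ι → Submodule K V, (∀ q, Module.finrank K V ≤ Module.finrank K (W q) + r) →
      ∃ t : Fin r → V, ∀ q, W q ⊔ Submodule.span K (Set.range t) = ⊤ := by
  induction r with
  | zero =>
    refine fun W hW => ⟨Fin.elim0, fun q => ?_⟩
    rw [Submodule.eq_top_of_finrank_eq (le_antisymm (Submodule.finrank_le _) (hW q)), top_sup_eq]
  | succ r ih =>
    intro W hW
    obtain ⟨x, hx⟩ : ∃ x : V, ∀ q, W q ≠ ⊤ → x ∉ W q := by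
      by_contra! h
      obtain ⟨q, hq⟩ := Subspace.exists_eq_top_of_iUnion_eq_univ
        (p := fun q : {q // W q ≠ ⊤} => W q.1) (Set.eq_univ_of_forall fun x => by
          obtain ⟨q, hq, hx⟩ := h x
          exact Set.mem_iUnion.mpr ⟨⟨q, hq⟩, hx⟩)
      exact q.2 hq
    obtain ⟨t, ht⟩ := ih (fun q => W q ⊔ Submodule.span K {x}) fun q => by
      by_cases hq : W q = ⊤
      · rw [hq, top_sup_eq, finrank_top]
        exact Nat.le_add_right _ _
      · have hlt : W q < W q ⊔ Submodule.span K {x} := by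
          refine lt_of_le_of_ne le_sup_left fun he => hx q hq ?_
          rw [he]
          exact Submodule.mem_sup_right (Submodule.mem_span_singleton_self x)
        have := Submodule.finrank_lt_finrank_of_lt hlt
        have := hW q
        omega
    refine ⟨Fin.cons x t, fun q => ?_⟩
    rw [Fin.range_cons, Submodule.span_insert, ← sup_assoc, ht]

section Generic
variable {K σ : Type*} [Field K] [DecidableEq σ] [Fintype σ]

/-- The coefficient vectors of the linear forms in the ideal `diagIdeal K Q`. -/
def diagSubmodule (K : Type*) {σ : Type*} [Field K] [DecidableEq σ] (Q : Finset σ) :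
    Submodule K (σ → K) :=
  Submodule.span K {c | ∃ i ∈ Q, ∃ j ∈ Q, c = Pi.single i 1 - Pi.single j 1}

lemma card_le_finrank_diagSubmodule_add {Q : Finset σ} {r : ℕ} (hQ : Q.Nonempty)
    (hr : Q.card + r = Fintype.card σ + 1) :
    Module.finrank K (σ → K) ≤ Module.finrank K (diagSubmodule K Q) + r := by
  classical
  obtain ⟨m, hm⟩ := hQ
  set S : Finset (σ → K) := (insert m Qᶜ).image fun i => Pi.single i (1 : K) with hS
  have htop : diagSubmodule K Q ⊔ Submodule.span K (S : Set (σ → K)) = ⊤ := by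
    rw [eq_top_iff, ← (Pi.basisFun K σ).span_eq, Submodule.span_le]
    rintro _ ⟨i, rfl⟩
    rw [Pi.basisFun_apply, SetLike.mem_coe]
    have hmem : ∀ j ∈ insert m Qᶜ, (Pi.single j 1 : σ → K) ∈
        diagSubmodule K Q ⊔ Submodule.span K (S : Set (σ → K)) := fun j hj =>
      Submodule.mem_sup_right (Submodule.subset_span
        (Finset.mem_coe.mpr (Finset.mem_image_of_mem _ hj)))
    by_cases hi : i ∈ Q
    · rw [← sub_add_cancel (Pi.single i 1 : σ → K) (Pi.single m 1)]
      exact add_mem (Submodule.mem_sup_left (Submodule.subset_span ⟨i, hi, m, hm, rfl⟩))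
        (hmem m (Finset.mem_insert_self _ _))
    · exact hmem i (Finset.mem_insert_of_mem (Finset.mem_compl.mpr hi))
  have h1 := Submodule.finrank_add_le_finrank_add_finrank (diagSubmodule K Q)
    (Submodule.span K (S : Set (σ → K)))
  rw [htop, finrank_top] at h1
  have h2 := finrank_span_finset_le_card (R := K) S
  rw [Set.finrank] at h2
  have h3 : S.card ≤ (insert m Qᶜ).card := Finset.card_image_le
  have h4 : (insert m Qᶜ).card ≤ Qᶜ.card + 1 := Finset.card_insert_le _ _
  have h5 := Finset.card_add_card_compl Q
  omega

lemma aeval_linearCombination_mk_surjective {Q : Finset σ} {r : ℕ} {t : Fin r → σ → K}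
    (ht : diagSubmodule K Q ⊔ Submodule.span K (Set.range t) = ⊤) :
    Function.Surjective ((Ideal.Quotient.mkₐ K (diagIdeal K Q)).comp
      (aeval fun j => Fintype.linearCombination K (X : σ → MvPolynomial σ K) (t j))) := by
  set Θ := (Ideal.Quotient.mkₐ K (diagIdeal K Q)).comp
      (aeval fun j => Fintype.linearCombination K (X : σ → MvPolynomial σ K) (t j)) with hΘ
  have hle : (⊤ : Submodule K (σ → K)) ≤ (Subalgebra.toSubmodule Θ.range).comap
      ((Ideal.Quotient.mkₐ K (diagIdeal K Q)).toLinearMap ∘ₗ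
        Fintype.linearCombination K (X : σ → MvPolynomial σ K)) := by
    rw [← ht]
    refine sup_le (Submodule.span_le.mpr ?_) (Submodule.span_le.mpr ?_)
    · rintro _ ⟨i, hi, j, hj, rfl⟩
      have : Ideal.Quotient.mkₐ K (diagIdeal K Q) (X i - X j) = 0 :=
        Ideal.Quotient.eq_zero_iff_mem.mpr (X_sub_X_mem_diagIdeal hi hj)
      simp only [SetLike.mem_coe, Submodule.mem_comap, LinearMap.comp_apply, map_sub,
        Fintype.linearCombination_apply_single, one_smul, AlgHom.toLinearMap_apply]
      rw [← map_sub, this]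
      exact zero_mem _
    · rintro _ ⟨j, rfl⟩
      exact ⟨X j, by simp [hΘ]⟩
  rw [← AlgHom.range_eq_top, eq_top_iff]
  have hX : ∀ i, Ideal.Quotient.mkₐ K (diagIdeal K Q) (X i) ∈ Θ.range := fun i => by
    have := hle (Submodule.mem_top (x := Pi.single i 1))
    simpa [Fintype.linearCombination_apply_single] using this
  rintro y -
  obtain ⟨p, rfl⟩ := Ideal.Quotient.mkₐ_surjective K (diagIdeal K Q) y
  induction p using MvPolynomial.induction_on with
  | C a => exact Θ.range.algebraMap_mem a
  | add p q hp hq => rw [map_add]; exact add_mem hp hq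
  | mul_X p i hp => rw [map_mul]; exact mul_mem hp (hX i)

lemma exists_surjective_quotient_diagIdeal {Q : Finset σ} {r : ℕ} (hQ : Q.Nonempty)
    (hr : Q.card + r = Fintype.card σ + 1) :
    ∃ ψ : MvPolynomial σ K ⧸ diagIdeal K Q →+* MvPolynomial (Fin r) K, Function.Surjective ψ := by
  obtain ⟨m, hm⟩ := hQ
  have hcard : (insert m Qᶜ).card = r := by
    have := Finset.card_add_card_compl Q
    rw [Finset.card_insert_of_notMem (by simpa using hm)]
    omega
  let e := (insert m Qᶜ).equivFinOfCardEq hcard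
  let c : σ → Fin r := fun i => if h : i ∈ insert m Qᶜ then e ⟨i, h⟩ else e ⟨m, by simp⟩
  have hc : Function.Surjective c := fun j => ⟨(e.symm j).1, by simp only [c]; simp⟩
  have hcQ : ∀ i ∈ Q, c i = e ⟨m, by simp⟩ := fun i hi => by
    simp only [c]
    split_ifs with h
    · have : i = m := by simpa [hi] using h
      subst this; rfl
    · rfl
  refine ⟨Ideal.Quotient.lift _ (rename c).toRingHom ?_,
    Ideal.Quotient.lift_surjective_of_surjective _ _ (rename_surjective c hc)⟩
  have : diagIdeal K Q ≤ RingHom.ker (rename (R := K) c).toRingHom := by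
    refine Ideal.span_le.mpr ?_
    rintro _ ⟨i, hi, j, hj, rfl⟩
    simp [RingHom.mem_ker, hcQ i hi, hcQ j hj]
  exact fun a ha => this ha

lemma exists_linear_aeval_bijective [Infinite K] {k r : ℕ} (hk : 1 ≤ k)
    (hr : k + r = Fintype.card σ + 1) :
    ∃ t : Fin r → MvPolynomial σ K, ∀ Q : Finset σ, Q.card = k →
      Function.Bijective ((Ideal.Quotient.mkₐ K (diagIdeal K Q)).comp (aeval t)) := by
  have hne : ∀ Q : Finset σ, Q.card = k → Q.Nonempty := fun Q hQ =>
    Finset.card_pos.mp (by omega)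
  obtain ⟨t, ht⟩ := Submodule.exists_forall_sup_span_range_eq_top r
    (fun Q : {Q : Finset σ // Q.card = k} => diagSubmodule K Q.1) fun Q =>
      card_le_finrank_diagSubmodule_add (hne Q.1 Q.2) (by rw [Q.2, hr])
  refine ⟨fun j => Fintype.linearCombination K X (t j), fun Q hQ => ?_⟩
  have hsurj := aeval_linearCombination_mk_surjective (ht ⟨Q, hQ⟩)
  obtain ⟨ψ, hψ⟩ := exists_surjective_quotient_diagIdeal (K := K) (hne Q hQ) (by rw [hQ, hr])
  refine ⟨?_, hsurj⟩
  exact Function.Injective.of_comp (f := ψ) (IsNoetherianRing.injective_of_surjective_ringHom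
    (ψ.comp (AlgHom.toRingHom _)) (hψ.comp hsurj))

end Generic

section Tableaux
variable {K : Type*} [Field K]

lemma isSpechtFun_of_injective {σ : Type*} [DecidableEq σ] [Fintype σ] :
    ∀ {d : ℕ} (a b : Fin d → σ), Function.Injective (Sum.elim a b) →
      ∃ T v, IsSpechtFun K T d v ∧
        (∏ c, (X (a c) - X (b c)) : MvPolynomial σ K) = evalFun X v ∧
        ∀ i ∈ T, i ∈ Set.range (Sum.elim a b)
  | 0, _, _, _ => ⟨∅, _, .one, by simp [evalFun_one], by simp⟩
  | d + 1, a, b, hab => by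
    have hinj : Function.Injective (Sum.elim (a ∘ Fin.succ) (b ∘ Fin.succ)) := by
      rw [← Sum.elim_comp_map]
      exact hab.comp ((Fin.succ_injective d).sumMap (Fin.succ_injective d))
    obtain ⟨T, v, hv, hprod, hT⟩ := isSpechtFun_of_injective _ _ hinj
    have hTs : ∀ i ∈ T, ∃ s : Fin d ⊕ Fin d,
        Sum.elim a b (Sum.map Fin.succ Fin.succ s) = i := fun i hi => by
      obtain ⟨s, hs⟩ := hT i hi
      refine ⟨s, ?_⟩
      rw [← hs, ← Sum.elim_comp_map]; rfl
    have ha : a 0 ∉ T := fun h => by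
      obtain ⟨s, hs⟩ := hTs _ h
      have := hab (hs.trans (Sum.elim_inl a b 0).symm)
      rcases s with s | s <;> simp [Fin.succ_ne_zero] at this
    have hb : b 0 ∉ T := fun h => by
      obtain ⟨s, hs⟩ := hTs _ h
      have := hab (hs.trans (Sum.elim_inr a b 0).symm)
      rcases s with s | s <;> simp [Fin.succ_ne_zero] at this
    have hne : a 0 ≠ b 0 := fun h =>
      Sum.inl_ne_inr (hab (h : Sum.elim a b (.inl 0) = Sum.elim a b (.inr 0)))
    refine ⟨_, _, .mul ha hb hne hv, ?_, fun i hi => ?_⟩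
    · rw [Fin.prod_univ_succ, hv.evalFun_mul _ ha hb, ← hprod]; rfl
    · rcases Finset.mem_insert.mp hi with rfl | hi
      · exact ⟨.inl 0, rfl⟩
      rcases Finset.mem_insert.mp hi with rfl | hi
      · exact ⟨.inr 0, rfl⟩
      · exact (hTs i hi).imp' (Sum.map Fin.succ Fin.succ) fun _ h => h

lemma IsSpechtFun.exists_injective {σ : Type*} [DecidableEq σ] [Fintype σ] {T : Finset σ} {d : ℕ}
    {v : Finset σ → K} (h : IsSpechtFun K T d v) :
    ∃ a b : Fin d → σ, Function.Injective (Sum.elim a b) ∧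
      (∏ c, (X (a c) - X (b c)) : MvPolynomial σ K) = evalFun X v ∧
      (∀ c, a c ∈ T) ∧ ∀ c, b c ∈ T := by
  induction h with
  | one => exact ⟨Fin.elim0, Fin.elim0, Function.injective_of_subsingleton _,
      by simp [evalFun_one], fun c => c.elim0, fun c => c.elim0⟩
  | @mul T d v i j hi hj hij h ih =>
    obtain ⟨a, b, hab, hprod, ha, hb⟩ := ih
    refine ⟨Fin.cons i a, Fin.cons j b, ?_, ?_, ?_, ?_⟩
    · rw [Sum.elim_injective] at hab ⊢
      obtain ⟨h1, h2, h3⟩ := hab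
      refine ⟨Fin.cons_injective_iff.mpr ⟨?_, h1⟩, Fin.cons_injective_iff.mpr ⟨?_, h2⟩, ?_⟩
      · rintro ⟨c, rfl⟩; exact hi (ha c)
      · rintro ⟨c, rfl⟩; exact hj (hb c)
      · intro c c'
        refine Fin.cases ?_ (fun c => ?_) c <;> refine Fin.cases ?_ (fun c' => ?_) c'
        · simpa using hij
        · simp only [Fin.cons_zero, Fin.cons_succ]
          exact fun h => hi (h ▸ hb c')
        · simp only [Fin.cons_zero, Fin.cons_succ]
          exact fun h => hj (h ▸ ha c)
        · simpa using h3 c c'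
    · rw [Fin.prod_univ_succ, h.evalFun_mul _ hi hj, ← hprod]; rfl
    · exact fun c => Fin.cases (by simp) (fun c => by simp [ha c]) c
    · exact fun c => Fin.cases (by simp) (fun c => by simp [hb c]) c

/-- The Specht polynomial of a two-row tableau in terms of the entries of its full columns. -/
lemma spechtPoly_eq_prod {n d : ℕ} {T : Fin n → ℕ × ℕ} (hT : IsTableau [n - d, d] T)
    {a b : Fin d → Fin n} (ha : ∀ c, T (a c) = (0, c.1)) (hb : ∀ c, T (b c) = (1, c.1)) :
    spechtPoly K T = ∏ c, (X (a c) - X (b c)) := by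
  obtain ⟨hinj, hbox, -⟩ := hT
  rw [spechtPoly]
  refine (Finset.prod_bij (fun c _ => (a c, b c)) ?_ ?_ ?_ ?_).symm
  · intro c _; simp [ha, hb]
  · intro c _ c' _ h
    have := congrArg T (Prod.ext_iff.mp h).1
    rw [ha, ha] at this
    exact Fin.ext (Prod.ext_iff.mp this).2
  · rintro ⟨i, j⟩ hij
    simp only [Finset.mem_filter, Finset.mem_univ, true_and] at hij
    have hj := hbox j
    simp only [List.length_cons, List.length_nil] at hj
    have hj1 : (T j).1 = 1 := by omega
    have hi0 : (T i).1 = 0 := by omega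
    have hjd : (T j).2 < d := by simpa [hj1] using hj.2
    refine ⟨⟨(T j).2, hjd⟩, Finset.mem_univ _, ?_⟩
    refine Prod.ext (hinj ?_) (hinj ?_)
    · rw [ha]; exact Prod.ext hi0.symm hij.1.symm
    · rw [hb]; exact Prod.ext hj1.symm rfl
  · intro c _; rfl

lemma exists_isTableau {n d : ℕ} (hdn : 2 * d ≤ n) (a b : Fin d → Fin n)
    (hab : Function.Injective (Sum.elim a b)) :
    ∃ T : Fin n → ℕ × ℕ, IsTableau [n - d, d] T ∧
      (∀ c, T (a c) = (0, c.1)) ∧ ∀ c, T (b c) = (1, c.1) := by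
  let g : Fin (n - d) ⊕ Fin d → ℕ × ℕ := Sum.elim (fun c => (0, c.1)) fun c => (1, c.1)
  have hg : Function.Injective g := by
    rw [Sum.elim_injective]
    exact ⟨fun c c' h => Fin.ext (Prod.ext_iff.mp h).2, fun c c' h => Fin.ext (Prod.ext_iff.mp h).2,
      fun c c' h => by simp at h⟩
  let ι : Fin d ⊕ Fin d → Fin (n - d) ⊕ Fin d := Sum.map (Fin.castLE (by omega)) id
  have hι : Function.Injective ι := (Fin.castLE_injective _).sumMap Function.injective_id
  obtain ⟨e, he⟩ : ∃ e : Fin (n - d) ⊕ Fin d ≃ Fin n, ∀ s, e (ι s) = Sum.elim a b s := by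
    have e₀ : Fin (n - d) ⊕ Fin d ≃ Fin n := Fintype.equivOfCardEq (by simp; omega)
    have hι' := e₀.injective.comp hι
    let p := (Equiv.ofInjective _ hι').symm.trans (Equiv.ofInjective _ hab)
    refine ⟨e₀.trans p.extendSubtype, fun s => ?_⟩
    refine (p.extendSubtype_apply_of_mem _ ⟨s, rfl⟩).trans ?_
    exact congrArg (fun s => Sum.elim a b s) (Equiv.ofInjective_symm_apply hι' s)
  have hTa : ∀ s, g (e.symm (Sum.elim a b s)) = g (ι s) := fun s => by
    rw [← he, Equiv.symm_apply_apply]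
  refine ⟨g ∘ e.symm, ⟨hg.comp e.symm.injective, fun i => ?_, fun r c hr hc => ?_⟩,
    fun c => hTa (.inl c), fun c => hTa (.inr c)⟩
  · rw [Function.comp_apply]
    rcases e.symm i with c | c <;> simp [g]
  · have hr' : r = 0 ∨ r = 1 := by
      simp only [List.length_cons, List.length_nil] at hr; omega
    rcases hr' with rfl | rfl
    · exact ⟨e (.inl ⟨c, by simpa using hc⟩), by simp [g]⟩
    · exact ⟨e (.inr ⟨c, by simpa using hc⟩), by simp [g]⟩

lemma spechtIdeal_eq_spechtIdealOn {n d : ℕ} (hdn : 2 * d ≤ n) :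
    spechtIdeal K n [n - d, d] = spechtIdealOn K (Finset.univ : Finset (Fin n)) d := by
  rw [spechtIdeal, spechtIdealOn]
  congr 1
  ext f
  constructor
  · rintro ⟨T, hT, rfl⟩
    choose a ha using fun c : Fin d => hT.2.2 0 c (by simp) (by simp; omega)
    choose b hb using fun c : Fin d => hT.2.2 1 c (by simp) (by simp)
    have hab : Function.Injective (Sum.elim a b) := by
      rw [Sum.elim_injective]
      refine ⟨fun c c' h => ?_, fun c c' h => ?_, fun c c' h => ?_⟩
      · have := congrArg T h
        rw [ha, ha] at this
        exact Fin.ext (Prod.ext_iff.mp this).2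
      · have := congrArg T h
        rw [hb, hb] at this
        exact Fin.ext (Prod.ext_iff.mp this).2
      · have := congrArg T h
        rw [ha, hb] at this
        simp at this
    obtain ⟨S, v, hv, hprod, -⟩ := isSpechtFun_of_injective (K := K) a b hab
    exact ⟨S, Finset.subset_univ S, v, hv, (spechtPoly_eq_prod hT ha hb).trans hprod⟩
  · rintro ⟨S, -, v, hv, rfl⟩
    obtain ⟨a, b, hab, hprod, -, -⟩ := hv.exists_injective
    obtain ⟨T, hT, ha, hb⟩ := exists_isTableau hdn a b hab
    exact ⟨T, hT, by rw [← hprod, spechtPoly_eq_prod hT ha hb]⟩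

end Tableaux

/-- Corollary 4.1: if `char K = 0`, then `R/I^Sp_{(n-d, d)}` is Cohen–Macaulay. -/
theorem specht_two_rows_CM {K : Type*} [Field K] [CharZero K] (n d : ℕ)
    (hd : 1 ≤ d) (hdn : 2 * d ≤ n) :
    IsCohenMacaulayRing (MvPolynomial (Fin n) K ⧸ spechtIdeal K n [n - d, d]) := by
  obtain ⟨t, ht⟩ := exists_linear_aeval_bijective (K := K) (σ := Fin n) (k := n + 1 - d) (r := d)
    (by omega) (by rw [Fintype.card_fin]; omega)
  let : Algebra (MvPolynomial (Fin d) K) (MvPolynomial (Fin n) K) := (aeval t).toRingHom.toAlgebra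
  obtain ⟨hfin, hproj⟩ := spechtIdealOn_finite_and_projective (K := K)
    (B := MvPolynomial (Fin d) K) (k := n + 1 - d) ht d (Finset.univ : Finset (Fin n))
    (by simpa using hdn) (by rw [Finset.card_univ, Fintype.card_fin]; omega)
  rw [spechtIdeal_eq_spechtIdealOn hdn]
  exact IsCohenMacaulayRing.of_finite_of_flat (MvPolynomial (Fin d) K) _
end
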